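/- arXiv:math/0611547 — 4 statements merged into one kernel-verified Lean document; each statement's English description precedes it below -/
import Mathlib

section
/- For every irreducible complex character χ of G (including the trivial character), Γ(χ) = Σ_{ℓ∈{2,3,7}} (χ(1) − dim χ^{H_ℓ})/2; in particular Γ(χ) is a nonnegative integer and is independent of the choice of the injective characters θ_ℓ. -/
open scoped BigOperators Classical

noncomputable section

/-- The projective special linear group `PSL(2, F) = SL(2, F)/{±I}` (for `F` a finite
field of odd characteristic the center of `SL(2,F)` is exactly `{±I}`). -/
abbrev PSL2 (F : Type) [Field F] : Type :=
  Matrix.SpecialLinearGroup (Fin 2) F ⧸ Subgroup.center (Matrix.SpecialLinearGroup (Fin 2) F)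

/-- `χ` is the character of some finite-dimensional complex representation of `G`. -/
def IsCharacter (G : Type) [Group G] (χ : G → ℂ) : Prop :=
  ∃ V : FDRep ℂ G, V.character = χ

/-- `χ` is an irreducible complex character of `G`. -/
def IsIrrCharacter (G : Type) [Group G] (χ : G → ℂ) : Prop :=
  ∃ V : FDRep ℂ G, CategoryTheory.Simple V ∧ V.character = χ

/-- `⟨χ|_H, θ⟩ = (1/|H|) ∑_{h ∈ H} χ(h) θ(h)⁻¹`, the multiplicity of the linear
character `θ` of `H` in the restriction `χ|_H`. -/
def restMult {G : Type} [Group G] [Finite G] (H : Subgroup G) (θ : H →* ℂˣ) (χ : G → ℂ) : ℂ :=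
  letI : Fintype H := Fintype.ofFinite H
  (Nat.card H : ℂ)⁻¹ * ∑ h : H, χ h * ((θ h : ℂ))⁻¹

/-- `dim χ^H = (1/|H|) ∑_{h ∈ H} χ(h)`, the dimension of the `H`-fixed subspace. -/
def dimFixed {G : Type} [Group G] [Finite G] (H : Subgroup G) (χ : G → ℂ) : ℂ :=
  letI : Fintype H := Fintype.ofFinite H
  (Nat.card H : ℂ)⁻¹ * ∑ h : H, χ h

/-- The ramification multiplicity
`Γ(χ) = (1/2)⟨χ|_{H₂},θ₂⟩ + (1/3)(⟨χ|_{H₃},θ₃⟩ + 2⟨χ|_{H₃},θ₃²⟩)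
  + (1/7)∑_{k=1}^{6} k ⟨χ|_{H₇},θ₇^k⟩`. -/
def ramMult {G : Type} [Group G] [Finite G] (H2 H3 H7 : Subgroup G)
    (θ2 : H2 →* ℂˣ) (θ3 : H3 →* ℂˣ) (θ7 : H7 →* ℂˣ) (χ : G → ℂ) : ℂ :=
  (1/2) * restMult H2 θ2 χ
    + (1/3) * (restMult H3 θ3 χ + 2 * restMult H3 (θ3 ^ 2) χ)
    + (1/7) * ∑ k ∈ Finset.Icc (1:ℕ) 6, (k : ℂ) * restMult H7 (θ7 ^ k) χ

/-- The base multiplicity `m = (q−ε₂)/4 + (q−ε₃)/3 + 3(q−ε₇)/7`, where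
`ε_ℓ = 1` if `q ≡ 1 (mod ℓ')` and `ε_ℓ = −1` otherwise. -/
def baseMult (q : ℕ) : ℤ :=
  ((q : ℤ) - (if q % 4 = 1 then 1 else -1)) / 4
    + ((q : ℤ) - (if q % 3 = 1 then 1 else -1)) / 3
    + 3 * (((q : ℤ) - (if q % 7 = 1 then 1 else -1)) / 7)

end

/-- The multiplicity of a linear character of `H` in the restriction of a character of `G` is a
natural number. -/
theorem exists_nat_restMult {G : Type} [Group G] [Finite G] (H : Subgroup G) (θ : H →* ℂˣ)
    {V : Type*} [AddCommGroup V] [Module ℂ V] [FiniteDimensional ℂ V]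
    (ρ : Representation ℂ G V) : ∃ n : ℕ, restMult H θ ρ.character = n := by
  let σ : Representation ℂ H V :=
    { toFun := fun h => ((θ h)⁻¹ : ℂˣ) • ρ h
      map_one' := by rw [map_one, Subgroup.coe_one, map_one, inv_one, one_smul]
      map_mul' := fun a b => by
        rw [map_mul, Subgroup.coe_mul, map_mul, mul_inv, smul_mul_smul_comm] }
  have : Fintype H := Fintype.ofFinite H
  have : Invertible (Nat.card H : ℂ) := invertibleOfNonzero (by exact_mod_cast Nat.card_pos.ne')
  refine ⟨_, Eq.trans ?_ (Representation.card_inv_mul_sum_char_eq_finrank σ)⟩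
  unfold restMult
  congr 1
  refine Finset.sum_congr (by ext; simp) fun h _ => ?_
  have h1 : σ.character h = LinearMap.trace ℂ V (((θ h : ℂ)⁻¹) • ρ h) := by
    simp [Representation.character, σ, Units.smul_def]
  rw [h1, map_smul, smul_eq_mul, mul_comm]
  rfl

theorem restMult_pow_zero {G : Type} [Group G] [Finite G] (H : Subgroup G) (θ : H →* ℂˣ)
    (χ : G → ℂ) : restMult H (θ ^ 0) χ = dimFixed H χ := by
  simp [restMult, dimFixed]

theorem restMult_pow_one {G : Type} [Group G] [Finite G] (H : Subgroup G) (θ : H →* ℂˣ)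
    (χ : G → ℂ) : restMult H (θ ^ 1) χ = restMult H θ χ := by
  simp [restMult]

theorem sum_restMult_pow {G : Type} [Group G] [Finite G] (H : Subgroup G) (θ : H →* ℂˣ)
    (hθ : Function.Injective θ) (χ : G → ℂ) :
    ∑ k ∈ Finset.range (Nat.card H), restMult H (θ ^ k) χ = χ 1 := by
  have hcard : (Nat.card H : ℂ) ≠ 0 := by exact_mod_cast Nat.card_pos.ne'
  let inst : Fintype H := Fintype.ofFinite H
  unfold restMult
  rw [← Finset.mul_sum, Finset.sum_comm, inv_mul_eq_iff_eq_mul₀ hcard,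
    Finset.sum_eq_single (1 : H)]
  · simp
  · intro h _ hne
    have hroot : (θ h : ℂ)⁻¹ ≠ 1 := by
      rw [ne_eq, inv_eq_one, Units.val_eq_one]
      exact fun e => hne (hθ (by rw [e, map_one]))
    have hpow : ((θ h : ℂ)⁻¹) ^ Nat.card H = 1 := by
      rw [inv_pow, ← Units.val_pow_eq_pow_val, ← map_pow, pow_card_eq_one']
      simp
    have := geom_sum_eq hroot (Nat.card H)
    rw [hpow, sub_self, zero_div] at this
    simp only [MonoidHom.pow_apply, Units.val_pow_eq_pow_val, ← inv_pow]
    rw [← Finset.mul_sum, this, mul_zero]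
  · simp

theorem restMult_pow_eq_of_add_eq {G : Type} [Group G] [Finite G] (H : Subgroup G) (θ : H →* ℂˣ)
    (χ : G → ℂ) (hχ : ∀ h ∈ H, χ h⁻¹ = χ h) {a b : ℕ} (hab : a + b = Nat.card H) :
    restMult H (θ ^ a) χ = restMult H (θ ^ b) χ := by
  unfold restMult
  congr 1
  let inst : Fintype H := Fintype.ofFinite H
  refine Fintype.sum_equiv (Equiv.inv H) _ _ fun h => ?_
  have hpow : θ h ^ a * θ h ^ b = 1 := by
    rw [← pow_add, hab, ← map_pow, pow_card_eq_one', map_one]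
  have hinv : (θ ^ a) h = ((θ ^ b) h)⁻¹ := eq_inv_of_mul_eq_one_left hpow
  rw [Equiv.inv_apply, Subgroup.coe_inv, hχ h h.2, map_inv, hinv]

theorem exists_sum_eq_and_prod_eq_of_forall_eq_one_or_neg_one (s : Multiset ℂ)
    (hs : ∀ x ∈ s, x = 1 ∨ x = -1) :
    ∃ k : ℕ, s.sum = s.card - 2 * k ∧ s.prod = (-1) ^ k := by
  induction s using Multiset.induction_on with
  | empty => exact ⟨0, by simp⟩
  | cons a s ih =>
    obtain ⟨k, h1, h2⟩ := ih fun x hx => hs x (Multiset.mem_cons_of_mem hx)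
    rcases hs a (Multiset.mem_cons_self a s) with rfl | rfl
    · exact ⟨k, by simp [h1]; ring, by simp [h2]⟩
    · exact ⟨k + 1, by simp [h1]; ring, by simp [h2, pow_succ]⟩

/-- The multiplicity of the eigenvalue `-1` of an involution of determinant one is even. -/
theorem exists_trace_eq_of_sq_eq_one {V : Type*} [AddCommGroup V] [Module ℂ V]
    [FiniteDimensional ℂ V] (f : Module.End ℂ V) (hf : f ^ 2 = 1) (hdet : LinearMap.det f = 1) :
    ∃ n : ℕ, LinearMap.trace ℂ V f = Module.finrank ℂ V - 4 * n := by
  let b := Module.finBasis ℂ V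
  have hs : ∀ x ∈ f.charpoly.roots, x = 1 ∨ x = -1 := by
    intro x hx
    have hx' := (Module.End.hasEigenvalue_iff_isRoot_charpoly f x).2
      (Polynomial.isRoot_of_mem_roots hx)
    obtain ⟨v, hv⟩ := hx'.exists_hasEigenvector
    have := hv.pow_apply 2
    rw [hf, Module.End.one_apply] at this
    have h2 : (x ^ 2 - 1) • v = 0 := by rw [sub_smul, ← this, one_smul, sub_self]
    have := (smul_eq_zero.1 h2).resolve_right hv.2
    exact sq_eq_one_iff.1 (sub_eq_zero.1 this)
  obtain ⟨k, h1, h2⟩ := exists_sum_eq_and_prod_eq_of_forall_eq_one_or_neg_one _ hs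
  have hsplit : f.charpoly.Splits := IsAlgClosed.splits _
  have hcard : f.charpoly.roots.card = Module.finrank ℂ V := by
    rw [← hsplit.natDegree_eq_card_roots, LinearMap.charpoly_natDegree]
  have htr : LinearMap.trace ℂ V f = f.charpoly.roots.sum := by
    rw [LinearMap.trace_eq_matrix_trace ℂ b, Matrix.trace_eq_sum_roots_charpoly,
      LinearMap.charpoly_toMatrix]
  have hd : LinearMap.det f = f.charpoly.roots.prod := by
    rw [← LinearMap.det_toMatrix b, Matrix.det_eq_prod_roots_charpoly,
      LinearMap.charpoly_toMatrix]
  have hk : Even k := by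
    rw [hdet, h2] at hd
    exact (neg_one_pow_eq_one_iff_even (by norm_num)).1 hd.symm
  obtain ⟨n, rfl⟩ := hk
  exact ⟨n, by rw [htr, h1, hcard]; push_cast; ring⟩

open Matrix in
theorem exists_conj_eq_inv_of_discr_ne_zero {F : Type*} [Field F] [Fintype F]
    (hodd : Odd (Fintype.card F)) (A : SpecialLinearGroup (Fin 2) F)
    (hD : (A 0 0 - A 1 1) ^ 2 + 4 * A 0 1 * A 1 0 ≠ 0) :
    ∃ B : SpecialLinearGroup (Fin 2) F, B * A * B⁻¹ = A⁻¹ := by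
  obtain ⟨x, y, z, hdet, htr⟩ : ∃ x y z : F, -x ^ 2 - y * z = 1 ∧
      x * (A 0 0 - A 1 1) + y * A 1 0 + z * A 0 1 = 0 := by
    generalize A 0 0 = a, A 0 1 = b, A 1 0 = c, A 1 1 = d at hD
    obtain ⟨u, w, huw⟩ : ∃ u w : F, u ^ 2 - ((a - d) ^ 2 + 4 * b * c) * w ^ 2 = -1 := by
      obtain ⟨u, w, h⟩ := FiniteField.exists_root_sum_quadratic (R := F)
        (f := Polynomial.X ^ 2 + 1)
        (g := Polynomial.C (-((a - d) ^ 2 + 4 * b * c)) * Polynomial.X ^ 2)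
        (by compute_degree!) (by rw [Polynomial.degree_C_mul_X_pow _ (neg_ne_zero.2 hD)]; rfl)
        (Nat.odd_iff.1 hodd)
      refine ⟨u, w, ?_⟩
      simp at h
      linear_combination h
    by_cases hc : c = 0
    · by_cases hb : b = 0
      · exact ⟨0, 1, -1, by ring, by simp [hb, hc]⟩
      · refine ⟨u + w * (a - d), 2 * b * w, -((u + w * (a - d)) * (a - d)) / b - 2 * w * c, ?_, ?_⟩
        · field_simp
          linear_combination (-1) * huw
        · field_simp
          ring
    · refine ⟨u + w * (a - d), -((u + w * (a - d)) * (a - d)) / c - 2 * w * b, 2 * c * w, ?_, ?_⟩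
      · field_simp
        linear_combination (-1) * huw
      · field_simp
        ring
  let B : SpecialLinearGroup (Fin 2) F :=
    ⟨!![x, y; z, -x], by rw [det_fin_two_of]; linear_combination hdet⟩
  have hB : (B : Matrix (Fin 2) (Fin 2) F) = !![x, y; z, -x] := rfl
  refine ⟨B, ?_⟩
  rw [mul_inv_eq_iff_eq_mul]
  ext i j
  have hA := A.det_coe
  rw [det_fin_two] at hA
  fin_cases i <;> fin_cases j <;>
    simp [hB, Matrix.mul_apply, adjugate_fin_two, Fin.sum_univ_two] <;>
    first
    | linear_combination htr
    | linear_combination (-1) * htr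
    | ring

open Matrix in
theorem pow_card_mem_center_of_discr_eq_zero {F : Type*} [Field F] [Fintype F]
    (hodd : Odd (Fintype.card F)) (A : SpecialLinearGroup (Fin 2) F)
    (hD : (A 0 0 - A 1 1) ^ 2 + 4 * A 0 1 * A 1 0 = 0) :
    A ^ Fintype.card F ∈ Subgroup.center (SpecialLinearGroup (Fin 2) F) := by
  obtain ⟨p, hp⟩ := CharP.exists F
  obtain ⟨n, hprime, hcard⟩ := FiniteField.card F p
  have := Fact.mk hprime
  have h2 : (2 : F) ≠ 0 := by
    intro h
    have : p ∣ 2 := by rw [← CharP.cast_eq_zero_iff F p]; exact_mod_cast h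
    rw [(Nat.prime_dvd_prime_iff_eq hprime Nat.prime_two).1 this] at hcard
    rw [hcard] at hodd
    exact (Nat.not_odd_iff_even.2 ((Nat.even_pow.2 ⟨even_two, n.ne_zero⟩))) hodd
  set t : F := (A 0 0 + A 1 1) / 2 with ht
  set N : Matrix (Fin 2) (Fin 2) F := (A : Matrix (Fin 2) (Fin 2) F) - scalar (Fin 2) t with hN
  have hN2 : N ^ 2 = 0 := by
    ext i j
    rw [pow_two, mul_apply, Fin.sum_univ_two]
    fin_cases i <;> fin_cases j <;> simp [N, ht] <;> field_simp <;>
      first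
      | linear_combination hD
      | ring
  have hA : (A : Matrix (Fin 2) (Fin 2) F) ^ Fintype.card F
      = scalar (Fin 2) (t ^ Fintype.card F) := by
    have h1 : (A : Matrix (Fin 2) (Fin 2) F) = scalar (Fin 2) t + N := by rw [hN]; abel
    rw [h1, hcard, add_pow_char_pow_of_commute _ _ (scalar_commute t (fun r => Commute.all t r) N),
      map_pow]
    have h2 : 2 ≤ p ^ (n : ℕ) := by
      rw [← hcard]; exact Fintype.one_lt_card
    rw [pow_eq_zero_of_le h2 hN2, add_zero]
  rw [Subgroup.mem_center_iff]
  intro B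
  apply Subtype.ext
  change (B : Matrix (Fin 2) (Fin 2) F) * (A : Matrix (Fin 2) (Fin 2) F) ^ Fintype.card F
    = (A : Matrix (Fin 2) (Fin 2) F) ^ Fintype.card F * B
  rw [hA]
  exact (scalar_commute _ (fun r => Commute.all _ r) _).symm

theorem PSL2.isConj_inv_of_pow_eq_one {F : Type} [Field F] [Fintype F]
    (hodd : Odd (Fintype.card F)) {n : ℕ} (hn : (Fintype.card F).Coprime n) (g : PSL2 F)
    (hg : g ^ n = 1) : IsConj g g⁻¹ := by
  induction g using QuotientGroup.induction_on with
  | H A =>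
    by_cases hD : (A 0 0 - A 1 1) ^ 2 + 4 * A 0 1 * A 1 0 = 0
    · have h1 : (A : PSL2 F) ^ Fintype.card F = 1 := by
        rw [← QuotientGroup.mk_pow, QuotientGroup.eq_one_iff]
        exact pow_card_mem_center_of_discr_eq_zero hodd A hD
      have h2 : (A : PSL2 F) = 1 := by
        rw [← orderOf_eq_one_iff]
        exact Nat.eq_one_of_dvd_coprimes hn (orderOf_dvd_of_pow_eq_one h1)
          (orderOf_dvd_of_pow_eq_one hg)
      rw [h2, inv_one]
    · obtain ⟨B, hB⟩ := exists_conj_eq_inv_of_discr_ne_zero hodd A hD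
      rw [isConj_iff]
      refine ⟨(B : PSL2 F), ?_⟩
      exact congrArg (QuotientGroup.mk' _) hB

open Matrix in
/-- Homomorphisms from `SL₂` of a finite field to a commutative group have exponent dividing the
cardinality of the field, because `SL₂` is generated by transvections. -/
theorem Matrix.SpecialLinearGroup.map_pow_card_eq_one {F M : Type*} [Field F] [Fintype F]
    [CommGroup M] (f : SpecialLinearGroup (Fin 2) F →* M) (A : SpecialLinearGroup (Fin 2) F) :
    f A ^ Fintype.card F = 1 := by
  induction A using SL2.transvection_induction with
  | htransvec i j hij a =>
    have hpow : ∀ n : ℕ, transvection hij a ^ n = transvection hij (n * a) := by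
      intro n
      induction n with
      | zero => simp
      | succ n ih => rw [pow_succ, ih, ← transvection_add]; push_cast; ring_nf
    rw [← map_pow, hpow, FiniteField.cast_card_eq_zero, zero_mul, transvection_coeff_zero, map_one]
  | hmul A B hA hB => rw [map_mul, mul_pow, hA, hB, one_mul]

theorem PSL2.det_eq_one_of_sq_eq_one {F : Type} [Field F] [Fintype F]
    (hodd : Odd (Fintype.card F)) {V : Type*} [AddCommGroup V] [Module ℂ V]
    (ρ : Representation ℂ (PSL2 F) V) (g : PSL2 F) (hg : g ^ 2 = 1) :
    LinearMap.det (ρ g) = 1 := by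
  induction g using QuotientGroup.induction_on with
  | H A =>
    let f : PSL2 F →* ℂˣ := (LinearMap.det.comp ρ).toHomUnits
    have h1 : f A ^ Fintype.card F = 1 :=
      Matrix.SpecialLinearGroup.map_pow_card_eq_one (f.comp (QuotientGroup.mk' _)) A
    have h2 : f A ^ 2 = 1 := by rw [← map_pow, hg, map_one]
    have h3 : f A = 1 := by
      rw [← orderOf_eq_one_iff]
      exact Nat.eq_one_of_dvd_coprimes (Nat.coprime_two_right.2 hodd)
        (orderOf_dvd_of_pow_eq_one h1) (orderOf_dvd_of_pow_eq_one h2)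
    exact congrArg Units.val h3

theorem ramification_module_rational_formula
    (q : ℕ) (hq : IsPrimePow q) (hgcd : Nat.Coprime q 42)
    (hq7 : q % 7 = 1 ∨ q % 7 = 6)
    (F : Type) [Field F] [Fintype F] (hF : Fintype.card F = q)
    (H2 H3 H7 : Subgroup (PSL2 F))
    (hH2 : Nat.card H2 = 2) (hH3 : Nat.card H3 = 3) (hH7 : Nat.card H7 = 7)
    (θ2 : H2 →* ℂˣ) (θ3 : H3 →* ℂˣ) (θ7 : H7 →* ℂˣ)
    (hθ2 : Function.Injective θ2) (hθ3 : Function.Injective θ3)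
    (hθ7 : Function.Injective θ7)
    (χ : PSL2 F → ℂ) (hχ : IsIrrCharacter (PSL2 F) χ)
    :
    ramMult H2 H3 H7 θ2 θ3 θ7 χ =
      ((χ 1 - dimFixed H2 χ) + (χ 1 - dimFixed H3 χ) + (χ 1 - dimFixed H7 χ)) / 2 ∧
    ∃ n : ℕ, ramMult H2 H3 H7 θ2 θ3 θ7 χ = (n : ℂ) := by
  obtain ⟨V, -, rfl⟩ := hχ
  subst hF
  have hodd : Odd (Fintype.card F) :=
    Nat.coprime_two_right.1 (hgcd.coprime_dvd_right (by norm_num))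
  have hreal : ∀ H : Subgroup (PSL2 F), (Fintype.card F).Coprime (Nat.card H) →
      ∀ h ∈ H, V.character h⁻¹ = V.character h := by
    intro H hH h hh
    obtain ⟨g, hg⟩ := isConj_iff.1 (PSL2.isConj_inv_of_pow_eq_one hodd hH h
      (congrArg Subtype.val (pow_card_eq_one' (x := (⟨h, hh⟩ : H)))))
    rw [← hg, FDRep.char_conj]
  have hr3 := hreal H3 (by rw [hH3]; exact hgcd.coprime_dvd_right (by norm_num))
  have hr7 := hreal H7 (by rw [hH7]; exact hgcd.coprime_dvd_right (by norm_num))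
  have s2 := sum_restMult_pow H2 θ2 hθ2 V.character
  have s3 := sum_restMult_pow H3 θ3 hθ3 V.character
  have s7 := sum_restMult_pow H7 θ7 hθ7 V.character
  simp only [hH2, hH3, hH7, Finset.sum_range_succ, Finset.sum_range_zero, zero_add,
    restMult_pow_zero, restMult_pow_one] at s2 s3 s7
  have e3 := restMult_pow_eq_of_add_eq H3 θ3 _ hr3 (a := 1) (b := 2) (by rw [hH3])
  have e16 := restMult_pow_eq_of_add_eq H7 θ7 _ hr7 (a := 1) (b := 6) (by rw [hH7])
  have e25 := restMult_pow_eq_of_add_eq H7 θ7 _ hr7 (a := 2) (b := 5) (by rw [hH7])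
  have e34 := restMult_pow_eq_of_add_eq H7 θ7 _ hr7 (a := 3) (b := 4) (by rw [hH7])
  rw [restMult_pow_one] at e3 e16
  obtain ⟨n2, hn2⟩ : ∃ n : ℕ, restMult H2 θ2 V.character = 2 * n := by
    obtain ⟨t, ht⟩ : ∃ t : H2, t ≠ 1 := by
      have : Nontrivial H2 := by
        rw [← Finite.one_lt_card_iff_nontrivial, hH2]; norm_num
      exact exists_ne 1
    have ht2 : (t : PSL2 F) ^ 2 = 1 := by
      have := pow_card_eq_one' (x := t)
      rw [hH2] at this
      simpa using congrArg Subtype.val this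
    obtain ⟨n, hn⟩ := exists_trace_eq_of_sq_eq_one (V.ρ t) (by rw [← map_pow, ht2, map_one])
      (PSL2.det_eq_one_of_sq_eq_one hodd V.ρ t ht2)
    refine ⟨n, ?_⟩
    have hdim : dimFixed H2 V.character = 2⁻¹ * (V.character 1 + V.character t) := by
      let inst : Fintype H2 := Fintype.ofFinite H2
      have huniv : (Finset.univ : Finset H2) = {1, t} := by
        refine (Finset.eq_of_subset_of_card_le (Finset.subset_univ _) ?_).symm
        rw [Finset.card_pair ht.symm, Finset.card_univ, ← Nat.card_eq_fintype_card, hH2]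
      unfold dimFixed
      rw [huniv, Finset.sum_pair ht.symm, hH2]
      simp
    have hn' : V.character t = V.character 1 - 4 * n := by
      rw [FDRep.char_one]; exact hn
    linear_combination s2 - hdim - 2⁻¹ * hn'
  obtain ⟨n3, hn3⟩ := exists_nat_restMult H3 θ3 V.ρ
  obtain ⟨m1, hm1⟩ := exists_nat_restMult H7 θ7 V.ρ
  obtain ⟨m2, hm2⟩ := exists_nat_restMult H7 (θ7 ^ 2) V.ρ
  obtain ⟨m3, hm3⟩ := exists_nat_restMult H7 (θ7 ^ 3) V.ρ
  change restMult H3 θ3 V.character = _ at hn3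
  change restMult H7 θ7 V.character = _ at hm1
  change restMult H7 (θ7 ^ 2) V.character = _ at hm2
  change restMult H7 (θ7 ^ 3) V.character = _ at hm3
  have hram : ramMult H2 H3 H7 θ2 θ3 θ7 V.character = n2 + n3 + (m1 + m2 + m3) := by
    unfold ramMult
    rw [show Finset.Icc (1 : ℕ) 6 = {1, 2, 3, 4, 5, 6} from rfl]
    simp [restMult_pow_one, ← e3, ← e16, ← e25, ← e34, hn2, hn3, hm1, hm2, hm3]
    ring
  refine ⟨?_, n2 + n3 + (m1 + m2 + m3), by rw [hram]; push_cast; rfl⟩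
  rw [← e3, hn3] at s3
  rw [← e16, ← e25, ← e34, hm1, hm2, hm3] at s7
  rw [hn2] at s2
  rw [hram]
  linear_combination 2⁻¹ * s2 + 2⁻¹ * s3 + 2⁻¹ * s7
end

section
/- If χ is an irreducible complex character of G with χ(1) = q (the Steinberg character), then Γ(χ) = m. -/
open scoped BigOperators Classical

theorem FDRep.isIrreducible_of_simple {k : Type} [Field k] {G : Type} [Group G]
    (V : FDRep k G) [CategoryTheory.Simple V] : Representation.IsIrreducible V.ρ := by
  have hV : ¬ CategoryTheory.Limits.IsZero V := CategoryTheory.Simple.not_isZero V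
  have : Nontrivial V := by
    by_contra hs
    rw [not_nontrivial_iff_subsingleton] at hs
    apply hV
    rw [CategoryTheory.Limits.IsZero.iff_id_eq_zero]
    ext x
    exact Subsingleton.elim (α := V) _ _
  have hbt : (⊥ : Subrepresentation V.ρ) ≠ ⊤ := by
    intro h
    have h2 : (⊥ : Submodule k V) = ⊤ := congrArg Subrepresentation.toSubmodule h
    exact bot_ne_top h2
  refine { exists_pair_ne := ⟨_, _, hbt⟩, eq_bot_or_eq_top := fun W => ?_ }
  let i : FDRep.of W.toRepresentation ⟶ V :=
    FDRep.forget₂HomLinearEquiv _ _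
      (Rep.ofHom ⟨W.toSubmodule.subtype, fun g => by ext x; rfl⟩)
  have hi : ∀ x : W.toSubmodule, (i : FDRep.of W.toRepresentation → V) x = (x : V) := fun x => rfl
  have : CategoryTheory.Mono i := CategoryTheory.ConcreteCategory.mono_of_injective _
    (fun x y h => Subtype.ext h)
  by_cases h0 : i = 0
  · left
    apply Subrepresentation.toSubmodule_injective
    refine (Submodule.eq_bot_iff _).2 fun x hx => ?_
    have := hi ⟨x, hx⟩
    rw [h0] at this
    exact this.symm
  · right
    have := CategoryTheory.isIso_of_mono_of_nonzero h0
    apply Subrepresentation.toSubmodule_injective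
    refine Submodule.eq_top_iff'.2 fun x => ?_
    have h3 := (FDRep.isoToLinearEquiv (CategoryTheory.asIso i)).apply_symm_apply x
    rw [← h3]
    exact Subtype.property (p := (· ∈ W.toSubmodule)) ((FDRep.isoToLinearEquiv (CategoryTheory.asIso i)).symm x)

theorem Module.End.isIntegral_trace_of_pow_eq_one {V : Type*} [AddCommGroup V] [Module ℂ V]
    [FiniteDimensional ℂ V] {A : Module.End ℂ V} {n : ℕ} (hn : 0 < n) (hA : A ^ n = 1) :
    IsIntegral ℤ (LinearMap.trace ℂ V A) := by
  rw [Module.End.trace_eq_sum_roots_charpoly_of_splits (IsAlgClosed.splits _)]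
  refine IsIntegral.multiset_sum fun μ hμ => ?_
  refine IsIntegral.of_pow hn ?_
  have he : A.HasEigenvalue μ := by
    rw [Module.End.hasEigenvalue_iff_isRoot_charpoly]
    exact (Polynomial.mem_roots'.1 hμ).2
  obtain ⟨v, hv⟩ := he.exists_hasEigenvector
  have h := hv.pow_apply n
  rw [hA, Module.End.one_apply] at h
  have : μ ^ n = 1 := by
    have h2 : (μ ^ n - 1) • v = 0 := by rw [sub_smul, ← h, one_smul, sub_self]
    exact sub_eq_zero.1 ((smul_eq_zero.1 h2).resolve_right hv.2)
  rw [this]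
  exact isIntegral_one

theorem Representation.trace_eq_card_fixed_sub_one_of_permutes {G V Ω : Type*} [Group G]
    [AddCommGroup V] [Module ℂ V] [FiniteDimensional ℂ V] (ρ : Representation ℂ G V)
    [Fintype Ω] [Nonempty Ω] (σ : G →* Equiv.Perm Ω) (u : Ω → V)
    (hspan : Submodule.span ℂ (Set.range u) = ⊤)
    (hrel : ∀ a : Ω → ℂ, ∑ x, a x • u x = 0 ↔ ∀ x y, a x = a y)
    (hperm : ∀ g x, ρ g (u x) = u (σ g x)) (g : G) :
    LinearMap.trace ℂ V (ρ g) = (Fintype.card {x // σ g x = x} : ℂ) - 1 := by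
  obtain ⟨x₀⟩ := ‹Nonempty Ω›
  let L : (Ω → ℂ) →ₗ[ℂ] V := Fintype.linearCombination ℂ u
  have hL : ∀ c, L c = ∑ x, c x • u x := fun c => Fintype.linearCombination_apply ℂ u c
  have hsurj : LinearMap.range L = ⊤ := by
    rw [← hspan]; exact Fintype.range_linearCombination ℂ u
  obtain ⟨s, hs⟩ := L.exists_rightInverse_of_surjective hsurj
  let P : (Ω → ℂ) →ₗ[ℂ] (Ω → ℂ) := LinearMap.funLeft ℂ ℂ (σ g).symm
  have hLP : ρ g ∘ₗ L = L ∘ₗ P := by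
    ext1 c
    ext1
    simp only [LinearMap.comp_apply, hL, map_sum, map_smul, hperm, P, LinearMap.funLeft_apply]
    exact Fintype.sum_equiv (σ g) _ _ fun x => by simp
  let φ : (Ω → ℂ) →ₗ[ℂ] ℂ := LinearMap.proj x₀ ∘ₗ (LinearMap.id - s ∘ₗ L)
  have hφ : ∀ c, c - s (L c) = φ c • (1 : Ω → ℂ) := by
    intro c
    have h0 : L (c - s (L c)) = 0 := by
      rw [map_sub, sub_eq_zero]
      exact (LinearMap.congr_fun hs (L c)).symm
    rw [hL, hrel] at h0
    ext x
    simpa [φ] using h0 x x₀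
  have hL1 : L 1 = 0 := by rw [hL, hrel]; simp
  have hsL : P ∘ₗ (s ∘ₗ L) = P - φ.smulRight (1 : Ω → ℂ) := by
    refine LinearMap.ext fun c => ?_
    have h1 : s (L c) = c - φ c • (1 : Ω → ℂ) := by rw [← hφ]; abel
    have hP1 : P 1 = 1 := by ext; simp [P, LinearMap.funLeft_apply]
    rw [LinearMap.comp_apply, LinearMap.comp_apply, h1, map_sub, map_smul, hP1,
      LinearMap.sub_apply, LinearMap.smulRight_apply]
  calc LinearMap.trace ℂ V (ρ g) = LinearMap.trace ℂ V ((ρ g ∘ₗ L) ∘ₗ s) := by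
        rw [LinearMap.comp_assoc, hs, LinearMap.comp_id]
    _ = LinearMap.trace ℂ _ (P ∘ₗ (s ∘ₗ L)) := by
        rw [hLP, LinearMap.comp_assoc, LinearMap.trace_comp_comm', LinearMap.comp_assoc]
    _ = LinearMap.trace ℂ _ P - 1 := by
        rw [hsL, map_sub, LinearMap.trace_smulRight]
        simp [φ, hL1]
    _ = _ := by
        congr 1
        rw [LinearMap.trace_eq_matrix_trace ℂ (Pi.basisFun ℂ Ω), Matrix.trace]
        simp only [Matrix.diag_apply, LinearMap.toMatrix_apply, Pi.basisFun_apply,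
          Pi.basisFun_repr, P, LinearMap.funLeft_apply, Pi.single_apply,
          _root_.Equiv.symm_apply_eq, Finset.sum_boole, Fintype.card_subtype]
        simp only [eq_comm]

/-- If a perfect group permutes transitively `dim V + 1` lines spanning `V`, then the character of
`V` is the permutation character minus one. -/
theorem Representation.trace_eq_card_fixed_sub_one {G V Ω : Type*} [Group G]
    [AddCommGroup V] [Module ℂ V] [FiniteDimensional ℂ V] (ρ : Representation ℂ G V)
    [Fintype Ω] [Nonempty Ω] (σ : G →* Equiv.Perm Ω) (hperf : ∀ f : G →* ℂˣ, f = 1)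
    (hdim : Module.finrank ℂ V + 1 = Fintype.card Ω) (htrans : ∀ x y, ∃ g, σ g x = y)
    (w : Ω → V) (hspan : Submodule.span ℂ (Set.range w) = ⊤) (hw0 : ∀ x, w x ≠ 0)
    (hmono : ∀ g x, ∃ μ : ℂ, ρ g (w x) = μ • w (σ g x)) (g : G) :
    LinearMap.trace ℂ V (ρ g) = (Fintype.card {x // σ g x = x} : ℂ) - 1 := by
  have hinj : ∀ g v, ρ g v = 0 → v = 0 := fun g v h => by
    have := congrArg (ρ g⁻¹) h
    simpa [← Module.End.mul_apply, ← map_mul] using this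
  choose μ hμ using hmono
  have hμ0 : ∀ g x, μ g x ≠ 0 := fun g x h => by
    have h1 := hμ g x
    rw [h, zero_smul] at h1
    exact hw0 x (hinj g _ h1)
  let L : (Ω → ℂ) →ₗ[ℂ] V := Fintype.linearCombination ℂ w
  have hL : ∀ c, L c = ∑ x, c x • w x := fun c => Fintype.linearCombination_apply ℂ w c
  have hsurj : LinearMap.range L = ⊤ := by
    rw [← hspan]; exact Fintype.range_linearCombination ℂ w
  have hker : Module.finrank ℂ (LinearMap.ker L) = 1 := by
    have h := L.finrank_range_add_finrank_ker
    rw [hsurj, finrank_top, Module.finrank_pi] at h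
    omega
  obtain ⟨⟨c, hc⟩, hc0, hcs⟩ := finrank_eq_one_iff'.1 hker
  have hcs' : ∀ a, L a = 0 → ∃ r : ℂ, r • c = a := fun a ha => by
    obtain ⟨r, hr⟩ := hcs ⟨a, ha⟩
    exact ⟨r, congrArg Subtype.val hr⟩
  have hc0' : c ≠ 0 := fun h => hc0 (Subtype.ext h)
  have hδ : ∀ g, ∃ δ : ℂ, ∀ x, c x * μ g x = δ * c (σ g x) := fun g => by
    obtain ⟨r, hr⟩ := hcs' (fun y => c ((σ g).symm y) * μ g ((σ g).symm y)) (by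
      rw [hL, ← Equiv.sum_comp (σ g)]
      have h : ρ g (L c) = 0 := by rw [hc, map_zero]
      rw [hL, map_sum] at h
      rw [← h]
      refine Finset.sum_congr rfl fun x _ => ?_
      simp [hμ, mul_smul])
    refine ⟨r, fun x => ?_⟩
    simpa using (congrFun hr (σ g x)).symm
  choose δ hδ using hδ
  obtain ⟨x₀, hx₀⟩ : ∃ x, c x ≠ 0 := by
    by_contra! h
    exact hc0' (funext h)
  have hcx : ∀ x, c x ≠ 0 := fun x h => by
    obtain ⟨g, rfl⟩ := htrans x₀ x
    have h1 := hδ g x₀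
    rw [h, mul_zero] at h1
    exact mul_ne_zero hx₀ (hμ0 _ _) h1
  have hu : ∀ g x, ρ g (c x • w x) = δ g • (c (σ g x) • w (σ g x)) := fun g x => by
    rw [map_smul, hμ, smul_smul, hδ, mul_smul]
  have hu0 : ∀ x, c x • w x ≠ 0 := fun x => smul_ne_zero (hcx x) (hw0 x)
  have hδ0 : ∀ g, δ g ≠ 0 := fun g h => by
    have h1 := hδ g x₀
    rw [h, zero_mul] at h1
    exact mul_ne_zero hx₀ (hμ0 _ _) h1
  have hcancel : ∀ (a b : ℂ) x, a • (c x • w x) = b • (c x • w x) → a = b := fun a b x h =>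
    smul_left_injective ℂ (hu0 x) h
  let f : G →* ℂˣ := MonoidHom.mk' (fun g => Units.mk0 (δ g) (hδ0 g)) fun g h => by
    ext
    refine hcancel _ _ (σ (g * h) x₀) ?_
    simp only [Units.val_mk0, Units.val_mul]
    rw [← hu, map_mul, Module.End.mul_apply, hu, map_smul, hu, map_mul, Equiv.Perm.mul_apply,
      smul_smul, mul_comm (δ g)]
  have hδ1 : ∀ g, δ g = 1 := fun g => by
    have := congrArg (fun F : G →* ℂˣ => (F g : ℂ)) (hperf f)
    simpa [f] using this
  refine ρ.trace_eq_card_fixed_sub_one_of_permutes σ (fun x => c x • w x) ?_ ?_ ?_ g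
  · rw [eq_top_iff, ← hspan, Submodule.span_le]
    rintro _ ⟨x, rfl⟩
    have : w x = (c x)⁻¹ • (c x • w x) := by rw [smul_smul, inv_mul_cancel₀ (hcx x), one_smul]
    rw [this]
    exact Submodule.smul_mem _ _ (Submodule.subset_span ⟨x, rfl⟩)
  · intro a
    simp only [smul_smul]
    rw [← hL (fun x => a x * c x)]
    constructor
    · intro h x y
      obtain ⟨r, hr⟩ := hcs' _ h
      have key : ∀ x, r = a x := fun x => mul_right_cancel₀ (hcx x) (congrFun hr x)
      rw [← key, ← key]
    · intro h
      have : (fun x => a x * c x) = a x₀ • c := by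
        ext x; simp [h x x₀]
      rw [this, map_smul, hc, smul_zero]
  · intro g x
    rw [hu, hδ1, one_smul]

/-- An irreducible representation of a perfect group with an eigenvector of a point stabilizer in
a transitive action on `dim V + 1` points affords the permutation character minus one. -/
theorem Representation.trace_eq_card_fixed_sub_one_of_stabilizer {G V Ω : Type*} [Group G]
    [AddCommGroup V] [Module ℂ V] [FiniteDimensional ℂ V] (ρ : Representation ℂ G V)
    [ρ.IsIrreducible] [Fintype Ω] (σ : G →* Equiv.Perm Ω) (hperf : ∀ f : G →* ℂˣ, f = 1)
    (hdim : Module.finrank ℂ V + 1 = Fintype.card Ω) (o : Ω) (htrans : ∀ x, ∃ g, σ g o = x)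
    (v : V) (hv0 : v ≠ 0) (hv : ∀ g, σ g o = o → ∃ μ : ℂ, ρ g v = μ • v) (g : G) :
    LinearMap.trace ℂ V (ρ g) = (Fintype.card {x // σ g x = x} : ℂ) - 1 := by
  choose r hr using htrans
  have : Nonempty Ω := ⟨o⟩
  have hinj : ∀ g v, ρ g v = 0 → v = 0 := fun g v h => by
    have := congrArg (ρ g⁻¹) h
    simpa [← Module.End.mul_apply, ← map_mul] using this
  have hmono : ∀ g x, ∃ μ : ℂ, ρ g (ρ (r x) v) = μ • ρ (r (σ g x)) v := fun g x => by
    obtain ⟨μ, hμ⟩ := hv ((r (σ g x))⁻¹ * g * r x) (by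
      simp only [map_mul, Equiv.Perm.mul_apply, hr]
      rw [map_inv, Equiv.Perm.inv_eq_iff_eq, hr])
    refine ⟨μ, ?_⟩
    rw [← map_smul, ← hμ, ← Module.End.mul_apply, ← Module.End.mul_apply, ← map_mul, ← map_mul]
    congr 2
    group
  refine ρ.trace_eq_card_fixed_sub_one σ hperf hdim (fun x y => ?_) (fun x => ρ (r x) v) ?_
    (fun x h => hv0 (hinj _ _ h)) hmono g
  · refine ⟨r y * (r x)⁻¹, ?_⟩
    have : (σ (r x))⁻¹ x = o := by rw [Equiv.Perm.inv_eq_iff_eq, hr]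
    rw [map_mul, Equiv.Perm.mul_apply, map_inv, this, hr]
  · let W : Subrepresentation ρ :=
      ⟨Submodule.span ℂ (Set.range fun x => ρ (r x) v), fun g u hu => by
        induction hu using Submodule.span_induction with
        | mem y hy =>
          obtain ⟨x, rfl⟩ := hy
          obtain ⟨μ, hμ⟩ := hmono g x
          rw [hμ]
          exact Submodule.smul_mem _ _ (Submodule.subset_span ⟨_, rfl⟩)
        | zero => rw [map_zero]; exact Submodule.zero_mem _
        | add a b _ _ ha hb => rw [map_add]; exact Submodule.add_mem _ ha hb
        | smul a b _ hb => rw [map_smul]; exact Submodule.smul_mem _ _ hb⟩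
    rcases IsSimpleOrder.eq_bot_or_eq_top W with h | h
    · exfalso
      have h1 : ρ (r o) v ∈ W.toSubmodule := Submodule.subset_span ⟨o, rfl⟩
      rw [h] at h1
      exact hv0 (hinj _ _ ((Submodule.mem_bot ℂ).1 h1))
    · exact congrArg Subrepresentation.toSubmodule h

theorem FiniteField.two_mul_sum_of_sq_invariant {F : Type*} [Field F] [Fintype F]
    (hF : ringChar F ≠ 2) (f : F → ℂ) (hf : ∀ t a, t ≠ 0 → f (t ^ 2 * a) = f a) :
    ∃ ν, 2 * ∑ a, f a = 2 * f 0 + ((Fintype.card F : ℂ) - 1) * (f 1 + f ν) := by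
  obtain ⟨ν, hν⟩ := quadraticChar_exists_neg_one hF
  have hν0 : ν ≠ 0 := fun h => by simp [h] at hν
  refine ⟨ν, ?_⟩
  have key : ∀ a, 2 * f a = (f 1 + f ν) + (quadraticChar F a : ℂ) * (f 1 - f ν) +
      if a = 0 then 2 * f 0 - (f 1 + f ν) else 0 := fun a => by
    by_cases ha : a = 0
    · simp [ha]
    · rcases quadraticChar_dichotomy ha with h | h
      · obtain ⟨t, rfl⟩ := (quadraticChar_one_iff_isSquare ha).1 h
        have := hf t 1 (left_ne_zero_of_mul ha)
        rw [mul_one, pow_two] at this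
        rw [h, if_neg ha, this]
        push_cast; ring
      · have h1 : quadraticChar F (a * ν⁻¹) = 1 := by
          have : quadraticChar F (a * ν⁻¹) * quadraticChar F ν = quadraticChar F a := by
            rw [← map_mul, inv_mul_cancel_right₀ hν0]
          rw [hν, h] at this
          linarith
        obtain ⟨t, ht⟩ := (quadraticChar_one_iff_isSquare
          (mul_ne_zero ha (inv_ne_zero hν0))).1 h1
        have ht0 : t ≠ 0 := fun h => by simp [h, ha, hν0] at ht
        have ha' : a = t ^ 2 * ν := by rw [pow_two, ← ht, inv_mul_cancel_right₀ hν0]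
        rw [h, if_neg ha, ha', hf t ν ht0]
        push_cast; ring
  rw [Finset.mul_sum, Finset.sum_congr rfl fun a _ => key a, Finset.sum_add_distrib,
    Finset.sum_add_distrib, ← Finset.sum_mul, ← Int.cast_sum, quadraticChar_sum_zero hF]
  simp
  ring

namespace Matrix.SpecialLinearGroup

open scoped MatrixGroups

variable {F : Type*} [Field F]

theorem diag2_mul_transvection (t a : F) (ht : t ≠ 0) :
    diag2 t ht * transvection zero_ne_one a = transvection zero_ne_one (t ^ 2 * a) * diag2 t ht := by
  ext i j
  fin_cases i <;> fin_cases j <;>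
    simp [diag2_coe, transvection_coe, Matrix.mul_apply, Fin.sum_univ_two]
  field_simp

theorem diag2_pow (t : F) (ht : t ≠ 0) (n : ℕ) :
    diag2 t ht ^ n = diag2 (t ^ n) (pow_ne_zero n ht) := by
  ext i j
  rw [coe_pow, diag2_coe, Matrix.diagonal_pow, diag2_coe]
  fin_cases i <;> fin_cases j <;> simp

theorem eq_diag2_mul_transvection (g : SL(2, F)) (hg : g 1 0 = 0) :
    ∃ (t a : F) (ht : t ≠ 0), g = diag2 t ht * transvection zero_ne_one a := by
  have hdet := g.det_coe
  rw [Matrix.det_fin_two, hg, mul_zero, sub_zero] at hdet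
  have h0 : g 0 0 ≠ 0 := left_ne_zero_of_mul_eq_one hdet
  refine ⟨g 0 0, g 0 1 / g 0 0, h0, ?_⟩
  ext i j
  fin_cases i <;> fin_cases j <;>
    simp [diag2_coe, transvection_coe, Matrix.mul_apply, Fin.sum_univ_two, hg]
  · field_simp
  · exact eq_inv_of_mul_eq_one_right hdet

theorem hom_eq_one [Fintype F] (hF : 3 < Fintype.card F) (f : SL(2, F) →* ℂˣ) : f = 1 := by
  obtain ⟨u, hu⟩ := IsCyclic.exists_generator (α := Fˣ)
  have hu2 : (u : F) ^ 2 ≠ 1 := fun h => by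
    have h1 : orderOf u ≤ 2 := orderOf_le_of_pow_eq_one zero_lt_two (Units.ext (by simpa using h))
    rw [orderOf_eq_card_of_forall_mem_zpowers hu, Nat.card_eq_fintype_card,
      Fintype.card_units] at h1
    omega
  have h := Abelianization.commutator_subset_ker f
  rw [SL2.commutator_eq_top u.ne_zero hu2] at h
  ext g
  exact congrArg Units.val ((MonoidHom.mem_ker).1 (h (Subgroup.mem_top g)))

section Representation

variable [Fintype F] {V : Type*} [AddCommGroup V] [Module ℂ V] [FiniteDimensional ℂ V]
  (ρ : Representation ℂ SL(2, F) V)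

theorem exists_transvection_fixed (hchar : ringChar F ≠ 2) (hF : 3 < Fintype.card F)
    (hdim : Module.finrank ℂ V = Fintype.card F) :
    ∃ v : V, v ≠ 0 ∧ ∀ a, ρ (transvection zero_ne_one a) v = v := by
  by_contra! hcon
  let P : V →ₗ[ℂ] V := ∑ a : F, ρ (transvection zero_ne_one a)
  have hP : P = 0 := by
    ext v
    by_contra hv
    obtain ⟨a, ha⟩ := hcon (P v) hv
    apply ha
    simp only [P, LinearMap.sum_apply, map_sum, ← Module.End.mul_apply, ← map_mul,
      ← transvection_add]
    exact Fintype.sum_equiv (Equiv.addLeft a) _ _ fun x => rfl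
  obtain ⟨ν, hν⟩ := FiniteField.two_mul_sum_of_sq_invariant hchar
    (fun a => LinearMap.trace ℂ V (ρ (transvection zero_ne_one a))) (fun t a ht => by
      have h : transvection zero_ne_one (t ^ 2 * a) =
          diag2 t ht * transvection zero_ne_one a * (diag2 t ht)⁻¹ := by
        rw [diag2_mul_transvection, mul_inv_cancel_right]
      simp only [h]
      exact ρ.char_conj _ _)
  have hsum : ∑ a, LinearMap.trace ℂ V (ρ (transvection zero_ne_one a)) = 0 := by
    rw [← map_sum, show ∑ a : F, ρ (transvection zero_ne_one a) = 0 from hP, map_zero]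
  have hint : ∀ g, IsIntegral ℤ (LinearMap.trace ℂ V (ρ g)) := fun g =>
    Module.End.isIntegral_trace_of_pow_eq_one Fintype.card_pos
      (by rw [← map_pow, pow_card_eq_one, map_one])
  simp only [hsum, transvection_coeff_zero, map_one, LinearMap.trace_one, hdim] at hν
  set s := LinearMap.trace ℂ V (ρ (transvection zero_ne_one 1)) +
    LinearMap.trace ℂ V (ρ (transvection zero_ne_one ν)) with hs
  have hsint : IsIntegral ℤ s := (hint _).add (hint _)
  have hq1 : ((Fintype.card F : ℚ) - 1) ≠ 0 := by
    have : (3 : ℚ) < Fintype.card F := by exact_mod_cast hF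
    linarith
  have hsr : s = ((-2 * Fintype.card F / (Fintype.card F - 1) : ℚ) : ℂ) := by
    have hq2 : ((Fintype.card F : ℂ) - 1) ≠ 0 := by exact_mod_cast hq1
    push_cast
    rw [eq_div_iff hq2]
    linear_combination -hν
  rw [hsr] at hsint
  have hint2 : IsIntegral ℤ (-2 * Fintype.card F / (Fintype.card F - 1) : ℚ) :=
    (isIntegral_algebraMap_iff (algebraMap ℚ ℂ).injective).1 hsint
  obtain ⟨n, hn⟩ := IsIntegrallyClosed.isIntegral_iff.1 hint2
  have hn' : n * ((Fintype.card F : ℤ) - 1) = -2 * Fintype.card F := by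
    have : (n : ℚ) * ((Fintype.card F : ℚ) - 1) = -2 * Fintype.card F := by
      rw [eq_div_iff hq1] at hn
      exact hn
    exact_mod_cast this
  have hdvd : ((Fintype.card F : ℤ) - 1) ∣ 2 := ⟨-n - 2, by linear_combination hn'⟩
  have := Int.le_of_dvd two_pos hdvd
  omega

theorem exists_borel_eigenvector (hchar : ringChar F ≠ 2) (hF : 3 < Fintype.card F)
    (hdim : Module.finrank ℂ V = Fintype.card F) :
    ∃ v : V, v ≠ 0 ∧ ∀ g : SL(2, F), g 1 0 = 0 → ∃ μ : ℂ, ρ g v = μ • v := by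
  obtain ⟨v₀, hv₀, hfix⟩ := exists_transvection_fixed ρ hchar hF hdim
  let W : Submodule ℂ V := ⨅ a : F, LinearMap.eqLocus (ρ (transvection zero_ne_one a)) LinearMap.id
  have hW : ∀ v, v ∈ W ↔ ∀ a, ρ (transvection zero_ne_one a) v = v := fun v => by
    simp [W, Submodule.mem_iInf]
  obtain ⟨u, hu⟩ := IsCyclic.exists_generator (α := Fˣ)
  have hstab : ∀ v ∈ W, ρ (diag2 (u : F) u.ne_zero) v ∈ W := fun v hv => by
    rw [hW] at hv ⊢
    intro a
    have h : transvection zero_ne_one a * diag2 (u : F) u.ne_zero =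
        diag2 (u : F) u.ne_zero * transvection zero_ne_one (((u : F) ^ 2)⁻¹ * a) := by
      rw [diag2_mul_transvection, mul_inv_cancel_left₀ (pow_ne_zero 2 u.ne_zero)]
    rw [← Module.End.mul_apply, ← map_mul, h, map_mul, Module.End.mul_apply, hv]
  have : Nontrivial W := ⟨⟨⟨v₀, (hW _).2 hfix⟩, 0, fun h => hv₀ (congrArg Subtype.val h)⟩⟩
  obtain ⟨c, hc⟩ := Module.End.exists_eigenvalue ((ρ (diag2 (u : F) u.ne_zero)).restrict hstab)
  obtain ⟨⟨v, hvW⟩, hv⟩ := hc.exists_hasEigenvector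
  have hvc : ρ (diag2 (u : F) u.ne_zero) v = c • v := congrArg Subtype.val hv.apply_eq_smul
  have hpow : ∀ n : ℕ, ρ (diag2 (u : F) u.ne_zero ^ n) v = c ^ n • v := fun n => by
    induction n with
    | zero => simp
    | succ n ih => rw [pow_succ, map_mul, Module.End.mul_apply, hvc, map_smul, ih, smul_smul,
        pow_succ, mul_comm]
  refine ⟨v, fun h => hv.2 (Subtype.ext h), fun g hg => ?_⟩
  obtain ⟨t, a, ht, rfl⟩ := eq_diag2_mul_transvection g hg
  obtain ⟨n, hn⟩ := (mem_powers_iff_mem_zpowers (y := Units.mk0 t ht)).2 (hu (Units.mk0 t ht))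
  have ht' : t = (u : F) ^ n := by
    simpa using congrArg Units.val hn.symm
  refine ⟨c ^ n, ?_⟩
  rw [map_mul, Module.End.mul_apply, (hW v).1 hvW, ← hpow, diag2_pow]
  subst ht'
  rfl

end Representation

section ProjectiveLine

/-- The action of `SL(2, F)` on the projective line by Möbius transformations. -/
noncomputable def projectiveLinePerm (F : Type*) [Field F] :
    SL(2, F) →* Equiv.Perm (OnePoint F) :=
  (MulAction.toPermHom (GL (Fin 2) F) (OnePoint F)).comp toGL

theorem projectiveLinePerm_infty_eq_iff (g : SL(2, F)) :
    projectiveLinePerm F g OnePoint.infty = OnePoint.infty ↔ g 1 0 = 0 :=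
  OnePoint.smul_infty_eq_self_iff (g := toGL g)

theorem projectiveLinePerm_coe_eq_iff (g : SL(2, F)) (k : F) :
    projectiveLinePerm F g k = k ↔ g 1 0 * k ^ 2 + (g 1 1 - g 0 0) * k - g 0 1 = 0 := by
  refine (Matrix.GeneralLinearGroup.fixpointPolynomial_aeval_eq_zero_iff (g := toGL g)).symm.trans ?_
  simp [Matrix.GeneralLinearGroup.fixpointPolynomial]

theorem exists_projectiveLinePerm_infty_eq (x : OnePoint F) :
    ∃ g : SL(2, F), projectiveLinePerm F g OnePoint.infty = x := by
  cases x with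
  | infty => exact ⟨1, by simp⟩
  | coe k =>
    let g : SL(2, F) := ⟨!![k, -1; 1, 0], by simp [Matrix.det_fin_two]⟩
    have h00 : toGL g 0 0 = k := rfl
    have h10 : toGL g 1 0 = 1 := rfl
    refine ⟨g, (OnePoint.smul_infty_eq_ite (toGL g)).trans ?_⟩
    simp [h00, h10]

theorem mem_center_fin_two_iff (g : SL(2, F)) :
    g ∈ Subgroup.center SL(2, F) ↔ g 0 1 = 0 ∧ g 1 0 = 0 ∧ g 0 0 = g 1 1 := by
  rw [mem_center_iff]
  constructor
  · rintro ⟨r, -, h⟩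
    rw [← h]
    simp
  · rintro ⟨h1, h2, h3⟩
    have hdet := g.det_coe
    rw [Matrix.det_fin_two, h1, h3] at hdet
    refine ⟨g 0 0, by rw [h3, Fintype.card_fin]; linear_combination hdet, ?_⟩
    ext i j
    fin_cases i <;> fin_cases j <;> simp [h1, h2, h3]

theorem projectiveLinePerm_eq_one_of_mem_center {g : SL(2, F)}
    (hg : g ∈ Subgroup.center SL(2, F)) : projectiveLinePerm F g = 1 := by
  obtain ⟨h1, h2, h3⟩ := (mem_center_fin_two_iff g).1 hg
  ext1 x
  cases x with
  | infty => exact (projectiveLinePerm_infty_eq_iff g).2 h2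
  | coe k => exact (projectiveLinePerm_coe_eq_iff g k).2 (by simp [h1, h2, h3])

theorem nonempty_fixed_projectiveLine_iff {g : SL(2, F)} (hg : g ∉ Subgroup.center SL(2, F))
    (hg2 : g ^ 2 ∈ Subgroup.center SL(2, F)) :
    (∃ x, projectiveLinePerm F g x = x) ↔ IsSquare (-1 : F) := by
  have hdet := g.det_coe
  rw [Matrix.det_fin_two] at hdet
  rw [mem_center_fin_two_iff] at hg hg2
  simp only [pow_two, coe_mul, Matrix.mul_apply, Fin.sum_univ_two] at hg2
  have htr : g 1 1 = - g 0 0 := by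
    by_contra h
    have h' : g 0 0 + g 1 1 ≠ 0 := fun h2 => h (by linear_combination h2)
    refine hg ⟨mul_right_cancel₀ h' ?_, mul_right_cancel₀ h' ?_, mul_right_cancel₀ h' ?_⟩
    · linear_combination hg2.1
    · linear_combination hg2.2.1
    · linear_combination hg2.2.2
  rw [htr] at hdet
  by_cases hc : g 1 0 = 0
  · rw [hc] at hdet
    exact ⟨fun _ => ⟨g 0 0, by linear_combination hdet⟩,
      fun _ => ⟨OnePoint.infty, (projectiveLinePerm_infty_eq_iff g).2 hc⟩⟩
  · constructor
    · rintro ⟨x, hx⟩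
      cases x with
      | infty => exact absurd ((projectiveLinePerm_infty_eq_iff g).1 hx) hc
      | coe k =>
        rw [projectiveLinePerm_coe_eq_iff, htr] at hx
        exact ⟨g 1 0 * k - g 0 0, by linear_combination hdet - g 1 0 * hx⟩
    · rintro ⟨i, hi⟩
      refine ⟨((g 0 0 + i) / g 1 0 : F), (projectiveLinePerm_coe_eq_iff g _).2 ?_⟩
      rw [htr]
      field_simp
      linear_combination hdet - hi

variable [Fintype F]

theorem card_projectiveLine {K : Type*} [Fintype K] :
    Fintype.card (OnePoint K) = Fintype.card K + 1 :=
  Fintype.card_option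

theorem card_fixed_projectiveLine_le_two {g : SL(2, F)} (hg : g ∉ Subgroup.center SL(2, F)) :
    Fintype.card {x // projectiveLinePerm F g x = x} ≤ 2 := by
  by_contra! h
  obtain ⟨x, y, z, hxy, hxz, hyz⟩ := Fintype.two_lt_card_iff.1 h
  apply hg
  rw [mem_center_fin_two_iff]
  obtain ⟨x, hx⟩ := x
  obtain ⟨y, hy⟩ := y
  obtain ⟨z, hz⟩ := z
  simp only [ne_eq, Subtype.mk.injEq] at hxy hxz hyz
  cases x <;> cases y <;> cases z <;>
    simp only [projectiveLinePerm_infty_eq_iff, projectiveLinePerm_coe_eq_iff, OnePoint.coe_eq_coe,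
      not_true, OnePoint.coe_ne_infty, OnePoint.infty_ne_coe, not_false_eq_true] at * <;> grind

theorem card_fixed_projectiveLine_modEq {g : SL(2, F)} {ℓ : ℕ} [Fact ℓ.Prime]
    (hg : g ^ ℓ ∈ Subgroup.center SL(2, F)) :
    Fintype.card {x // projectiveLinePerm F g x = x} ≡ Fintype.card F + 1 [MOD ℓ] := by
  have h := Equiv.Perm.card_compl_support_modEq (p := ℓ) (n := 1) (σ := projectiveLinePerm F g)
    (by rw [pow_one, ← map_pow, projectiveLinePerm_eq_one_of_mem_center hg])
  rw [card_projectiveLine] at h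
  rw [Fintype.card_subtype]
  convert h using 2
  ext x
  simp

end ProjectiveLine

end Matrix.SpecialLinearGroup

theorem Representation.IsIrreducible.comp_of_surjective {k G H V : Type*} [Field k] [Group G]
    [Group H] [AddCommGroup V] [Module k V] (ρ : Representation k G V) [ρ.IsIrreducible]
    (f : H →* G) (hf : Function.Surjective f) :
    Representation.IsIrreducible (MonoidHom.comp ρ f : Representation k H V) := by
  have hbt : (⊥ : Subrepresentation ρ) ≠ ⊤ := bot_ne_top
  refine { exists_pair_ne := ⟨⊥, ⊤, fun h => hbt ?_⟩, eq_bot_or_eq_top := fun W => ?_ }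
  · have h' : (⊥ : Submodule k V) = ⊤ := congrArg Subrepresentation.toSubmodule h
    exact Subrepresentation.toSubmodule_injective h'
  · let W' : Subrepresentation ρ := ⟨W.toSubmodule, fun g v hv => by
      obtain ⟨h, rfl⟩ := hf g
      exact W.apply_mem_toSubmodule h hv⟩
    rcases IsSimpleOrder.eq_bot_or_eq_top W' with h | h
    · left
      have h' : W.toSubmodule = ⊥ := congrArg Subrepresentation.toSubmodule h
      exact Subrepresentation.toSubmodule_injective h'
    · right
      have h' : W.toSubmodule = ⊤ := congrArg Subrepresentation.toSubmodule h
      exact Subrepresentation.toSubmodule_injective h'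

open Matrix.SpecialLinearGroup in
theorem IsIrrCharacter.steinberg_apply_mk {F : Type} [Field F] [Fintype F]
    (hchar : ringChar F ≠ 2) (hF : 3 < Fintype.card F) {χ : PSL2 F → ℂ}
    (hχ : IsIrrCharacter (PSL2 F) χ) (hdeg : χ 1 = Fintype.card F)
    (g : Matrix.SpecialLinearGroup (Fin 2) F) :
    χ (g : PSL2 F) = (Fintype.card {x // projectiveLinePerm F g x = x} : ℂ) - 1 := by
  obtain ⟨V, hV, rfl⟩ := hχ
  rw [FDRep.char_one] at hdeg
  have hdim : Module.finrank ℂ V = Fintype.card F := by exact_mod_cast hdeg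
  have := V.isIrreducible_of_simple
  let ρ : Representation ℂ (Matrix.SpecialLinearGroup (Fin 2) F) V :=
    MonoidHom.comp V.ρ (QuotientGroup.mk' (Subgroup.center _))
  have : ρ.IsIrreducible :=
    Representation.IsIrreducible.comp_of_surjective V.ρ _ (QuotientGroup.mk'_surjective _)
  obtain ⟨v, hv0, hv⟩ := exists_borel_eigenvector ρ hchar hF hdim
  exact ρ.trace_eq_card_fixed_sub_one_of_stabilizer (projectiveLinePerm F) (hom_eq_one hF)
    (by rw [hdim, card_projectiveLine]) OnePoint.infty exists_projectiveLinePerm_infty_eq v hv0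
    (fun g hg => hv g ((projectiveLinePerm_infty_eq_iff g).1 hg)) g

open Matrix.SpecialLinearGroup in
theorem IsIrrCharacter.steinberg_apply_of_odd_prime {F : Type} [Field F] [Fintype F]
    (hchar : ringChar F ≠ 2) (hF : 3 < Fintype.card F) {χ : PSL2 F → ℂ}
    (hχ : IsIrrCharacter (PSL2 F) χ) (hdeg : χ 1 = Fintype.card F) {ℓ : ℕ} [hℓ : Fact ℓ.Prime]
    (hℓ2 : ℓ ≠ 2) (hmod : Fintype.card F % ℓ = 1 ∨ Fintype.card F % ℓ = ℓ - 1)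
    {x : PSL2 F} (hx1 : x ≠ 1) (hx : x ^ ℓ = 1) :
    χ x = if Fintype.card F % ℓ = 1 then 1 else -1 := by
  obtain ⟨g, rfl⟩ := QuotientGroup.mk_surjective x
  have hg : g ∉ Subgroup.center _ := fun h => hx1 ((QuotientGroup.eq_one_iff g).2 h)
  have hgl : g ^ ℓ ∈ Subgroup.center _ := (QuotientGroup.eq_one_iff (g ^ ℓ)).1 hx
  rw [hχ.steinberg_apply_mk hchar hF hdeg]
  have h2 := card_fixed_projectiveLine_le_two hg
  have h3 := card_fixed_projectiveLine_modEq hgl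
  generalize Fintype.card {x // projectiveLinePerm F g x = x} = n at *
  have hℓ3 : 2 < ℓ := lt_of_le_of_ne hℓ.out.two_le hℓ2.symm
  rw [Nat.ModEq, Nat.add_mod, Nat.mod_eq_of_lt (h2.trans_lt hℓ3),
    Nat.mod_eq_of_lt (by omega : 1 < ℓ)] at h3
  split_ifs with h
  · rw [h, Nat.mod_eq_of_lt hℓ3] at h3
    rw [h3]; norm_num
  · rw [hmod.resolve_left h, Nat.sub_add_cancel (by omega), Nat.mod_self] at h3
    rw [h3]; norm_num

open Matrix.SpecialLinearGroup in
theorem IsIrrCharacter.steinberg_apply_of_involution {F : Type} [Field F] [Fintype F]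
    (hchar : ringChar F ≠ 2) (hF : 3 < Fintype.card F) {χ : PSL2 F → ℂ}
    (hχ : IsIrrCharacter (PSL2 F) χ) (hdeg : χ 1 = Fintype.card F)
    {x : PSL2 F} (hx1 : x ≠ 1) (hx : x ^ 2 = 1) :
    χ x = if Fintype.card F % 4 = 1 then 1 else -1 := by
  obtain ⟨g, rfl⟩ := QuotientGroup.mk_surjective x
  have hg : g ∉ Subgroup.center _ := fun h => hx1 ((QuotientGroup.eq_one_iff g).2 h)
  have hgl : g ^ 2 ∈ Subgroup.center _ := (QuotientGroup.eq_one_iff (g ^ 2)).1 hx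
  rw [hχ.steinberg_apply_mk hchar hF hdeg]
  have h2 := card_fixed_projectiveLine_le_two hg
  have : Fact (Nat.Prime 2) := ⟨Nat.prime_two⟩
  have h3 := card_fixed_projectiveLine_modEq hgl
  have h4 := nonempty_fixed_projectiveLine_iff hg hgl
  rw [FiniteField.isSquare_neg_one_iff, ← nonempty_subtype, ← Fintype.card_pos_iff] at h4
  generalize Fintype.card {x // projectiveLinePerm F g x = x} = n at *
  have hodd := FiniteField.odd_card_of_char_ne_two hchar
  rw [Nat.ModEq] at h3
  split_ifs with h
  · obtain rfl : n = 2 := by have := h4.2 (by omega); omega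
    norm_num
  · obtain rfl : n = 0 := by
      by_contra h0
      exact h4.1 (Nat.pos_of_ne_zero h0) (by omega)
    norm_num

theorem restMult_eq_of_const {G : Type} [Group G] [Finite G] {H : Subgroup G} {θ : H →* ℂˣ}
    (hθ : θ ≠ 1) {χ : G → ℂ} {ε : ℂ} (hχ : ∀ x ∈ H, x ≠ 1 → χ x = ε) :
    restMult H θ χ = (χ 1 - ε) / Nat.card H := by
  let : Fintype H := Fintype.ofFinite H
  have hsum : ∑ h : H, ((θ h : ℂ))⁻¹ = 0 := by
    have h1 : (Units.coeHom ℂ).comp θ⁻¹ ≠ 1 := fun h => hθ (by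
      ext x
      have := DFunLike.congr_fun h x
      simpa using this)
    simpa using sum_hom_units_eq_zero _ h1
  have key : ∀ h : H, χ h * ((θ h : ℂ))⁻¹ = ε * ((θ h : ℂ))⁻¹ + if h = 1 then χ 1 - ε else 0 := by
    intro h
    by_cases h1 : h = 1
    · simp [h1]
    · rw [hχ h h.2 (fun h2 => h1 (Subtype.ext h2)), if_neg h1, add_zero]
  change (Nat.card H : ℂ)⁻¹ * ∑ h : H, χ h * ((θ h : ℂ))⁻¹ = _
  rw [Finset.sum_congr rfl fun h _ => key h, Finset.sum_add_distrib, ← Finset.mul_sum, hsum]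
  simp [div_eq_inv_mul]

theorem MonoidHom.pow_ne_one_of_injective {H : Type*} [Group H] {ℓ : ℕ} [hℓ : Fact ℓ.Prime]
    (hH : Nat.card H = ℓ) {θ : H →* ℂˣ} (hθ : Function.Injective θ) {k : ℕ} (hk : ¬ ℓ ∣ k) :
    θ ^ k ≠ 1 := by
  intro h
  have : Finite H := Nat.finite_of_card_ne_zero (hH ▸ hℓ.out.ne_zero)
  have : Nontrivial H := Finite.one_lt_card_iff_nontrivial.1 (hH ▸ hℓ.out.one_lt)
  obtain ⟨x, hx⟩ := exists_ne (1 : H)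
  have h1 : x ^ k = 1 := hθ (by rw [map_pow, map_one]; exact DFunLike.congr_fun h x)
  have h2 : orderOf x = ℓ := orderOf_eq_prime (hH ▸ pow_card_eq_one') hx
  exact hk (h2 ▸ orderOf_dvd_of_pow_eq_one h1)

theorem ramification_module_steinberg
    (q : ℕ) (hq : IsPrimePow q) (hgcd : Nat.Coprime q 42)
    (hq7 : q % 7 = 1 ∨ q % 7 = 6)
    (F : Type) [Field F] [Fintype F] (hF : Fintype.card F = q)
    (H2 H3 H7 : Subgroup (PSL2 F))
    (hH2 : Nat.card H2 = 2) (hH3 : Nat.card H3 = 3) (hH7 : Nat.card H7 = 7)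
    (θ2 : H2 →* ℂˣ) (θ3 : H3 →* ℂˣ) (θ7 : H7 →* ℂˣ)
    (hθ2 : Function.Injective θ2) (hθ3 : Function.Injective θ3)
    (hθ7 : Function.Injective θ7)
    (χ : PSL2 F → ℂ) (hχ : IsIrrCharacter (PSL2 F) χ) (hdeg : χ 1 = (q : ℂ))
    :
    ramMult H2 H3 H7 θ2 θ3 θ7 χ = (baseMult q : ℂ) := by
  subst hF
  have hcop : ∀ p, p.Prime → p ∣ 42 → Fintype.card F % p ≠ 0 := fun p hp hp42 h =>
    hp.one_lt.ne' (Nat.dvd_one.1 (hgcd ▸ Nat.dvd_gcd (Nat.dvd_of_mod_eq_zero h) hp42))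
  have h2 := hcop 2 Nat.prime_two (by norm_num)
  have h3 := hcop 3 Nat.prime_three (by norm_num)
  have hcard : 3 < Fintype.card F := by
    have := hq.one_lt
    omega
  have hchar : ringChar F ≠ 2 := fun h => h2 (FiniteField.even_card_of_char_two h)
  have : Fact (Nat.Prime 2) := ⟨Nat.prime_two⟩
  have : Fact (Nat.Prime 3) := ⟨Nat.prime_three⟩
  have : Fact (Nat.Prime 7) := ⟨by norm_num⟩
  have hpow : ∀ {H : Subgroup (PSL2 F)} {n : ℕ}, Nat.card H = n → ∀ {x}, x ∈ H → x ^ n = 1 := by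
    rintro H _ rfl x hx
    exact congrArg Subtype.val (pow_card_eq_one' (x := (⟨x, hx⟩ : H)))
  have r2 : restMult H2 (θ2 ^ 1) χ =
      (χ 1 - if Fintype.card F % 4 = 1 then 1 else -1) / Nat.card H2 :=
    restMult_eq_of_const (MonoidHom.pow_ne_one_of_injective hH2 hθ2 (by norm_num))
      fun x hx hx1 => hχ.steinberg_apply_of_involution hchar hcard hdeg hx1 (hpow hH2 hx)
  have r3 : ∀ k, ¬ 3 ∣ k → restMult H3 (θ3 ^ k) χ =
      (χ 1 - if Fintype.card F % 3 = 1 then 1 else -1) / Nat.card H3 := fun k hk =>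
    restMult_eq_of_const (MonoidHom.pow_ne_one_of_injective hH3 hθ3 hk)
      fun x hx hx1 => hχ.steinberg_apply_of_odd_prime hchar hcard hdeg (by norm_num) (by omega)
        hx1 (hpow hH3 hx)
  have r7 : ∀ k, ¬ 7 ∣ k → restMult H7 (θ7 ^ k) χ =
      (χ 1 - if Fintype.card F % 7 = 1 then 1 else -1) / Nat.card H7 := fun k hk =>
    restMult_eq_of_const (MonoidHom.pow_ne_one_of_injective hH7 hθ7 hk)
      fun x hx hx1 => hχ.steinberg_apply_of_odd_prime hchar hcard hdeg (by norm_num) hq7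
        hx1 (hpow hH7 hx)
  have r31 := r3 1 (by norm_num)
  rw [pow_one] at r2 r31
  have s7 : ∑ k ∈ Finset.Icc (1:ℕ) 6, (k : ℂ) * restMult H7 (θ7 ^ k) χ = 21 *
      ((χ 1 - if Fintype.card F % 7 = 1 then 1 else -1) / Nat.card H7) := by
    have h : ∀ k ∈ Finset.Icc (1:ℕ) 6, (k : ℂ) * restMult H7 (θ7 ^ k) χ = k *
        ((χ 1 - if Fintype.card F % 7 = 1 then 1 else -1) / Nat.card H7) := fun k hk => by
      rw [Finset.mem_Icc] at hk
      rw [r7 k (by omega)]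
    rw [Finset.sum_congr rfl h, ← Finset.sum_mul]
    congr 1
    norm_num [Finset.sum_Icc_succ_top]
  rw [ramMult, r2, r31, r3 2 (by norm_num), s7, hH2, hH3, hH7, hdeg, baseMult]
  push_cast [Int.cast_div]
  obtain ⟨a, ha⟩ : (4 : ℤ) ∣ (Fintype.card F : ℤ) - if Fintype.card F % 4 = 1 then 1 else -1 := by
    split_ifs <;> omega
  obtain ⟨b, hb⟩ : (3 : ℤ) ∣ (Fintype.card F : ℤ) - if Fintype.card F % 3 = 1 then 1 else -1 := by
    split_ifs <;> omega
  obtain ⟨c, hc⟩ : (7 : ℤ) ∣ (Fintype.card F : ℤ) - if Fintype.card F % 7 = 1 then 1 else -1 := by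
    split_ifs <;> omega
  have ha' := congrArg (Int.cast : ℤ → ℂ) ha
  have hb' := congrArg (Int.cast : ℤ → ℂ) hb
  have hc' := congrArg (Int.cast : ℤ → ℂ) hc
  push_cast at ha' hb' hc'
  rw [ha, hb, hc, Int.mul_ediv_cancel_left _ (by norm_num), Int.mul_ediv_cancel_left _ (by norm_num),
    Int.mul_ediv_cancel_left _ (by norm_num), ha', hb', hc']
  ring
end

section
/- Suppose q ≡ 1 (mod 8). Then for every irreducible complex character χ of G with χ(1) = (q+1)/2, Γ(χ) = m/2. -/
open scoped BigOperators Classical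

namespace PSL2Ramification

open Matrix SpecialLinearGroup

local notation "SL₂" => Matrix.SpecialLinearGroup (Fin 2)

section Matrices

variable {F : Type} [Field F]

/-- The upper unitriangular matrix with off-diagonal entry `b`. -/
def upper (b : F) : SL₂ F := ⟨!![1, b; 0, 1], by simp [Matrix.det_fin_two]⟩

/-- The diagonal matrix with entries `a, a⁻¹`. -/
def torus (a : Fˣ) : SL₂ F := ⟨!![(a : F), 0; 0, ((a⁻¹ : Fˣ) : F)], by simp [Matrix.det_fin_two]⟩

/-- The Weyl element. -/
def weyl : SL₂ F := ⟨!![0, -1; 1, 0], by simp [Matrix.det_fin_two]⟩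

lemma coe_upper (b : F) : (upper b : Matrix (Fin 2) (Fin 2) F) = !![1, b; 0, 1] := rfl

lemma coe_torus (a : Fˣ) :
    (torus a : Matrix (Fin 2) (Fin 2) F) = !![(a : F), 0; 0, ((a⁻¹ : Fˣ) : F)] := rfl

lemma coe_weyl : ((weyl : SL₂ F) : Matrix (Fin 2) (Fin 2) F) = !![0, -1; 1, 0] := rfl

lemma det_eq_one (g : SL₂ F) : g 0 0 * g 1 1 - g 0 1 * g 1 0 = 1 := by
  have := g.det_coe
  rwa [Matrix.det_fin_two] at this

lemma upper_add (x y : F) : upper (x + y) = upper x * upper y := by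
  ext i j
  fin_cases i <;> fin_cases j <;> simp [coe_upper, Matrix.mul_apply, Fin.sum_univ_two, add_comm]

lemma upper_zero : upper (0 : F) = 1 := by
  ext i j
  fin_cases i <;> fin_cases j <;> simp [coe_upper]

lemma torus_mul (a b : Fˣ) : torus (a * b) = torus a * torus b := by
  ext i j
  fin_cases i <;> fin_cases j <;>
    simp [coe_torus, Matrix.mul_apply, Fin.sum_univ_two, mul_comm]

lemma torus_one : torus (1 : Fˣ) = 1 := by
  ext i j
  fin_cases i <;> fin_cases j <;> simp [coe_torus]

lemma weyl_mul_torus (a : Fˣ) : weyl * torus a * (weyl : SL₂ F)⁻¹ = torus a⁻¹ := by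
  rw [mul_inv_eq_iff_eq_mul]
  ext i j
  fin_cases i <;> fin_cases j <;> simp [coe_torus, coe_weyl, Matrix.mul_apply, Fin.sum_univ_two]

lemma mul_upper_of_triangular {g : SL₂ F} (hg : g 1 0 = 0) (x : F) :
    g * upper x = upper (g 0 0 ^ 2 * x) * g := by
  have := det_eq_one g
  rw [hg] at this
  have h2 : g 0 0 * g 1 1 = 1 := by linear_combination this
  ext i j
  fin_cases i <;> fin_cases j <;> simp [coe_upper, Matrix.mul_apply, Fin.sum_univ_two, hg]
  linear_combination (- g 0 0 * x) * h2

lemma inv_one_zero (g : SL₂ F) : g⁻¹ 1 0 = - g 1 0 := by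
  simp [Matrix.SpecialLinearGroup.coe_inv, Matrix.adjugate_fin_two]

lemma exists_torus_mul_upper {g : SL₂ F} (hg : g 1 0 = 0) :
    ∃ (a : Fˣ) (x : F), (a : F) = g 0 0 ∧ g = upper x * torus a := by
  have := det_eq_one g
  rw [hg] at this
  have h2 : g 0 0 * g 1 1 = 1 := by linear_combination this
  refine ⟨⟨g 0 0, g 1 1, h2, by rw [mul_comm, h2]⟩, g 0 1 * g 0 0, rfl, ?_⟩
  ext i j
  fin_cases i <;> fin_cases j <;>
    simp [coe_upper, coe_torus, Matrix.mul_apply, Fin.sum_univ_two, hg]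
  · rw [mul_assoc, h2, mul_one]

lemma bruhat {g : SL₂ F} (hg : g 1 0 ≠ 0) :
    g = upper (g 0 0 / g 1 0) * (torus (Units.mk0 _ hg)⁻¹ * weyl) * upper (g 1 1 / g 1 0) := by
  have := det_eq_one g
  ext i j
  fin_cases i <;> fin_cases j <;>
    simp [coe_upper, coe_torus, coe_weyl, Matrix.mul_apply, Fin.sum_univ_two] <;> field_simp
  linear_combination -this

lemma exists_conj_triangular {g : SL₂ F} {v : Fin 2 → F} (hv : v ≠ 0) {a : F}
    (h : (g : Matrix (Fin 2) (Fin 2) F) *ᵥ v = a • v) :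
    ∃ k : SL₂ F, (k⁻¹ * g * k) 1 0 = 0 ∧ (k⁻¹ * g * k) 0 0 = a := by
  have hc : IsCoprime (v 0) (v 1) := by
    by_cases h0 : v 0 = 0
    · have h1 : v 1 ≠ 0 := fun h1 => hv (by ext i; fin_cases i <;> simp [h0, h1])
      rw [h0]
      exact isCoprime_zero_left.2 h1.isUnit
    · exact ⟨(v 0)⁻¹, 0, by simp [h0]⟩
  obtain ⟨k, hk0, hk1⟩ := hc.exists_SL2_col 0
  have e0 := congrFun h 0
  have e1 := congrFun h 1
  simp [Matrix.mulVec, dotProduct, Fin.sum_univ_two] at e0 e1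
  have hd := det_eq_one k
  refine ⟨k, ?_, ?_⟩
  · simp [Matrix.SpecialLinearGroup.coe_inv, Matrix.adjugate_fin_two, Matrix.mul_apply,
      Matrix.vecMul, dotProduct, Fin.sum_univ_two, hk0, hk1]
    linear_combination (-v 1) * e0 + v 0 * e1
  · simp [Matrix.SpecialLinearGroup.coe_inv, Matrix.adjugate_fin_two, Matrix.mul_apply,
      Matrix.vecMul, dotProduct, Fin.sum_univ_two, hk0, hk1]
    rw [hk0, hk1] at hd
    linear_combination (k 1 1) * e0 - k 0 1 * e1 + a * hd

lemma conj_one_zero (g k : SL₂ F) : (k⁻¹ * g * k) 1 0 =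
    k 0 0 * (g 1 0 * k 0 0 + g 1 1 * k 1 0) - k 1 0 * (g 0 0 * k 0 0 + g 0 1 * k 1 0) := by
  simp [Matrix.SpecialLinearGroup.coe_inv, Matrix.adjugate_fin_two, Matrix.mul_apply,
    Matrix.vecMul, dotProduct, Fin.sum_univ_two]
  ring

/-- If `g` has no eigenvector over `F`, its centralizer in `GL₂` contains a matrix of
non-square determinant. -/
lemma exists_not_isSquare_det [Finite F] (h2 : (2 : F) ≠ 0) {g : SL₂ F}
    (hg : ∀ k : SL₂ F, (k⁻¹ * g * k) 1 0 ≠ 0) :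
    ∃ m : F, ¬ IsSquare ((m + 2 * g 0 0) * (m + 2 * g 1 1) - 2 * g 0 1 * (2 * g 1 0)) := by
  by_contra! hall
  have hdet := det_eq_one g
  set D : F := (g 0 0 + g 1 1) ^ 2 - 4 with hD
  have key (x : F) : IsSquare (x ^ 2 - D) := by
    convert hall (x - (g 0 0 + g 1 1)) using 1
    linear_combination (-4) * hdet
  let f : {s : F // IsSquare s} → {s : F // IsSquare s} := fun s => ⟨s - D, by
    obtain ⟨_, x, rfl⟩ := s
    simpa [pow_two] using key x⟩
  have hf : Function.Injective f := fun s t h => by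
    simpa [f, Subtype.ext_iff] using h
  obtain ⟨⟨_, x, rfl⟩, hx⟩ := (Finite.injective_iff_surjective.1 hf) ⟨0, IsSquare.zero⟩
  have hx : x * x - D = 0 := by simpa [f] using hx
  let M : Matrix (Fin 2) (Fin 2) F := !![x - (g 0 0 + g 1 1) + 2 * g 0 0, 2 * g 0 1;
    2 * g 1 0, x - (g 0 0 + g 1 1) + 2 * g 1 1]
  have hM : M.det = 0 := by
    rw [Matrix.det_fin_two_of]
    linear_combination hx - (-4) * hdet
  obtain ⟨v, hv, hMv⟩ := Matrix.exists_mulVec_eq_zero_iff.2 hM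
  have e0 := congrFun hMv 0
  have e1 := congrFun hMv 1
  simp [M, Matrix.mulVec, dotProduct, Fin.sum_univ_two] at e0 e1
  obtain ⟨k, hk, -⟩ := exists_conj_triangular (g := g) hv (a := (g 0 0 + g 1 1 - x) / 2) (by
    ext i
    fin_cases i <;> simp [Matrix.mulVec, dotProduct, Fin.sum_univ_two] <;> field_simp
    · linear_combination e0
    · linear_combination e1)
  exact hg k hk

lemma exists_bijective_conj_one_zero [Finite F] (h2 : (2 : F) ≠ 0) {g : SL₂ F}
    (hg : ∀ k : SL₂ F, (k⁻¹ * g * k) 1 0 ≠ 0) :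
    ∃ (μ : F) (φ : SL₂ F → SL₂ F), ¬ IsSquare μ ∧ Function.Bijective φ ∧
      ∀ k, ((φ k)⁻¹ * g * φ k) 1 0 = μ * (k⁻¹ * g * k) 1 0 := by
  obtain ⟨m, hm⟩ := exists_not_isSquare_det h2 hg
  let M : Matrix (Fin 2) (Fin 2) F := !![m + 2 * g 0 0, 2 * g 0 1; 2 * g 1 0, m + 2 * g 1 1]
  have hMdet : M.det = (m + 2 * g 0 0) * (m + 2 * g 1 1) - 2 * g 0 1 * (2 * g 1 0) :=
    Matrix.det_fin_two_of ..
  rw [← hMdet] at hm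
  have hM0 : M.det ≠ 0 := fun h => hm (h ▸ IsSquare.zero)
  let E : Matrix (Fin 2) (Fin 2) F := !![M.det⁻¹, 0; 0, 1]
  have hE : E.det = M.det⁻¹ := by simp [E, Matrix.det_fin_two]
  let φ : SL₂ F → SL₂ F := fun k => ⟨M * k * E, by
    rw [Matrix.det_mul, Matrix.det_mul, k.det_coe, hE, mul_one, mul_inv_cancel₀ hM0]⟩
  refine ⟨M.det⁻¹, φ, fun h => hm (by simpa using h.inv), ?_, fun k => ?_⟩
  · refine Finite.injective_iff_bijective.1 fun k l h => ?_
    have h' : M * k * E = M * l * E := congrArg Subtype.val h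
    have hMu : IsUnit M := (Matrix.isUnit_iff_isUnit_det _).2 hM0.isUnit
    have hEu : IsUnit E :=
      (Matrix.isUnit_iff_isUnit_det _).2 (by rw [hE]; exact (inv_ne_zero hM0).isUnit)
    exact Subtype.ext (hMu.mul_left_cancel (hEu.mul_right_cancel h'))
  · have c0 : φ k 0 0 = M.det⁻¹ * ((m + 2 * g 0 0) * k 0 0 + 2 * g 0 1 * k 1 0) := by
      change (M * k * E) 0 0 = _
      simp [M, E, Matrix.mul_apply, Matrix.vecMul, dotProduct, Fin.sum_univ_two]
      ring
    have c1 : φ k 1 0 = M.det⁻¹ * (2 * g 1 0 * k 0 0 + (m + 2 * g 1 1) * k 1 0) := by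
      change (M * k * E) 1 0 = _
      simp [M, E, Matrix.mul_apply, Matrix.vecMul, dotProduct, Fin.sum_univ_two]
      ring
    have hc : M.det⁻¹ * M.det = 1 := inv_mul_cancel₀ hM0
    rw [conj_one_zero, conj_one_zero, c0, c1]
    rw [hMdet] at hc ⊢
    obtain ⟨r, hr⟩ : ∃ r, r = ((m + 2 * g 0 0) * (m + 2 * g 1 1) - 2 * g 0 1 * (2 * g 1 0))⁻¹ :=
      ⟨_, rfl⟩
    rw [← hr] at hc ⊢
    linear_combination r * (k 0 0 * (g 1 0 * k 0 0 + g 1 1 * k 1 0)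
      - k 1 0 * (g 0 0 * k 0 0 + g 0 1 * k 1 0)) * hc

lemma card_nontriangular [Fintype F] :
    (Finset.univ.filter fun g : SL₂ F => g 1 0 ≠ 0).card =
      Fintype.card F * (Finset.univ.filter fun g : SL₂ F => g 1 0 = 0).card := by
  rw [← Finset.card_univ, ← Finset.card_product]
  symm
  refine Finset.card_bij' (fun p _ => p.2 * weyl * upper p.1)
    (fun g _ => (g 1 1 / g 1 0, g * (upper (g 1 1 / g 1 0))⁻¹ * weyl⁻¹)) ?_ ?_ ?_ ?_
  · rintro ⟨x, b⟩ h
    have hb : b 1 0 = 0 := by simpa using h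
    have := det_eq_one b
    have h1 : b 1 1 ≠ 0 := fun h => by simp [hb, h] at this
    simpa [coe_weyl, coe_upper, Matrix.mul_apply, Fin.sum_univ_two] using h1
  · intro g h
    have hg : g 1 0 ≠ 0 := by simpa using h
    simp [coe_weyl, coe_upper, Matrix.SpecialLinearGroup.coe_inv, Matrix.adjugate_fin_two,
      Matrix.mul_apply, Fin.sum_univ_two]
    field_simp
    ring
  · rintro ⟨x, b⟩ h
    have hb : b 1 0 = 0 := by simpa using h
    have := det_eq_one b
    have h1 : b 1 1 ≠ 0 := fun h => by simp [hb, h] at this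
    have hx : (b * weyl * upper x : SL₂ F) 1 1 / (b * weyl * upper x : SL₂ F) 1 0 = x := by
      simp [coe_weyl, coe_upper, Matrix.mul_apply, Fin.sum_univ_two, hb]
      field_simp
    ext1
    · exact hx
    · simp only [hx]
      group
  · intro g h
    simp

end Matrices

section Unipotent

variable {F : Type} [Field F] [Fintype F] {V : Type} [AddCommGroup V] [Module ℂ V]
  (ρ : SL₂ F →* Module.End ℂ V) (ψ : AddChar F ℂ)

/-- The projection onto the `b ↦ ψ (c * b)` isotypic part for the upper unitriangular group. -/
noncomputable def isotypicProj (c : F) : Module.End ℂ V :=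
  (Fintype.card F : ℂ)⁻¹ • ∑ b : F, ψ (-(c * b)) • ρ (upper b)

lemma upper_mul_isotypicProj (x c : F) :
    ρ (upper x) * isotypicProj ρ ψ c = ψ (c * x) • isotypicProj ρ ψ c := by
  rw [isotypicProj, mul_smul_comm, smul_comm (ψ _)]
  congr 1
  rw [Finset.mul_sum, Finset.smul_sum]
  refine Fintype.sum_equiv (Equiv.addLeft x) _ _ fun b => ?_
  rw [mul_smul_comm, ← map_mul, ← upper_add, smul_smul, ← AddChar.map_add_eq_mul]
  congr 2
  simp only [Equiv.coe_addLeft]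
  ring

variable {ψ}

lemma isotypicProj_mul_isotypicProj (hψ : ψ.IsPrimitive) (c d : F) :
    isotypicProj ρ ψ c * isotypicProj ρ ψ d = if d = c then isotypicProj ρ ψ d else 0 := by
  conv_lhs => rw [isotypicProj]
  rw [smul_mul_assoc, Finset.sum_mul]
  have h : ∀ b ∈ Finset.univ, ψ (-(c * b)) • ρ (upper b) * isotypicProj ρ ψ d =
      ψ (b * (d - c)) • isotypicProj ρ ψ d := fun b _ => by
    rw [smul_mul_assoc, upper_mul_isotypicProj, smul_smul, ← AddChar.map_add_eq_mul]
    congr 2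
    ring
  rw [Finset.sum_congr rfl h, ← Finset.sum_smul, AddChar.sum_mulShift _ hψ, smul_smul]
  by_cases hcd : d = c
  · simp [hcd]
  · simp [hcd, sub_eq_zero]

lemma sum_isotypicProj (hψ : ψ.IsPrimitive) : ∑ c : F, isotypicProj ρ ψ c = 1 := by
  simp only [isotypicProj]
  rw [← Finset.smul_sum, Finset.sum_comm]
  have h : ∀ b ∈ Finset.univ, ∑ c : F, ψ (-(c * b)) • ρ (upper b) =
      if b = 0 then (Fintype.card F : ℂ) • (1 : Module.End ℂ V) else 0 := fun b _ => by
    simp only [← mul_neg]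
    rw [← Finset.sum_smul, AddChar.sum_mulShift _ hψ]
    by_cases hb : b = 0
    · simp [hb, upper_zero]
    · simp [hb]
  rw [Finset.sum_congr rfl h]
  simp

variable (ψ)

lemma triangular_mul_isotypicProj {g : SL₂ F} (hg : g 1 0 = 0) (c : F) :
    ρ g * isotypicProj ρ ψ c = isotypicProj ρ ψ (c / g 0 0 ^ 2) * ρ g := by
  have h0 : g 0 0 ≠ 0 := fun h => by simpa [h, hg] using det_eq_one g
  rw [isotypicProj, isotypicProj, mul_smul_comm, smul_mul_assoc, Finset.mul_sum, Finset.sum_mul]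
  congr 1
  refine Fintype.sum_bijective _ (mulLeft_bijective₀ _ (pow_ne_zero 2 h0)) _ _ fun b => ?_
  rw [mul_smul_comm, smul_mul_assoc, ← map_mul, ← map_mul, mul_upper_of_triangular hg]
  congr 2
  field_simp

lemma trace_isotypicProj_mul_sq (c : F) {a : F} (ha : a ≠ 0) :
    LinearMap.trace ℂ V (isotypicProj ρ ψ (c * a ^ 2)) =
      LinearMap.trace ℂ V (isotypicProj ρ ψ c) := by
  have h := triangular_mul_isotypicProj ρ ψ (g := torus (Units.mk0 a ha)) (by simp [coe_torus])
    (c * a ^ 2)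
  have h1 : c * a ^ 2 / (torus (Units.mk0 a ha) : SL₂ F) 0 0 ^ 2 = c := by
    simp [coe_torus]; field_simp
  rw [h1] at h
  have hinv : ρ (torus (Units.mk0 a ha)) * ρ (torus (Units.mk0 a ha))⁻¹ = 1 := by
    rw [← map_mul, mul_inv_cancel, map_one]
  calc _ = LinearMap.trace ℂ V (isotypicProj ρ ψ (c * a ^ 2) *
          (ρ (torus (Units.mk0 a ha))⁻¹ * ρ (torus (Units.mk0 a ha)))) := by
        rw [← map_mul, inv_mul_cancel, map_one, mul_one]
    _ = LinearMap.trace ℂ V (ρ (torus (Units.mk0 a ha)) * isotypicProj ρ ψ (c * a ^ 2) *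
          ρ (torus (Units.mk0 a ha))⁻¹) := by
        rw [← mul_assoc, LinearMap.trace_mul_comm, mul_assoc]
    _ = _ := by rw [h, mul_assoc, hinv, mul_one]

end Unipotent

lemma exists_trace_eq_natCast {V : Type} [AddCommGroup V] [Module ℂ V] [FiniteDimensional ℂ V]
    {e : Module.End ℂ V} (he : e * e = e) :
    LinearMap.trace ℂ V e = Module.finrank ℂ (LinearMap.range e) :=
  (LinearMap.IsIdempotentElem.isProj_range e he).trace

/-- Compression by a rank one idempotent is scalar multiplication by a trace. -/
lemma rank_one_mul_mul {V : Type} [AddCommGroup V] [Module ℂ V] [FiniteDimensional ℂ V]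
    {e : Module.End ℂ V} (he : e * e = e) (ht : LinearMap.trace ℂ V e = 1)
    (X : Module.End ℂ V) : e * X * e = LinearMap.trace ℂ V (X * e) • e := by
  have hr : Module.finrank ℂ (LinearMap.range e) = 1 := by
    have := exists_trace_eq_natCast he
    rw [ht] at this
    exact_mod_cast this.symm
  obtain ⟨⟨v, hv⟩, -, hspan⟩ := finrank_eq_one_iff'.1 hr
  have hs (x : V) : ∃ c : ℂ, c • v = e x := by
    obtain ⟨c, hc⟩ := hspan ⟨e x, x, rfl⟩
    exact ⟨c, congrArg Subtype.val hc⟩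
  obtain ⟨k, hk⟩ := hs (X v)
  have hX : e * X * e = k • e := by
    ext x
    obtain ⟨c, hc⟩ := hs x
    rw [Module.End.mul_apply, Module.End.mul_apply, ← hc, map_smul, map_smul, ← hk,
      LinearMap.smul_apply, ← hc, smul_comm]
  have : LinearMap.trace ℂ V (X * e) = k := by
    calc LinearMap.trace ℂ V (X * e) = LinearMap.trace ℂ V (X * e * e) := by rw [mul_assoc, he]
      _ = LinearMap.trace ℂ V (e * X * e) := by rw [LinearMap.trace_mul_comm, mul_assoc]
      _ = k := by rw [hX, map_smul, ht, smul_eq_mul, mul_one]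
  rw [hX, this]

section HalfPrincipal

variable {F : Type} [Field F] {V : Type} [AddCommGroup V] [Module ℂ V]
  (ρ : SL₂ F →* Module.End ℂ V)

lemma eq_one_of_upper_eq_one (h : ∀ x, ρ (upper x) = 1) (g : SL₂ F) : ρ g = 1 := by
  have big (g : SL₂ F) (hg : g 1 0 ≠ 0) : ρ g = ρ (torus (Units.mk0 _ hg)⁻¹ * weyl) := by
    conv_lhs => rw [bruhat hg]
    simp only [map_mul, h, one_mul, mul_one]
  have lower (c : F) : ρ (weyl * upper (-c) * weyl⁻¹) = 1 := by
    rw [map_mul, map_mul, h, mul_one, ← map_mul, mul_inv_cancel, map_one]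
  have entry (c : F) : (weyl * upper (-c) * weyl⁻¹ : SL₂ F) 1 0 = c := by
    simp [coe_weyl, coe_upper, Matrix.SpecialLinearGroup.coe_inv, Matrix.adjugate_fin_two,
      Matrix.mul_apply, Fin.sum_univ_two]
  have key (g : SL₂ F) (hg : g 1 0 ≠ 0) : ρ g = 1 := by
    have h2 : (weyl * upper (-(g 1 0)) * weyl⁻¹ : SL₂ F) 1 0 ≠ 0 := by rwa [entry]
    have h1 := big _ h2
    rw [lower] at h1
    rw [big g hg, h1]
    simp only [entry]
  by_cases hg : g 1 0 = 0
  · have hdet := det_eq_one g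
    have h11 : g 1 1 ≠ 0 := fun h => by simp [hg, h] at hdet
    have h1 : ρ (g * weyl) = 1 := key _ (by
      simpa [coe_weyl, Matrix.mul_apply, Fin.sum_univ_two, hg] using h11)
    have h2 : ρ weyl = 1 := key _ (by simp [coe_weyl])
    rwa [map_mul, h2, mul_one] at h1
  · exact key g hg

variable [Fintype F] [FiniteDimensional ℂ V]

omit [Fintype F] in
lemma exists_ne_one (hS : ∀ A : Module.End ℂ V, (∀ g, ρ g * A = A * ρ g) → ∃ c : ℂ, A = c • 1)
    (hd : 1 < Module.finrank ℂ V) : ∃ g, ρ g ≠ 1 := by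
  by_contra! h
  have h1 : Module.finrank ℂ (Module.End ℂ V) ≤ 1 := finrank_le_one (1 : Module.End ℂ V) fun A => by
    obtain ⟨c, hc⟩ := hS A fun g => by rw [h, one_mul, mul_one]
    exact ⟨c, hc.symm⟩
  have h2 : Module.finrank ℂ (Module.End ℂ V) = _ := Module.finrank_linearMap ℂ ℂ V V
  rw [h2] at h1
  nlinarith

lemma trace_isotypicProj_zero {ψ : AddChar F ℂ} (hψ : ψ.IsPrimitive)
    (hS : ∀ A : Module.End ℂ V, (∀ g, ρ g * A = A * ρ g) → ∃ c : ℂ, A = c • 1)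
    (hchar : ringChar F ≠ 2) (hq : 3 < Fintype.card F)
    (hd : 2 * Module.finrank ℂ V = Fintype.card F + 1) :
    LinearMap.trace ℂ V (isotypicProj ρ ψ 0) = 1 := by
  have hidem (c : F) : isotypicProj ρ ψ c * isotypicProj ρ ψ c = isotypicProj ρ ψ c := by
    simp [isotypicProj_mul_isotypicProj ρ hψ]
  choose n hn using fun c => show ∃ n : ℕ, LinearMap.trace ℂ V (isotypicProj ρ ψ c) = n from
    ⟨_, exists_trace_eq_natCast (hidem c)⟩
  have hsum : ∑ c, (n c : ℤ) = Module.finrank ℂ V := by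
    have : ∑ c, (n c : ℂ) = Module.finrank ℂ V := by
      rw [← LinearMap.trace_one ℂ V, ← sum_isotypicProj ρ hψ, map_sum]
      exact Finset.sum_congr rfl fun c _ => (hn c).symm
    exact_mod_cast this
  have hsq (c a : F) (ha : a ≠ 0) : n (c * a ^ 2) = n c := by
    have := trace_isotypicProj_mul_sq ρ ψ c ha
    rw [hn, hn] at this
    exact_mod_cast this
  obtain ⟨ν, hν⟩ := FiniteField.exists_nonsquare hchar
  have hν0 : ν ≠ 0 := fun h => hν (h ▸ IsSquare.zero)
  have hval (c : F) : 2 * (n c : ℤ) = (n 1 + n ν) + quadraticChar F c * (n 1 - n ν) +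
      if c = 0 then 2 * (n 0 : ℤ) - (n 1 + n ν) else 0 := by
    by_cases hc : c = 0
    · simp [hc]
    by_cases hcs : IsSquare c
    · rw [(quadraticChar_one_iff_isSquare hc).2 hcs]
      obtain ⟨a, rfl⟩ := hcs
      have ha : a ≠ 0 := fun h => hc (by simp [h])
      have := hsq 1 a ha
      rw [one_mul, pow_two] at this
      simp [this, ha]
      ring
    · have h1 : quadraticChar F (c / ν) = 1 := by
        rw [div_eq_mul_inv, map_mul, quadraticChar_neg_one_iff_not_isSquare.2 hcs,
          quadraticChar_neg_one_iff_not_isSquare.2 (fun h => hν (by simpa using h.inv))]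
        rfl
      rw [quadraticChar_neg_one_iff_not_isSquare.2 hcs]
      obtain ⟨a, ha⟩ := (quadraticChar_one_iff_isSquare (div_ne_zero hc hν0)).1 h1
      have hca : c = ν * a ^ 2 := by rw [pow_two, ← ha]; field_simp
      have ha0 : a ≠ 0 := fun h => hc (by simp [hca, h])
      have := hsq ν a ha0
      rw [← hca] at this
      simp [this, hc]
      ring
  have htot : 2 * (n 0 : ℤ) + (Fintype.card F - 1) * (n 1 + n ν) = Fintype.card F + 1 := by
    have h1 : ∑ c, 2 * (n c : ℤ) = Fintype.card F + 1 := by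
      rw [← Finset.mul_sum, hsum]; exact_mod_cast hd
    rw [Finset.sum_congr rfl fun c _ => hval c] at h1
    rw [Finset.sum_add_distrib, Finset.sum_add_distrib, ← Finset.sum_mul,
      quadraticChar_sum_zero hchar, Finset.sum_const, Finset.sum_ite_eq', Finset.card_univ,
      nsmul_eq_mul, zero_mul, if_pos (Finset.mem_univ _)] at h1
    linarith
  have hqz : (3 : ℤ) < Fintype.card F := by exact_mod_cast hq
  obtain hk | hk | hk : n 1 + n ν = 0 ∨ n 1 + n ν = 1 ∨ 2 ≤ n 1 + n ν := by omega
  · exfalso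
    have hk' : (n 1 : ℤ) + n ν = 0 := by exact_mod_cast hk
    rw [hk'] at htot
    have hn0 : n 0 = Module.finrank ℂ V := by omega
    have hz : (1 - isotypicProj ρ ψ 0 : Module.End ℂ V) = 0 := by
      have hi : IsIdempotentElem (1 - isotypicProj ρ ψ 0) :=
        IsIdempotentElem.one_sub (hidem 0)
      refine (LinearMap.IsIdempotentElem.trace_eq_zero_iff hi).1 ?_
      rw [map_sub, hn, hn0, LinearMap.trace_one, sub_self]
    have h1 : isotypicProj ρ ψ 0 = 1 := (sub_eq_zero.1 hz).symm
    obtain ⟨g, hg⟩ := exists_ne_one ρ hS (by omega)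
    refine hg (eq_one_of_upper_eq_one ρ (fun x => ?_) g)
    have := upper_mul_isotypicProj ρ ψ x 0
    simpa [h1] using this
  · have hk' : (n 1 : ℤ) + n ν = 1 := by exact_mod_cast hk
    rw [hk'] at htot
    have hn0 : n 0 = 1 := by omega
    rw [hn, hn0, Nat.cast_one]
  · have hk' : (2 : ℤ) ≤ n 1 + n ν := by exact_mod_cast hk
    nlinarith [Int.natCast_nonneg (n 0)]

/-- `e` is a rank one projection onto the vectors fixed by the upper unitriangular group. -/
structure IsBorelIdempotent {F : Type} [Field F] {V : Type} [AddCommGroup V] [Module ℂ V]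
    (ρ : SL₂ F →* Module.End ℂ V) (e : Module.End ℂ V) : Prop where
  idem : e * e = e
  trace_eq_one : LinearMap.trace ℂ V e = 1
  upper_mul : ∀ x, ρ (upper x) * e = e
  mul_eq_self : ∀ X : Module.End ℂ V, (∀ x, ρ (upper x) * X = X) → e * X = X
  comm : ∀ g : SL₂ F, g 1 0 = 0 → ρ g * e = e * ρ g
  trace_eq : ∀ g : SL₂ F, g 1 0 = 0 → g 0 0 ^ 2 ≠ 1 →
    LinearMap.trace ℂ V (ρ g) = LinearMap.trace ℂ V (ρ g * e)

lemma exists_isBorelIdempotent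
    (hS : ∀ A : Module.End ℂ V, (∀ g, ρ g * A = A * ρ g) → ∃ c : ℂ, A = c • 1)
    (hchar : ringChar F ≠ 2) (hq : 3 < Fintype.card F)
    (hd : 2 * Module.finrank ℂ V = Fintype.card F + 1) :
    ∃ e, IsBorelIdempotent ρ e := by
  have hψ := AddChar.FiniteField.primitiveChar_to_Complex_isPrimitive F
  set ψ := AddChar.FiniteField.primitiveChar_to_Complex F
  refine ⟨isotypicProj ρ ψ 0, ?_, trace_isotypicProj_zero ρ hψ hS hchar hq hd, fun x => ?_,
    fun X hX => ?_, fun g hg => ?_, fun g hg hg2 => ?_⟩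
  · simp [isotypicProj_mul_isotypicProj ρ hψ]
  · simp [upper_mul_isotypicProj]
  · simp [isotypicProj, Finset.sum_mul, hX, ← Nat.cast_smul_eq_nsmul ℂ]
  · simpa using triangular_mul_isotypicProj ρ ψ hg 0
  · have h0 : g 0 0 ≠ 0 := fun h => by simpa [h, hg] using det_eq_one g
    have h1 : ρ g = ∑ c, ρ g * isotypicProj ρ ψ c := by
      rw [← Finset.mul_sum, sum_isotypicProj ρ hψ, mul_one]
    conv_lhs => rw [h1, map_sum]
    refine Finset.sum_eq_single 0 (fun c _ hc => ?_) (by simp)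
    have hne : c / g 0 0 ^ 2 ≠ c := fun h => hg2 (by
      field_simp at h
      exact h.symm)
    have h2 : isotypicProj ρ ψ c = isotypicProj ρ ψ c * isotypicProj ρ ψ c := by
      simp [isotypicProj_mul_isotypicProj ρ hψ]
    rw [h2, ← mul_assoc, triangular_mul_isotypicProj ρ ψ hg, LinearMap.trace_mul_comm,
      ← mul_assoc, isotypicProj_mul_isotypicProj ρ hψ, if_neg hne, zero_mul, map_zero]

namespace IsBorelIdempotent

variable {ρ} {e : Module.End ℂ V} (he : IsBorelIdempotent ρ e)

include he

omit [Fintype F] in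
lemma trace_triangular_mul {b : SL₂ F} (hb : b 1 0 = 0) (g : SL₂ F) :
    LinearMap.trace ℂ V (ρ (b * g) * e) =
      LinearMap.trace ℂ V (ρ b * e) * LinearMap.trace ℂ V (ρ g * e) := by
  calc LinearMap.trace ℂ V (ρ (b * g) * e) = LinearMap.trace ℂ V ((ρ b * ρ g * e) * e) := by
        rw [map_mul ρ, mul_assoc (ρ b * ρ g) e e, he.idem]
    _ = LinearMap.trace ℂ V (ρ b * (e * ρ g * e)) := by
        rw [LinearMap.trace_mul_comm]
        simp only [← mul_assoc]
        rw [he.comm b hb]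
    _ = _ := by
        rw [rank_one_mul_mul he.idem he.trace_eq_one, mul_smul_comm, map_smul, smul_eq_mul,
          mul_comm]

omit [Fintype F] in
lemma trace_mul_triangular {b : SL₂ F} (hb : b 1 0 = 0) (g : SL₂ F) :
    LinearMap.trace ℂ V (ρ (g * b) * e) =
      LinearMap.trace ℂ V (ρ g * e) * LinearMap.trace ℂ V (ρ b * e) := by
  calc LinearMap.trace ℂ V (ρ (g * b) * e) = LinearMap.trace ℂ V (ρ g * (ρ b * e) * e) := by
        rw [map_mul ρ, mul_assoc (ρ g) (ρ b * e) e, mul_assoc (ρ b) e e, he.idem, ← mul_assoc]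
    _ = LinearMap.trace ℂ V (ρ g * (e * ρ b * e)) := by
        rw [he.comm b hb, mul_assoc]
    _ = _ := by
        rw [rank_one_mul_mul he.idem he.trace_eq_one, mul_smul_comm, map_smul, smul_eq_mul,
          mul_comm]

/-- The character of the torus on the line fixed by the upper unitriangular group. -/
noncomputable def torusChar : Fˣ →* ℂ where
  toFun a := LinearMap.trace ℂ V (ρ (torus a) * e)
  map_one' := by rw [torus_one, map_one, one_mul, he.trace_eq_one]
  map_mul' a b := by rw [torus_mul, he.trace_triangular_mul (by simp [coe_torus])]

omit [Fintype F] [FiniteDimensional ℂ V] in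
lemma trace_upper_mul (x : F) : LinearMap.trace ℂ V (ρ (upper x) * e) = 1 := by
  rw [he.upper_mul, he.trace_eq_one]

omit [Fintype F] in
lemma trace_triangular {b : SL₂ F} (hb : b 1 0 = 0) {a : Fˣ} (ha : (a : F) = b 0 0) :
    LinearMap.trace ℂ V (ρ b * e) = he.torusChar a := by
  obtain ⟨a', x, ha', rfl⟩ := exists_torus_mul_upper hb
  obtain rfl : a = a' := Units.ext (ha.trans ha'.symm)
  rw [he.trace_triangular_mul (by simp [coe_upper]), he.trace_upper_mul, one_mul]
  rfl

omit [Fintype F] in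
lemma torusChar_sq (a : Fˣ) : he.torusChar a ^ 2 = 1 := by
  by_cases h : a ^ 2 = 1
  · rw [← map_pow, h, map_one]
  · have h1 : (a : F) ^ 2 ≠ 1 := fun h' => h (Units.ext (by simpa using h'))
    have h2 := he.trace_eq (torus a) (by simp [coe_torus]) (by simpa [coe_torus] using h1)
    have h3 := he.trace_eq (torus a⁻¹) (by simp [coe_torus]) (by
      simpa [coe_torus] using h1)
    have h4 : LinearMap.trace ℂ V (ρ (torus a⁻¹)) = LinearMap.trace ℂ V (ρ (torus a)) := by
      rw [← weyl_mul_torus, map_mul, LinearMap.trace_mul_comm, ← map_mul,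
        inv_mul_cancel_left]
    have h5 : he.torusChar a = he.torusChar a⁻¹ := h2.symm.trans (h4.symm.trans h3)
    nth_rewrite 1 [pow_two]
    nth_rewrite 2 [h5]
    rw [← map_mul, mul_inv_cancel, map_one]

omit [Fintype F] in
lemma trace_nontriangular {g : SL₂ F} (hg : g 1 0 ≠ 0) :
    LinearMap.trace ℂ V (ρ g * e) =
      he.torusChar (Units.mk0 _ hg) * LinearMap.trace ℂ V (ρ weyl * e) := by
  conv_lhs => rw [bruhat hg]
  rw [he.trace_mul_triangular (by simp [coe_upper]), he.trace_triangular_mul (by simp [coe_upper]),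
    he.trace_triangular_mul (by simp [coe_torus]), he.trace_upper_mul, he.trace_upper_mul,
    one_mul, mul_one]
  change he.torusChar _ * _ = _
  congr 1
  have h1 := he.torusChar_sq (Units.mk0 _ hg)
  have h2 : he.torusChar (Units.mk0 _ hg) * he.torusChar (Units.mk0 _ hg)⁻¹ = 1 := by
    rw [← map_mul, mul_inv_cancel, map_one]
  linear_combination (-he.torusChar (Units.mk0 _ hg)⁻¹) * h1 + he.torusChar (Units.mk0 _ hg) * h2

omit [Fintype F] in
/-- The trace of a split element whose eigenvalues are squares. -/
lemma trace_eq_one_of_sq {g k : SL₂ F} (h0 : (k⁻¹ * g * k) 1 0 = 0) {a : F}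
    (ha : (k⁻¹ * g * k) 0 0 = a ^ 2) (ha4 : a ^ 4 ≠ 1) : LinearMap.trace ℂ V (ρ g) = 1 := by
  have h1 : LinearMap.trace ℂ V (ρ g) = LinearMap.trace ℂ V (ρ (k⁻¹ * g * k)) := by
    rw [map_mul, LinearMap.trace_mul_comm, ← map_mul, mul_inv_cancel_left]
  have ha0 : a ≠ 0 := by
    rintro rfl
    simpa [h0, ha] using det_eq_one (k⁻¹ * g * k)
  rw [h1, he.trace_eq _ h0 (by rw [ha, ← pow_mul]; exact ha4),
    he.trace_triangular h0 (a := Units.mk0 a ha0 ^ 2) (by simp [ha]), map_pow, he.torusChar_sq]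


lemma exists_sum_conj_eq
    (hS : ∀ A : Module.End ℂ V, (∀ g, ρ g * A = A * ρ g) → ∃ c : ℂ, A = c • 1) :
    ∃ c : ℂ, ∑ k : SL₂ F, ρ k * e * ρ k⁻¹ = c • 1 ∧
      c * Module.finrank ℂ V = Fintype.card (SL₂ F) := by
  have hinv (g : SL₂ F) : ρ g⁻¹ * ρ g = 1 := by rw [← map_mul, inv_mul_cancel, map_one]
  obtain ⟨c, hc⟩ := hS (∑ k : SL₂ F, ρ k * e * ρ k⁻¹) fun g => by
    rw [Finset.mul_sum, Finset.sum_mul]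
    refine Fintype.sum_equiv (Equiv.mulLeft g) _ _ fun k => ?_
    rw [Equiv.coe_mulLeft, _root_.mul_inv_rev, map_mul ρ g k, map_mul ρ k⁻¹ g⁻¹]
    simp only [mul_assoc, hinv, mul_one]
  refine ⟨c, hc, ?_⟩
  have h := congrArg (LinearMap.trace ℂ V) hc
  have h1 (k : SL₂ F) : LinearMap.trace ℂ V (ρ k * e * ρ k⁻¹) = 1 := by
    rw [LinearMap.trace_mul_comm, ← mul_assoc, hinv, one_mul, he.trace_eq_one]
  rw [map_sum, Finset.sum_congr rfl fun k _ => h1 k, map_smul, LinearMap.trace_one] at h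
  simpa using h.symm

lemma exists_torusChar_ne_one
    (hS : ∀ A : Module.End ℂ V, (∀ g, ρ g * A = A * ρ g) → ∃ c : ℂ, A = c • 1)
    (hq : 3 < Fintype.card F) (hd : 2 * Module.finrank ℂ V = Fintype.card F + 1) :
    ∃ a, he.torusChar a ≠ 1 := by
  by_contra! h
  set κ := LinearMap.trace ℂ V (ρ weyl * e) with hκ
  set N : ℕ := (Finset.univ.filter fun g : SL₂ F => g 1 0 = 0).card with hN
  have h0 {g : SL₂ F} (hg : g 1 0 = 0) : LinearMap.trace ℂ V (ρ g * e) = 1 := by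
    obtain ⟨a, -, ha, -⟩ := exists_torus_mul_upper hg
    rw [he.trace_triangular hg ha, h]
  have h1 {g : SL₂ F} (hg : g 1 0 ≠ 0) : LinearMap.trace ℂ V (ρ g * e) = κ := by
    rw [he.trace_nontriangular hg, h, one_mul]
  have hsplit {f : SL₂ F → ℂ} {a b : ℂ} (ha : ∀ g, g 1 0 = 0 → f g = a)
      (hb : ∀ g, g 1 0 ≠ 0 → f g = b) : ∑ g, f g = N * a + Fintype.card F * N * b := by
    rw [← Finset.sum_filter_add_sum_filter_not Finset.univ (fun g : SL₂ F => g 1 0 = 0) f,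
      Finset.sum_congr rfl fun g hg => ha g (Finset.mem_filter.1 hg).2,
      Finset.sum_congr rfl fun g hg => hb g (Finset.mem_filter.1 hg).2,
      Finset.sum_const, Finset.sum_const, card_nontriangular]
    simp [hN]
  have hN0 : (N : ℂ) ≠ 0 := by
    have : (1 : SL₂ F) ∈ Finset.univ.filter fun g : SL₂ F => g 1 0 = 0 := by simp
    exact_mod_cast (Finset.card_pos.2 ⟨_, this⟩).ne'
  have hsum : (N : ℂ) + Fintype.card F * N * κ = 0 := by
    have hl (g : SL₂ F) : ρ g * ∑ k, ρ k = ∑ k, ρ k := by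
      rw [Finset.mul_sum]
      exact Fintype.sum_equiv (Equiv.mulLeft g) _ _ fun k => by simp
    have hr (g : SL₂ F) : (∑ k, ρ k) * ρ g = ∑ k, ρ k := by
      rw [Finset.sum_mul]
      exact Fintype.sum_equiv (Equiv.mulRight g) _ _ fun k => by simp
    obtain ⟨c, hc⟩ := hS (∑ k, ρ k) fun g => by rw [hl, hr]
    have hc0 : c = 0 := by
      by_contra hc0
      have h2 := he.mul_eq_self (∑ k, ρ k) fun x => hl _
      rw [hc, mul_smul_comm, mul_one] at h2
      have h3 : e = 1 := smul_right_injective _ hc0 h2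
      have h4 := he.trace_eq_one
      rw [h3, LinearMap.trace_one] at h4
      have : Module.finrank ℂ V = 1 := by exact_mod_cast h4
      omega
    have h2 : ∑ k, LinearMap.trace ℂ V (ρ k * e) = 0 := by
      rw [← map_sum, ← Finset.sum_mul, hc, hc0, zero_smul, zero_mul, map_zero]
    rwa [hsplit (fun g => h0) (fun g => h1), mul_one] at h2
  obtain ⟨c, hc, hcd⟩ := he.exists_sum_conj_eq hS
  have hsq : (N : ℂ) + Fintype.card F * N * κ ^ 2 = c := by
    have h2 : ∑ k : SL₂ F, LinearMap.trace ℂ V (ρ k * e) * LinearMap.trace ℂ V (ρ k⁻¹ * e) = c := by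
      have h3 := congrArg (fun X => LinearMap.trace ℂ V (X * e)) hc
      simp only [smul_mul_assoc, one_mul, map_smul, he.trace_eq_one, Finset.sum_mul, map_sum,
        smul_eq_mul, mul_one] at h3
      rw [← h3]
      refine Finset.sum_congr rfl fun k _ => ?_
      rw [mul_assoc, mul_assoc, ← mul_assoc e, rank_one_mul_mul he.idem he.trace_eq_one,
        mul_smul_comm, map_smul, smul_eq_mul, mul_comm]
    rwa [hsplit (a := 1) (b := κ ^ 2) (fun g hg => by
      rw [h0 hg, h0 (by rw [inv_one_zero, hg, neg_zero]), one_mul]) (fun g hg => by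
      rw [h1 hg, h1 (by rwa [inv_one_zero, neg_ne_zero]), pow_two]), mul_one] at h2
  have hcard : (Fintype.card (SL₂ F) : ℂ) = N + Fintype.card F * N := by
    simpa using hsplit (f := fun _ => 1) (a := 1) (b := 1) (fun _ _ => rfl) (fun _ _ => rfl)
  have hd' : 2 * (Module.finrank ℂ V : ℂ) = Fintype.card F + 1 := by exact_mod_cast hd
  have hq1 : (Fintype.card F : ℂ) + 1 ≠ 0 := by
    exact_mod_cast Nat.succ_ne_zero (Fintype.card F)
  have e1 : (Fintype.card F : ℂ) * κ = -1 :=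
    mul_left_cancel₀ hN0 (by linear_combination hsum)
  have e2 : (Fintype.card F : ℂ) * κ ^ 2 = 1 := by
    refine mul_left_cancel₀ hN0 (mul_left_cancel₀ hq1 ?_)
    linear_combination (Fintype.card F + 1 : ℂ) * hsq - c * hd' + 2 * hcd + 2 * hcard
  have e3 : κ = -1 := by linear_combination κ * e1 - e2
  have e4 : (Fintype.card F : ℂ) = 1 := by linear_combination e1 * (-1) + e3 * Fintype.card F
  have : Fintype.card F = 1 := by exact_mod_cast e4
  omega

/-- The trace of an element without eigenvectors over `F`. -/
lemma trace_eq_zero_of_conj_one_zero_ne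
    (hS : ∀ A : Module.End ℂ V, (∀ g, ρ g * A = A * ρ g) → ∃ c : ℂ, A = c • 1)
    (hchar : ringChar F ≠ 2) (hq : 3 < Fintype.card F)
    (hd : 2 * Module.finrank ℂ V = Fintype.card F + 1)
    {g : SL₂ F} (hg : ∀ k : SL₂ F, (k⁻¹ * g * k) 1 0 ≠ 0) :
    LinearMap.trace ℂ V (ρ g) = 0 := by
  obtain ⟨c, hc, hcd⟩ := he.exists_sum_conj_eq hS
  have hc0 : c ≠ 0 := by
    rintro rfl
    rw [zero_mul] at hcd
    exact Fintype.card_ne_zero (by exact_mod_cast hcd.symm : Fintype.card (SL₂ F) = 0)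
  obtain ⟨μ, φ, hμ, hφ, hφg⟩ := exists_bijective_conj_one_zero (Ring.two_ne_zero hchar) hg
  have hμ0 : μ ≠ 0 := fun h => hμ (h ▸ IsSquare.zero)
  have hμ1 : he.torusChar (Units.mk0 μ hμ0) ≠ 1 := by
    obtain ⟨ν, hν⟩ := he.exists_torusChar_ne_one hS hq hd
    have hνs : ¬ IsSquare (ν : F) := by
      rintro ⟨a, ha⟩
      have ha0 : a ≠ 0 := fun h => ν.ne_zero (by simp [ha, h])
      have : ν = Units.mk0 a ha0 ^ 2 := Units.ext (by simp [ha, pow_two])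
      exact hν (by rw [this, map_pow, he.torusChar_sq])
    have h1 : quadraticChar F (ν / μ) = 1 := by
      rw [div_eq_mul_inv, map_mul, quadraticChar_neg_one_iff_not_isSquare.2 hνs,
        quadraticChar_neg_one_iff_not_isSquare.2 (fun h => hμ (by simpa using h.inv))]
      rfl
    obtain ⟨a, ha⟩ := (quadraticChar_one_iff_isSquare (div_ne_zero ν.ne_zero hμ0)).1 h1
    have ha0 : a ≠ 0 := fun h => div_ne_zero ν.ne_zero hμ0 (by simp [ha, h])
    have : ν = Units.mk0 μ hμ0 * Units.mk0 a ha0 ^ 2 := Units.ext (by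
      simp only [Units.val_mul, Units.val_mk0, pow_two, ← ha]
      field_simp)
    rwa [this, map_mul, map_pow, he.torusChar_sq, mul_one] at hν
  set S := ∑ k : SL₂ F, he.torusChar (Units.mk0 _ (hg k)) with hSdef
  have hS0 : S = 0 := by
    have h1 : S = he.torusChar (Units.mk0 μ hμ0) * S := by
      rw [hSdef, Finset.mul_sum]
      conv_lhs => rw [← hφ.sum_comp]
      refine Finset.sum_congr rfl fun k _ => ?_
      rw [← map_mul]
      congr 1
      exact Units.ext (hφg k)
    have h2 : (he.torusChar (Units.mk0 μ hμ0) - 1) * S = 0 := by linear_combination -h1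
    exact (mul_eq_zero.1 h2).resolve_left (sub_ne_zero.2 hμ1)
  have h1 : c * LinearMap.trace ℂ V (ρ g) = S * LinearMap.trace ℂ V (ρ weyl * e) := by
    calc c * LinearMap.trace ℂ V (ρ g)
        = LinearMap.trace ℂ V (ρ g * ∑ k : SL₂ F, ρ k * e * ρ k⁻¹) := by
          rw [hc, mul_smul_comm, mul_one, map_smul, smul_eq_mul]
      _ = ∑ k : SL₂ F, LinearMap.trace ℂ V (ρ (k⁻¹ * g * k) * e) := by
          rw [Finset.mul_sum, map_sum]
          refine Finset.sum_congr rfl fun k _ => ?_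
          rw [← mul_assoc, LinearMap.trace_mul_comm, map_mul ρ, map_mul ρ]
          simp only [mul_assoc]
      _ = _ := by
          rw [Finset.sum_mul]
          exact Finset.sum_congr rfl fun k _ => he.trace_nontriangular (hg k)
  rw [hS0, zero_mul] at h1
  exact (mul_eq_zero.1 h1).resolve_left hc0

end IsBorelIdempotent

end HalfPrincipal

section Elements

variable {F : Type} [Field F]

lemma upper_pow (x : F) (n : ℕ) : upper x ^ n = upper (n * x) := by
  induction n with
  | zero => simp [upper_zero]
  | succ n ih => rw [pow_succ, ih, ← upper_add]; push_cast; ring_nf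

lemma pow_of_triangular {h : SL₂ F} (h0 : h 1 0 = 0) (n : ℕ) :
    (h ^ n) 1 0 = 0 ∧ (h ^ n) 0 0 = h 0 0 ^ n := by
  induction n with
  | zero => simp
  | succ n ih =>
    rw [pow_succ (h 0 0), pow_succ h]
    simp only [Matrix.SpecialLinearGroup.coe_mul, Matrix.mul_apply, Fin.sum_univ_two, ih.1, ih.2, h0]
    simp

lemma eq_one_of_pow_eq_one {h : SL₂ F} (h0 : h 1 0 = 0) (h1 : h 0 0 = 1) {n : ℕ}
    (hn : (n : F) ≠ 0) (hh : h ^ n = 1) : h = 1 := by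
  obtain ⟨a, x, ha, rfl⟩ := exists_torus_mul_upper h0
  obtain rfl : a = 1 := Units.ext (ha.trans h1)
  rw [torus_one, mul_one] at hh ⊢
  rw [upper_pow] at hh
  have h2 := congrArg (fun g : SL₂ F => g 0 1) hh
  simp [coe_upper, hn] at h2
  rw [h2, upper_zero]

lemma conj_pow_eq {g k : SL₂ F} (n : ℕ) : (k⁻¹ * g * k) ^ n = k⁻¹ * g ^ n * k := by
  simpa using conj_pow (a := k⁻¹) (b := g) (i := n)

lemma eq_one_of_conj_eq_one {g k : SL₂ F} (h : k⁻¹ * g * k = 1) : g = 1 := by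
  have : g = k * (k⁻¹ * g * k) * k⁻¹ := by group
  rw [this, h, mul_one, mul_inv_cancel]

lemma mk_eq_one_of_sq {g : SL₂ F} (h2 : (2 : F) ≠ 0) (hg : g ^ 2 = 1) :
    (g : PSL2 F) = 1 := by
  rw [QuotientGroup.eq_one_iff, Matrix.SpecialLinearGroup.mem_center_iff]
  have h : g⁻¹ = g := inv_eq_of_mul_eq_one_left (by rw [← pow_two, hg])
  have e (i j) : g⁻¹ i j = g i j := by rw [h]
  have e00 := e 0 0
  have e01 := e 0 1
  have e10 := e 1 0
  simp [Matrix.SpecialLinearGroup.coe_inv, Matrix.adjugate_fin_two] at e00 e01 e10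
  have z01 : g 0 1 = 0 := (mul_eq_zero.1 (by linear_combination -e01 : 2 * g 0 1 = 0)).resolve_left h2
  have z10 : g 1 0 = 0 := (mul_eq_zero.1 (by linear_combination -e10 : 2 * g 1 0 = 0)).resolve_left h2
  have hd := det_eq_one g
  refine ⟨g 0 0, ?_, ?_⟩
  · rw [e00, z01] at hd
    simp [pow_two]
    linear_combination hd
  · ext i j
    fin_cases i <;> fin_cases j <;> simp [z01, z10, e00]

lemma eq_or_eq_neg_of_mem_center {g : SL₂ F} (hg : g ∈ Subgroup.center (SL₂ F)) :
    g = 1 ∨ g = -1 := by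
  obtain ⟨r, hr, h⟩ := Matrix.SpecialLinearGroup.mem_center_iff.1 hg
  rw [Fintype.card_fin] at hr
  rcases sq_eq_one_iff.1 hr with rfl | rfl
  · left
    ext i j
    simp [← h]
  · right
    ext i j
    rw [Matrix.SpecialLinearGroup.coe_neg, ← h]
    fin_cases i <;> fin_cases j <;> simp

lemma exists_conj_triangular_of_pow_eq_one [Fintype F] {n : ℕ} (hn : 0 < n)
    (hdvd : n ∣ Fintype.card F - 1) {g : SL₂ F} (hg : g ^ n = 1) :
    ∃ k : SL₂ F, (k⁻¹ * g * k) 1 0 = 0 := by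
  obtain ⟨u, hu⟩ := IsCyclic.exists_generator (α := Fˣ)
  have hord : orderOf u = Fintype.card F - 1 := by
    rw [orderOf_eq_card_of_forall_mem_zpowers hu, Nat.card_eq_fintype_card, Fintype.card_units]
  obtain ⟨m, hm⟩ := hdvd
  have hpos : 0 < n * m := hm ▸ Nat.sub_pos_of_lt Fintype.one_lt_card
  have hζ : IsPrimitiveRoot ((u ^ m : Fˣ) : F) n := by
    rw [IsPrimitiveRoot.coe_units_iff]
    have : orderOf (u ^ m) = n := by
      rw [orderOf_pow_of_dvd (Nat.pos_of_mul_pos_left hpos).ne' (by rw [hord, hm]; exact ⟨n, mul_comm _ _⟩),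
        hord, hm, Nat.mul_div_cancel _ (Nat.pos_of_mul_pos_left hpos)]
    exact this ▸ IsPrimitiveRoot.orderOf (u ^ m)
  let M : Matrix (Fin 2) (Fin 2) F := g
  have hM : M ^ n = 1 := by
    rw [← Matrix.SpecialLinearGroup.coe_pow, hg, Matrix.SpecialLinearGroup.coe_one]
  let D : Polynomial F →* F :=
    Matrix.detMonoidHom.comp (MonoidHomClass.toMonoidHom (Polynomial.aeval (R := F) M))
  have h1 := congrArg D (Polynomial.X_pow_sub_one_eq_prod hn hζ)
  have h2 : D (Polynomial.X ^ n - 1) = 0 := by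
    simp [D, hM]
  rw [map_prod, h2] at h1
  obtain ⟨ζ, -, h3⟩ := Finset.prod_eq_zero_iff.1 h1.symm
  replace h3 : (M - algebraMap F _ ζ).det = 0 := by simpa [D] using h3
  obtain ⟨v, hv, hMv⟩ := Matrix.exists_mulVec_eq_zero_iff.2 h3
  obtain ⟨k, hk, -⟩ := exists_conj_triangular (g := g) hv (a := ζ) (by
    rw [Matrix.sub_mulVec, sub_eq_zero] at hMv
    rw [hMv, Algebra.algebraMap_eq_smul_one, Matrix.smul_mulVec, Matrix.one_mulVec])
  exact ⟨k, hk⟩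

end Elements

section Traces

variable {F : Type} [Field F] [Fintype F] {V : Type} [AddCommGroup V] [Module ℂ V]
  [FiniteDimensional ℂ V] {ρ : SL₂ F →* Module.End ℂ V} {e : Module.End ℂ V}
  (he : IsBorelIdempotent ρ e)

include he

lemma IsBorelIdempotent.trace_eq_one_of_pow_eq_one {n : ℕ} (hodd : Odd n)
    (hdvd : n ∣ Fintype.card F - 1) {g : SL₂ F} (hg : g ^ n = 1) (hg1 : g ≠ 1) :
    LinearMap.trace ℂ V (ρ g) = 1 := by
  obtain ⟨k, hk⟩ := exists_conj_triangular_of_pow_eq_one hodd.pos hdvd hg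
  have hn : (n : F) ≠ 0 := by
    intro hn0
    obtain ⟨m, hm⟩ := hdvd
    have h1 : Fintype.card F = n * m + 1 := by
      have := Fintype.card_pos (α := F)
      omega
    have h2 := congrArg (Nat.cast : ℕ → F) h1
    simp [hn0] at h2
  have hpow : (k⁻¹ * g * k) ^ n = 1 := by rw [conj_pow_eq, hg, mul_one, inv_mul_cancel]
  have ha := (pow_of_triangular hk n).2
  rw [hpow] at ha
  set a := (k⁻¹ * g * k) 0 0
  have ha : a ^ n = 1 := by simpa using ha.symm
  obtain ⟨j, rfl⟩ := hodd
  have hsq : a = (a ^ (j + 1)) ^ 2 := by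
    linear_combination (-a) * ha
  refine he.trace_eq_one_of_sq hk hsq fun h4 => ?_
  have ha2 : a ^ 2 = 1 := by
    rw [hsq, ← pow_mul]
    exact h4
  have ha1 : a = 1 := by
    rw [pow_succ, pow_mul, ha2, one_pow, one_mul] at ha
    exact ha
  exact hg1 (eq_one_of_conj_eq_one (eq_one_of_pow_eq_one hk ha1 hn hpow))

lemma IsBorelIdempotent.trace_eq_one_of_sq_eq_neg_one (h2 : ringChar F ≠ 2)
    (hdvd : 8 ∣ Fintype.card F - 1) {g : SL₂ F} (hg : g ^ 2 = -1) :
    LinearMap.trace ℂ V (ρ g) = 1 := by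
  have hg4 : g ^ 4 = 1 := by
    rw [show 4 = 2 * 2 from rfl, pow_mul, hg, neg_sq, one_pow]
  obtain ⟨k, hk⟩ := exists_conj_triangular_of_pow_eq_one (by norm_num)
    (Dvd.dvd.trans (by norm_num : 4 ∣ 8) hdvd) hg4
  have hpow : (k⁻¹ * g * k) ^ 2 = -1 := by
    rw [conj_pow_eq, hg, mul_neg, mul_one, neg_mul, inv_mul_cancel]
  have ha := (pow_of_triangular hk 2).2
  rw [hpow] at ha
  obtain ⟨a, haa⟩ : ∃ a, a = (k⁻¹ * g * k) 0 0 := ⟨_, rfl⟩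
  rw [← haa] at ha
  have ha : a ^ 2 = -1 := by simpa using ha.symm
  have ha0 : a ≠ 0 := by
    rintro rfl
    simp at ha
  obtain ⟨b, hb⟩ : IsSquare a := by
    rw [FiniteField.isSquare_iff h2 ha0]
    obtain ⟨j, hj⟩ := hdvd
    have : Fintype.card F / 2 = 4 * j := by omega
    rw [this, pow_mul, show a ^ 4 = (a ^ 2) ^ 2 by ring, ha, neg_sq, one_pow, one_pow]
  refine he.trace_eq_one_of_sq hk (a := b) (by rw [← haa, hb, pow_two]) fun h4 => ?_
  exact Ring.neg_one_ne_one_of_char_ne_two h2 (by rw [← ha, ← h4, hb]; ring)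

lemma IsBorelIdempotent.trace_eq_zero_of_pow_eq_one
    (hS : ∀ A : Module.End ℂ V, (∀ g, ρ g * A = A * ρ g) → ∃ c : ℂ, A = c • 1)
    (hchar : ringChar F ≠ 2) (hq : 3 < Fintype.card F)
    (hd : 2 * Module.finrank ℂ V = Fintype.card F + 1)
    {n : ℕ} (hodd : Odd n) (hdvd : n ∣ Fintype.card F + 1) {g : SL₂ F} (hg : g ^ n = 1)
    (hg1 : g ≠ 1) :
    LinearMap.trace ℂ V (ρ g) = 0 := by
  refine he.trace_eq_zero_of_conj_one_zero_ne hS hchar hq hd fun k hk => ?_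
  have hn : (n : F) ≠ 0 := by
    intro hn0
    obtain ⟨m, hm⟩ := hdvd
    have h2 := congrArg (Nat.cast : ℕ → F) hm
    simp [hn0] at h2
  have hpow : (k⁻¹ * g * k) ^ n = 1 := by rw [conj_pow_eq, hg, mul_one, inv_mul_cancel]
  have ha := (pow_of_triangular hk n).2
  rw [hpow] at ha
  set a := (k⁻¹ * g * k) 0 0
  have ha : a ^ n = 1 := by simpa using ha.symm
  have ha0 : a ≠ 0 := by
    intro h
    rw [h, zero_pow hodd.pos.ne'] at ha
    exact zero_ne_one ha
  have hgcd : n.gcd (Fintype.card F - 1) = 1 := by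
    have h1 : n.gcd (Fintype.card F - 1) ∣ 2 := by
      have := Nat.dvd_sub ((Nat.gcd_dvd_left n (Fintype.card F - 1)).trans hdvd)
        (Nat.gcd_dvd_right n (Fintype.card F - 1))
      rwa [show Fintype.card F + 1 - (Fintype.card F - 1) = 2 by omega] at this
    rcases (Nat.dvd_prime Nat.prime_two).1 h1 with h | h
    · exact h
    · exact absurd (h ▸ Nat.gcd_dvd_left n (Fintype.card F - 1)) hodd.not_two_dvd_nat
  have ha1 : a = 1 := by
    have := orderOf_dvd_of_pow_eq_one ha
    have h1 := Nat.dvd_gcd this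
      (orderOf_dvd_of_pow_eq_one (FiniteField.pow_card_sub_one_eq_one a ha0))
    rwa [hgcd, Nat.dvd_one, orderOf_eq_one_iff] at h1
  exact hg1 (eq_one_of_conj_eq_one (eq_one_of_pow_eq_one hk ha1 hn hpow))

end Traces

section Characters

lemma exists_eq_smul_one {G : Type} [Group G] (W : FDRep ℂ G) [CategoryTheory.Simple W]
    (A : Module.End ℂ W) (hA : ∀ g, W.ρ g * A = A * W.ρ g) : ∃ c : ℂ, A = c • 1 := by
  let f : W ⟶ W := ⟨CategoryTheory.InducedCategory.homMk (ModuleCat.ofHom A), fun g => by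
    ext1
    exact (hA g).symm⟩
  obtain ⟨c, hc⟩ := CategoryTheory.endomorphism_simple_eq_smul_id ℂ f
  refine ⟨c, ?_⟩
  have := congrArg (fun φ : W ⟶ W => φ.hom.hom.hom) hc
  exact this.symm

/-- The values at elements of small order of an irreducible character of degree `(q + 1) / 2`. -/
lemma character_values {F : Type} [Field F] [Fintype F] {χ : PSL2 F → ℂ}
    (hχ : IsIrrCharacter (PSL2 F) χ) (h8 : Fintype.card F % 8 = 1)
    (hdeg : χ 1 = ((Fintype.card F : ℂ) + 1) / 2) :
    (∀ h : PSL2 F, h ^ 2 = 1 → h ≠ 1 → χ h = 1) ∧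
    (∀ n : ℕ, Odd n → n ∣ Fintype.card F - 1 → ∀ h : PSL2 F, h ^ n = 1 → h ≠ 1 → χ h = 1) ∧
    (∀ n : ℕ, Odd n → n ∣ Fintype.card F + 1 → ∀ h : PSL2 F, h ^ n = 1 → h ≠ 1 → χ h = 0) := by
  obtain ⟨W, hW, rfl⟩ := hχ
  have hq : 3 < Fintype.card F := by
    have := Fintype.one_lt_card (α := F)
    omega
  have hchar : ringChar F ≠ 2 := fun h => by
    have := FiniteField.even_card_iff_char_two.1 h
    omega
  have h2 : (2 : F) ≠ 0 := Ring.two_ne_zero hchar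
  let ρ : SL₂ F →* Module.End ℂ W := W.ρ.comp (QuotientGroup.mk' _)
  have hS (A : Module.End ℂ W) (hA : ∀ g, ρ g * A = A * ρ g) : ∃ c : ℂ, A = c • 1 :=
    exists_eq_smul_one W A fun g => by
      obtain ⟨g, rfl⟩ := QuotientGroup.mk_surjective g
      exact hA g
  have hd : 2 * Module.finrank ℂ W = Fintype.card F + 1 := by
    rw [FDRep.char_one] at hdeg
    have : 2 * (Module.finrank ℂ W : ℂ) = Fintype.card F + 1 := by rw [hdeg]; ring
    exact_mod_cast this
  obtain ⟨e, he⟩ := exists_isBorelIdempotent ρ hS hchar hq hd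
  have htr (g : SL₂ F) : W.character (g : PSL2 F) = LinearMap.trace ℂ W (ρ g) := rfl
  have lift (n : ℕ) (hn : Odd n) (h : PSL2 F) (hh : h ^ n = 1) :
      ∃ g : SL₂ F, (g : PSL2 F) = h ∧ g ^ n = 1 := by
    obtain ⟨g, rfl⟩ := QuotientGroup.mk_surjective h
    rw [← QuotientGroup.mk_pow, QuotientGroup.eq_one_iff] at hh
    rcases eq_or_eq_neg_of_mem_center hh with h | h
    · exact ⟨g, rfl, h⟩
    · refine ⟨-g, ?_, by rw [hn.neg_pow, h, neg_neg]⟩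
      rw [QuotientGroup.eq]
      have : (-g)⁻¹ * g = g ^ n := by
        rw [inv_mul_eq_iff_eq_mul, h, mul_neg, mul_one, neg_neg]
      rwa [this]
  have ne1 {g : SL₂ F} (hg : (g : PSL2 F) ≠ 1) : g ≠ 1 := fun h => hg (by rw [h]; rfl)
  refine ⟨fun h hh h1 => ?_, fun n hn hdvd h hh h1 => ?_, fun n hn hdvd h hh h1 => ?_⟩
  · obtain ⟨g, rfl⟩ := QuotientGroup.mk_surjective h
    rw [← QuotientGroup.mk_pow, QuotientGroup.eq_one_iff] at hh
    rcases eq_or_eq_neg_of_mem_center hh with h | h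
    · exact absurd (mk_eq_one_of_sq h2 h) h1
    · rw [htr, he.trace_eq_one_of_sq_eq_neg_one hchar (by omega) h]
  · obtain ⟨g, rfl, hg⟩ := lift n hn h hh
    rw [htr, he.trace_eq_one_of_pow_eq_one hn hdvd hg (ne1 h1)]
  · obtain ⟨g, rfl, hg⟩ := lift n hn h hh
    rw [htr, he.trace_eq_zero_of_pow_eq_one hS hchar hq hd hn hdvd hg (ne1 h1)]

lemma restMult_pow {G : Type} [Group G] [Finite G] {H : Subgroup G} {p : ℕ} (hp : p.Prime)
    (hH : Nat.card H = p) {θ : H →* ℂˣ} (hθ : Function.Injective θ) {χ : G → ℂ} {c : ℂ}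
    (hχ : ∀ h : G, h ^ p = 1 → h ≠ 1 → χ h = c) {k : ℕ} (hk : ¬ p ∣ k) :
    restMult H (θ ^ k) χ = (χ 1 - c) / p := by
  let : Fintype H := Fintype.ofFinite H
  have : Fact p.Prime := ⟨hp⟩
  have hpow (h : H) : (h : G) ^ p = 1 := by
    rw [← Subgroup.coe_pow, ← hH, pow_card_eq_one', Subgroup.coe_one]
  have hne : (Units.coeHom ℂ).comp (θ ^ k)⁻¹ ≠ 1 := by
    intro h
    obtain ⟨x, hx⟩ : ∃ x : H, x ≠ 1 := by
      have : Nontrivial H := Finite.one_lt_card_iff_nontrivial.1 (hH ▸ hp.one_lt)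
      exact exists_ne 1
    have h1 : orderOf x = p := orderOf_eq_prime (Subtype.ext (hpow x)) hx
    have h2 : ((θ x : ℂ) ^ k)⁻¹ = 1 := by simpa using DFunLike.congr_fun h x
    have h3 : θ (x ^ k) = θ 1 := by
      ext
      simpa using h2
    exact hk (h1 ▸ orderOf_dvd_of_pow_eq_one (hθ h3))
  have hsum : ∑ h : H, (((θ ^ k) h : ℂˣ) : ℂ)⁻¹ = 0 := by
    simpa using sum_hom_units_eq_zero _ hne
  have hterm (h : H) : χ h * (((θ ^ k) h : ℂˣ) : ℂ)⁻¹ =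
      c * (((θ ^ k) h : ℂˣ) : ℂ)⁻¹ + if h = 1 then χ 1 - c else 0 := by
    by_cases h1 : h = 1
    · simp [h1]
    · rw [hχ h (hpow h) (fun h' => h1 (Subtype.ext h')), if_neg h1, add_zero]
  unfold restMult
  rw [Finset.sum_congr rfl fun h _ => hterm h, Finset.sum_add_distrib, ← Finset.mul_sum, hsum, hH]
  simp [div_eq_inv_mul]

end Characters

end PSL2Ramification

theorem ramification_module_q1mod8
    (q : ℕ) (hq : IsPrimePow q) (hgcd : Nat.Coprime q 42)
    (hq7 : q % 7 = 1 ∨ q % 7 = 6)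
    (F : Type) [Field F] [Fintype F] (hF : Fintype.card F = q)
    (H2 H3 H7 : Subgroup (PSL2 F))
    (hH2 : Nat.card H2 = 2) (hH3 : Nat.card H3 = 3) (hH7 : Nat.card H7 = 7)
    (θ2 : H2 →* ℂˣ) (θ3 : H3 →* ℂˣ) (θ7 : H7 →* ℂˣ)
    (hθ2 : Function.Injective θ2) (hθ3 : Function.Injective θ3)
    (hθ7 : Function.Injective θ7)
    (hq8 : q % 8 = 1)
    (χ : PSL2 F → ℂ) (hχ : IsIrrCharacter (PSL2 F) χ) (hdeg : χ 1 = ((q : ℂ) + 1) / 2)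
    :
    ramMult H2 H3 H7 θ2 θ3 θ7 χ = (baseMult q : ℂ) / 2 := by
  subst hF
  obtain ⟨h2, hsplit, hnonsplit⟩ := PSL2Ramification.character_values hχ hq8 hdeg
  have hq3 : Fintype.card F % 3 = 1 ∨ Fintype.card F % 3 = 2 := by
    have h3 : ¬ 3 ∣ Fintype.card F := fun h =>
      absurd (Nat.dvd_gcd h (by norm_num : 3 ∣ 42)) (by rw [hgcd]; norm_num)
    omega
  have values {n : ℕ} (hn : Odd n)
      (hmod : n ∣ Fintype.card F - 1 ∨ n ∣ Fintype.card F + 1) :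
      ∀ h : PSL2 F, h ^ n = 1 → h ≠ 1 → χ h = if n ∣ Fintype.card F - 1 then 1 else 0 := by
    intro h hh h1
    split_ifs with hd
    · exact hsplit n hn hd h hh h1
    · exact hnonsplit n hn (hmod.resolve_left hd) h hh h1
  have r2 := PSL2Ramification.restMult_pow Nat.prime_two hH2 hθ2 h2 (k := 1) (by norm_num)
  have r3 {k : ℕ} := PSL2Ramification.restMult_pow Nat.prime_three hH3 hθ3
    (values (n := 3) (by decide) (by omega)) (k := k)
  have r7 {k : ℕ} := PSL2Ramification.restMult_pow (by norm_num : Nat.Prime 7) hH7 hθ7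
    (values (n := 7) (by decide) (by omega)) (k := k)
  have r3' := r3 (k := 1) (by norm_num)
  rw [show θ2 ^ 1 = θ2 from pow_one θ2] at r2
  rw [show θ3 ^ 1 = θ3 from pow_one θ3] at r3'
  have hsum : ∑ k ∈ Finset.Icc (1 : ℕ) 6, (k : ℂ) * restMult H7 (θ7 ^ k) χ =
      21 * ((χ 1 - if 7 ∣ Fintype.card F - 1 then 1 else 0) / (7 : ℕ)) := by
    rw [Finset.sum_congr rfl fun k hk => by
      rw [r7 (k := k) (by have := Finset.mem_Icc.1 hk; omega)], ← Finset.sum_mul]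
    congr 1
    simp [Finset.sum_Icc_succ_top]
    norm_num
  rw [ramMult, r2, r3', r3 (k := 2) (by norm_num), hsum, hdeg]
  have b2 : ((Fintype.card F : ℤ) - (if Fintype.card F % 4 = 1 then 1 else -1)) / 4 * 4 =
      (Fintype.card F : ℤ) - 1 := by
    rw [if_pos (by omega)]
    omega
  have b3 : ((Fintype.card F : ℤ) - (if Fintype.card F % 3 = 1 then 1 else -1)) / 3 * 3 =
      (Fintype.card F : ℤ) + 1 - 2 * (if 3 ∣ Fintype.card F - 1 then 1 else 0) := by
    split_ifs <;> omega
  have b7 : ((Fintype.card F : ℤ) - (if Fintype.card F % 7 = 1 then 1 else -1)) / 7 * 7 =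
      (Fintype.card F : ℤ) + 1 - 2 * (if 7 ∣ Fintype.card F - 1 then 1 else 0) := by
    split_ifs <;> omega
  have c2 := congrArg (Int.cast : ℤ → ℂ) b2
  have c3 := congrArg (Int.cast : ℤ → ℂ) b3
  have c7 := congrArg (Int.cast : ℤ → ℂ) b7
  unfold baseMult
  push_cast at c2 c3 c7 ⊢
  linear_combination (-1 / 8 : ℂ) * c2 - (1 / 6 : ℂ) * c3 - (3 / 14 : ℂ) * c7
end

section
/- Suppose q ≡ 5 (mod 8). Then for every irreducible complex character χ of G with χ(1) = (q+1)/2, Γ(χ) = (m+1)/2. -/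
open scoped BigOperators Classical

section SpecialLinearTwo

open Matrix MatrixGroups

variable {F : Type} [Field F]

lemma SL2.mem_center_iff_entries (x : SL(2, F)) :
    x ∈ Subgroup.center SL(2, F) ↔ x 0 1 = 0 ∧ x 1 0 = 0 ∧ x 0 0 = x 1 1 := by
  rw [Matrix.SpecialLinearGroup.mem_center_iff]
  constructor
  · rintro ⟨r, -, h⟩
    refine ⟨?_, ?_, ?_⟩ <;> simp [← h]
  · rintro ⟨h01, h10, h⟩
    have hdet := x.det_coe
    rw [det_fin_two] at hdet
    refine ⟨x 0 0, ?_, ?_⟩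
    · simp only [Fintype.card_fin]
      linear_combination hdet + x 0 0 * h + h01 * x 1 0
    · ext i j
      fin_cases i <;> fin_cases j <;> simp [h01, h10, h]

lemma SL2.neg_one_mem_center : (-1 : SL(2, F)) ∈ Subgroup.center SL(2, F) := by
  rw [SL2.mem_center_iff_entries]
  simp

lemma SL2.mul_self_eq (x : SL(2, F)) :
    (x : Matrix (Fin 2) (Fin 2) F) * x = x.1.trace • (x : Matrix (Fin 2) (Fin 2) F) - 1 := by
  have hdet := x.det_coe
  rw [det_fin_two] at hdet
  ext i j
  fin_cases i <;> fin_cases j <;> simp [mul_apply, Fin.sum_univ_two, trace_fin_two]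
  · linear_combination -hdet
  · ring
  · ring
  · linear_combination -hdet

lemma SL2.trace_conj (g x : SL(2, F)) : (g * x * g⁻¹).1.trace = x.1.trace := by
  have h : (g * x * g⁻¹).1 = g.1 * x.1 * (g⁻¹).1 := by
    rw [Matrix.SpecialLinearGroup.coe_mul, Matrix.SpecialLinearGroup.coe_mul]
  rw [h, Matrix.trace_mul_cycle, ← Matrix.SpecialLinearGroup.coe_mul]
  simp

/-- A nondegenerate binary quadratic form over a finite field of odd order represents `1`. -/
lemma exists_quadratic_form_eq_one [Fintype F] (h2 : (2 : F) ≠ 0) (hodd : Fintype.card F % 2 = 1)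
    (a b c : F) (hD : b ^ 2 - 4 * a * c ≠ 0) :
    ∃ s t : F, a * s ^ 2 + b * s * t + c * t ^ 2 = 1 := by
  by_cases ha : a = 0
  · subst ha
    have hb : b ≠ 0 := by
      rintro rfl
      simp at hD
    refine ⟨(1 - c) / b, 1, ?_⟩
    field_simp
    ring
  · open Polynomial in
    obtain ⟨X, Y, hXY⟩ := FiniteField.exists_root_sum_quadratic (R := F)
      (f := X ^ 2 - C (4 * a)) (g := C (-(b ^ 2 - 4 * a * c)) * X ^ 2)
      (degree_X_pow_sub_C (by decide) _) (degree_C_mul_X_pow 2 (neg_ne_zero.mpr hD)) hodd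
    simp only [Polynomial.eval_sub, Polynomial.eval_pow, Polynomial.eval_X, Polynomial.eval_C,
      Polynomial.eval_mul] at hXY
    refine ⟨(X - b * Y) / (2 * a), Y, ?_⟩
    field_simp
    linear_combination hXY

lemma SL2.exists_mul_eq_mul_companion [Fintype F] (h2 : (2 : F) ≠ 0)
    (hodd : Fintype.card F % 2 = 1) (x : SL(2, F)) (hD : x.1.trace ^ 2 ≠ 4) :
    ∃ P : SL(2, F), x.1 * P.1 = P.1 * !![0, -1; 1, x.1.trace] := by
  have hdet := x.det_coe
  rw [det_fin_two] at hdet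
  obtain ⟨s, t, hst⟩ := exists_quadratic_form_eq_one h2 hodd (x 1 0) (x 1 1 - x 0 0) (-(x 0 1)) (by
    intro h
    apply hD
    rw [trace_fin_two]
    linear_combination h + 4 * hdet)
  refine ⟨⟨!![s, x 0 0 * s + x 0 1 * t; t, x 1 0 * s + x 1 1 * t], ?_⟩, ?_⟩
  · rw [det_fin_two]
    simp
    linear_combination hst
  · ext i j
    fin_cases i <;> fin_cases j <;> simp [mul_apply, Fin.sum_univ_two, trace_fin_two]
    · linear_combination -s * hdet
    · linear_combination -t * hdet

lemma SL2.isConj_of_trace_eq [Fintype F] (h2 : (2 : F) ≠ 0)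
    (hodd : Fintype.card F % 2 = 1) (x y : SL(2, F)) (hxy : x.1.trace = y.1.trace)
    (hD : x.1.trace ^ 2 ≠ 4) : ∃ g : SL(2, F), g * x * g⁻¹ = y := by
  obtain ⟨P, hP⟩ := SL2.exists_mul_eq_mul_companion h2 hodd x hD
  obtain ⟨Q, hQ⟩ := SL2.exists_mul_eq_mul_companion h2 hodd y (hxy ▸ hD)
  refine ⟨Q * P⁻¹, ?_⟩
  let K : SL(2, F) := ⟨!![0, -1; 1, x.1.trace], by simp [det_fin_two]⟩
  have h1 : x * P = P * K := Subtype.ext hP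
  have h2 : y * Q = Q * K := Subtype.ext (by rw [← hxy] at hQ; exact hQ)
  rw [eq_mul_inv_of_mul_eq h1, eq_mul_inv_of_mul_eq h2]
  group

lemma SL2.pow_eq_of_trace_eq (x : SL(2, F)) (e : F) (he : e ^ 2 = 1) (hx : x.1.trace = 2 * e)
    (k : ℕ) : (x : Matrix (Fin 2) (Fin 2) F) ^ k =
      (k * e ^ (k + 1)) • (x : Matrix (Fin 2) (Fin 2) F) - ((k - 1) * e ^ k) • 1 := by
  induction k with
  | zero => simp
  | succ k ih =>
    rw [pow_succ, ih, sub_mul, smul_mul_assoc, SL2.mul_self_eq, hx, smul_mul_assoc, one_mul]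
    have h1 : e ^ (k + 1 + 1) = e ^ k := by rw [add_assoc, pow_add, he, mul_one]
    have h2 : e ^ (k + 1) = e ^ k * e := pow_succ _ _
    rw [smul_sub, smul_smul, h1, h2]
    have h3 : e * e = 1 := by rw [← sq, he]
    have h4 : (k * (e ^ k * e)) * (2 * e) = 2 * k * e ^ k := by
      linear_combination 2 * k * e ^ k * h3
    rw [h4]
    push_cast
    module

lemma SL2.trace_sq_ne_four (h2 : (2 : F) ≠ 0) (x : SL(2, F)) (hx : x ∉ Subgroup.center SL(2, F))
    (n : ℕ) (hn : (n : F) ≠ 0) (hxn : x ^ n ∈ Subgroup.center SL(2, F)) : x.1.trace ^ 2 ≠ 4 := by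
  intro h4
  set e := x.1.trace / 2 with he
  have he2 : e ^ 2 = 1 := by
    rw [he, div_pow, h4, div_eq_one_iff_eq (pow_ne_zero 2 h2)]
    norm_num
  have he0 : e ≠ 0 := by
    rintro h
    simp [h] at he2
  have hpow := SL2.pow_eq_of_trace_eq x e he2 (by rw [he]; field_simp) n
  rw [← Matrix.SpecialLinearGroup.coe_pow] at hpow
  rw [SL2.mem_center_iff_entries] at hxn hx
  have hr : (n : F) * e ^ (n + 1) ≠ 0 := mul_ne_zero hn (pow_ne_zero _ he0)
  obtain ⟨ha, hb, hc⟩ := hxn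
  apply hx
  rw [hpow] at ha hb hc
  simp [he0, hn] at ha hb hc
  exact ⟨ha, hb, hc⟩

lemma SL2.trace_eq_zero_of_sq_mem_center (x : SL(2, F)) (hx : x ∉ Subgroup.center SL(2, F))
    (hx2 : x ^ 2 ∈ Subgroup.center SL(2, F)) : x.1.trace = 0 := by
  rw [SL2.mem_center_iff_entries] at hx hx2
  rw [Matrix.SpecialLinearGroup.coe_pow, sq, SL2.mul_self_eq] at hx2
  by_contra h0
  apply hx
  simpa [h0] using hx2

end SpecialLinearTwo

section IdempotentTrace

variable {V : Type} [AddCommGroup V] [Module ℂ V] [FiniteDimensional ℂ V]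

lemma IsIdempotentElem.trace_eq_finrank_range {e : Module.End ℂ V} (he : IsIdempotentElem e) :
    LinearMap.trace ℂ V e = Module.finrank ℂ (LinearMap.range e) :=
  (LinearMap.IsIdempotentElem.isProj_range e he).trace

lemma IsIdempotentElem.mul_mul_eq_trace_smul {e : Module.End ℂ V} (he : IsIdempotentElem e)
    (h1 : LinearMap.trace ℂ V e = 1) (A : Module.End ℂ V) :
    e * A * e = LinearMap.trace ℂ V (A * e) • e := by
  have hr : Module.finrank ℂ (LinearMap.range e) = 1 := by
    rw [he.trace_eq_finrank_range] at h1
    exact_mod_cast h1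
  obtain ⟨⟨v, hv⟩, -, hspan⟩ := finrank_eq_one_iff'.mp hr
  have hspan' : ∀ x, ∃ c : ℂ, c • v = e x := fun x => by
    obtain ⟨c, hc⟩ := hspan ⟨e x, x, rfl⟩
    exact ⟨c, congrArg Subtype.val hc⟩
  obtain ⟨c, hc⟩ := hspan' (A v)
  have key : e * A * e = c • e := by
    ext x
    obtain ⟨k, hk⟩ := hspan' x
    simp only [Module.End.mul_apply, LinearMap.smul_apply]
    rw [← hk, map_smul, map_smul, ← hc, smul_comm]
  have htr : LinearMap.trace ℂ V (e * A * e) = LinearMap.trace ℂ V (A * e) := by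
    rw [LinearMap.trace_mul_comm, ← mul_assoc, he.eq, LinearMap.trace_mul_comm]
  rw [← htr, key, map_smul, h1, smul_eq_mul, mul_one]

/-- The trace of an involution of determinant one, modulo `4`. -/
lemma trace_of_mul_self_eq_one {f : Module.End ℂ V} (hf : f * f = 1)
    (hdet : LinearMap.det f = 1) :
    ∃ b : ℕ, LinearMap.trace ℂ V f = Module.finrank ℂ V - 4 * b := by
  have hs : f.charpoly.Splits := IsAlgClosed.splits _
  have hroots : ∀ μ ∈ f.charpoly.roots, μ = 1 ∨ μ = -1 := by
    intro μ hμ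
    have hμ' := (Module.End.hasEigenvalue_iff_isRoot_charpoly f μ).mpr
      (Polynomial.isRoot_of_mem_roots hμ)
    obtain ⟨v, hv⟩ := hμ'.exists_hasEigenvector
    have h1 : (f * f) v = (μ * μ) • v := by
      rw [Module.End.mul_apply, hv.apply_eq_smul, map_smul, hv.apply_eq_smul, smul_smul]
    rw [hf, Module.End.one_apply] at h1
    have h2 : (μ * μ - 1) • v = 0 := by rw [sub_smul, ← h1, one_smul, sub_self]
    have h3 : μ * μ - 1 = 0 := (smul_eq_zero.mp h2).resolve_right hv.2
    exact mul_self_eq_one_iff.mp (sub_eq_zero.mp h3)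
  have hcard : Multiset.card f.charpoly.roots = Module.finrank ℂ V := by
    rw [← f.charpoly_natDegree]
    exact hs.natDegree_eq_card_roots.symm
  have haux : ∀ s : Multiset ℂ, (∀ μ ∈ s, μ = 1 ∨ μ = -1) →
      ∃ b : ℕ, s.sum = Multiset.card s - 2 * b ∧ s.prod = (-1) ^ b := by
    intro s
    induction s using Multiset.induction with
    | empty => exact fun _ => ⟨0, by simp⟩
    | cons μ s ih =>
      intro h
      obtain ⟨b, hb1, hb2⟩ := ih fun ν hν => h ν (Multiset.mem_cons_of_mem hν)
      rcases h μ (Multiset.mem_cons_self _ _) with rfl | rfl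
      · refine ⟨b, ?_, by simp [hb2]⟩
        simp [hb1]
        ring
      · refine ⟨b + 1, ?_, by simp [hb2, pow_succ]⟩
        simp [hb1]
        ring
  obtain ⟨b, hb1, hb2⟩ := haux _ hroots
  rw [← Module.End.trace_eq_sum_roots_charpoly_of_splits hs, hcard] at hb1
  rw [← Module.End.det_eq_prod_roots_charpoly_of_splits hs, hdet] at hb2
  obtain ⟨k, rfl⟩ : Even b := by
    by_contra hodd
    rw [Nat.not_even_iff_odd] at hodd
    rw [hodd.neg_one_pow] at hb2
    norm_num at hb2
  refine ⟨k, ?_⟩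
  rw [hb1]
  push_cast
  ring

end IdempotentTrace

section UnipotentProjections

open Matrix MatrixGroups

variable {F : Type} [Field F]

/-- The upper unitriangular matrix with off-diagonal entry `b`. -/
def SL2.upper (b : F) : SL(2, F) := ⟨!![1, b; 0, 1], by simp [det_fin_two]⟩

/-- The diagonal torus of `SL(2, F)`. -/
def SL2.diag : Fˣ →* SL(2, F) where
  toFun d := ⟨!![(d : F), 0; 0, ((d⁻¹ : Fˣ) : F)], by simp [det_fin_two]⟩
  map_one' := by ext i j; fin_cases i <;> fin_cases j <;> simp
  map_mul' d e := by
    refine Subtype.ext ?_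
    change _ = (!![(d : F), 0; 0, ((d⁻¹ : Fˣ) : F)] * !![(e : F), 0; 0, ((e⁻¹ : Fˣ) : F)] :
      Matrix (Fin 2) (Fin 2) F)
    ext i j
    fin_cases i <;> fin_cases j <;> simp [mul_apply, Fin.sum_univ_two, mul_comm]

/-- The Weyl element of `SL(2, F)`. -/
def SL2.weyl : SL(2, F) := ⟨!![0, -1; 1, 0], by simp [det_fin_two]⟩

lemma SL2.coe_upper (b : F) : (SL2.upper b : Matrix (Fin 2) (Fin 2) F) = !![1, b; 0, 1] := rfl

lemma SL2.coe_diag (d : Fˣ) :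
    (SL2.diag d : Matrix (Fin 2) (Fin 2) F) = !![(d : F), 0; 0, ((d⁻¹ : Fˣ) : F)] := rfl

lemma SL2.coe_weyl : ((SL2.weyl : SL(2, F)) : Matrix (Fin 2) (Fin 2) F) = !![0, -1; 1, 0] := rfl

lemma SL2.upper_add (a b : F) : SL2.upper (a + b) = SL2.upper a * SL2.upper b := by
  ext i j
  fin_cases i <;> fin_cases j <;> simp [SL2.coe_upper, mul_apply, Fin.sum_univ_two, add_comm]

lemma SL2.upper_zero : SL2.upper (0 : F) = 1 := by
  ext i j
  fin_cases i <;> fin_cases j <;> simp [SL2.coe_upper]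

lemma SL2.diag_mul_upper (d : Fˣ) (b : F) :
    SL2.diag d * SL2.upper b = SL2.upper (d ^ 2 * b) * SL2.diag d := by
  ext i j
  fin_cases i <;> fin_cases j <;>
    simp [SL2.coe_upper, SL2.coe_diag, mul_apply, Fin.sum_univ_two]
  field_simp

lemma SL2.eq_upper_mul_weyl_mul_diag_mul_upper (x : SL(2, F)) (c : Fˣ) (hc : x 1 0 = c) :
    x = SL2.upper (x 0 0 / c) * SL2.weyl * SL2.diag c * SL2.upper (x 1 1 / c) := by
  have hdet := x.det_coe
  rw [det_fin_two, hc] at hdet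
  ext i j
  fin_cases i <;> fin_cases j <;>
    simp [SL2.coe_upper, SL2.coe_diag, SL2.coe_weyl, mul_apply, Fin.sum_univ_two, hc]
  · field_simp
    linear_combination -hdet
  · field_simp

variable {V : Type} [AddCommGroup V] [Module ℂ V] (ρ : SL(2, F) →* Module.End ℂ V)

/-- A representation of `SL(2, F)` trivial on the upper unipotent subgroup is trivial. -/
lemma SL2.map_eq_one_of_upper (h : ∀ b, ρ (SL2.upper b) = 1) (x : SL(2, F)) : ρ x = 1 := by
  have hw : ∀ b : F, Matrix.SpecialLinearGroup.transvection one_ne_zero b =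
      SL2.weyl * SL2.upper (-b) * SL2.weyl⁻¹ := fun b => by
    rw [eq_mul_inv_iff_mul_eq]
    ext i j
    fin_cases i <;> fin_cases j <;>
    simp [SL2.coe_upper, SL2.coe_weyl, mul_apply, Fin.sum_univ_two,
      Matrix.SpecialLinearGroup.transvection_coe]
  induction x using Matrix.SL2.transvection_induction with
  | htransvec i j hij c =>
    fin_cases i <;> fin_cases j
    · exact absurd rfl hij
    · rw [show Matrix.SpecialLinearGroup.transvection hij c = SL2.upper c from ?_, h]
      ext i j
      fin_cases i <;> fin_cases j <;>
        simp [SL2.coe_upper, Matrix.SpecialLinearGroup.transvection_coe]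
    · refine (congrArg ρ (hw c)).trans ?_
      rw [map_mul, map_mul, h, mul_one, ← map_mul, mul_inv_cancel, map_one]
    · exact absurd rfl hij
  | hmul A B hA hB => rw [map_mul, hA, hB, one_mul]

variable [Fintype F]

/-- The projection onto the eigenspace of the upper unipotent subgroup attached to the
additive character `b ↦ ψ (b * s)`. -/
noncomputable def unipotentProj (s : F) : Module.End ℂ V :=
  (Fintype.card F : ℂ)⁻¹ •
    ∑ b : F, AddChar.FiniteField.primitiveChar_to_Complex F (-(b * s)) • ρ (SL2.upper b)

lemma sum_unipotentProj : ∑ s, unipotentProj ρ s = 1 := by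
  have hq : (Fintype.card F : ℂ) ≠ 0 := by simp
  simp only [unipotentProj]
  rw [← Finset.smul_sum, Finset.sum_comm]
  simp_rw [← Finset.sum_smul, ← neg_mul]
  have h : ∀ b : F, ∑ s, AddChar.FiniteField.primitiveChar_to_Complex F (-b * s) =
      if b = 0 then (Fintype.card F : ℂ) else 0 := fun b => by
    have := AddChar.sum_mulShift (-b)
      (AddChar.FiniteField.primitiveChar_to_Complex_isPrimitive (F := F))
    simp_rw [mul_comm (-b)]
    simpa using this
  simp_rw [h]
  simp [SL2.upper_zero, smul_smul, hq]

lemma map_upper_mul_unipotentProj (b s : F) : ρ (SL2.upper b) * unipotentProj ρ s =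
    AddChar.FiniteField.primitiveChar_to_Complex F (b * s) • unipotentProj ρ s := by
  simp only [unipotentProj]
  rw [mul_smul_comm, smul_comm, Finset.mul_sum]
  congr 1
  rw [Finset.smul_sum]
  refine Fintype.sum_equiv (Equiv.addLeft b) _ _ fun c => ?_
  rw [mul_smul_comm, ← map_mul, ← SL2.upper_add, smul_smul, ← AddChar.map_add_eq_mul]
  congr 2
  simp
  ring

lemma isIdempotentElem_unipotentProj (s : F) : IsIdempotentElem (unipotentProj ρ s) := by
  have hq : (Fintype.card F : ℂ) ≠ 0 := by simp
  have h : unipotentProj ρ s * unipotentProj ρ s = (Fintype.card F : ℂ)⁻¹ •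
      ∑ b : F, AddChar.FiniteField.primitiveChar_to_Complex F (-(b * s)) •
        (ρ (SL2.upper b) * unipotentProj ρ s) := by
    conv_lhs => enter [1]; rw [unipotentProj]
    rw [smul_mul_assoc, Finset.sum_mul]
    simp_rw [smul_mul_assoc]
  rw [IsIdempotentElem, h]
  simp_rw [map_upper_mul_unipotentProj, smul_smul, ← AddChar.map_add_eq_mul, neg_add_cancel]
  simp [← Nat.cast_smul_eq_nsmul ℂ, smul_smul, hq]

lemma map_upper_mul_unipotentProj_zero (b : F) :
    ρ (SL2.upper b) * unipotentProj ρ 0 = unipotentProj ρ 0 := by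
  simp [map_upper_mul_unipotentProj]

lemma unipotentProj_zero_mul_map_upper (b : F) :
    unipotentProj ρ 0 * ρ (SL2.upper b) = unipotentProj ρ 0 := by
  simp only [unipotentProj]
  rw [smul_mul_assoc, Finset.sum_mul]
  congr 1
  refine Fintype.sum_equiv (Equiv.addRight b) _ _ fun c => ?_
  simp [SL2.upper_add]

lemma map_diag_mul_unipotentProj (d : Fˣ) (s : F) :
    ρ (SL2.diag d) * unipotentProj ρ (d ^ 2 * s) = unipotentProj ρ s * ρ (SL2.diag d) := by
  simp only [unipotentProj]
  rw [mul_smul_comm, smul_mul_assoc, Finset.sum_mul, Finset.mul_sum]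
  congr 1
  refine Fintype.sum_equiv (Units.mulLeft (d ^ 2)) _ _ fun c => ?_
  rw [mul_smul_comm, smul_mul_assoc, ← map_mul, ← map_mul, SL2.diag_mul_upper]
  congr 2
  simp
  ring

lemma trace_unipotentProj_sq_mul (d : Fˣ) (s : F) :
    LinearMap.trace ℂ V (unipotentProj ρ (d ^ 2 * s)) =
      LinearMap.trace ℂ V (unipotentProj ρ s) := by
  have h : unipotentProj ρ (d ^ 2 * s) =
      ρ (SL2.diag d⁻¹) * (unipotentProj ρ s * ρ (SL2.diag d)) := by
    rw [← map_diag_mul_unipotentProj, ← mul_assoc, ← map_mul, ← map_mul]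
    simp
  rw [h, LinearMap.trace_mul_comm, mul_assoc, ← map_mul, ← map_mul]
  simp

end UnipotentProjections

section HalfPrincipalSeries

open Matrix MatrixGroups

variable {F : Type} [Field F]

lemma SL2.diag_neg_one : SL2.diag (-1 : Fˣ) = -1 := by
  ext i j
  fin_cases i <;> fin_cases j <;> simp [SL2.coe_diag]

lemma SL2.det_map_eq_one {V : Type} [AddCommGroup V] [Module ℂ V]
    (ρ : SL(2, F) →* Module.End ℂ V) (hF : ∃ a : F, a ≠ 0 ∧ a ^ 2 ≠ 1) (x : SL(2, F)) :
    LinearMap.det (ρ x) = 1 := by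
  obtain ⟨a, ha, ha2⟩ := hF
  let D : SL(2, F) →* ℂˣ := ((LinearMap.det (M := V) (A := ℂ)).comp ρ).toHomUnits
  have hx : x ∈ commutator SL(2, F) := by
    rw [Matrix.SL2.commutator_eq_top ha ha2]
    trivial
  exact congrArg Units.val (Abelianization.commutator_subset_ker D hx)

variable [Fintype F]

lemma FiniteField.ringChar_ne_two_of_card_odd (hodd : Fintype.card F % 2 = 1) :
    ringChar F ≠ 2 := by
  intro h
  have := FiniteField.even_card_iff_char_two.mp h
  omega

lemma FiniteField.two_ne_zero_of_card_odd (hodd : Fintype.card F % 2 = 1) : (2 : F) ≠ 0 :=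
  Ring.two_ne_zero (FiniteField.ringChar_ne_two_of_card_odd hodd)

/-- Sums over the nonzero elements of a finite field of odd order of functions that are
invariant under multiplication by squares. -/
lemma FiniteField.exists_sum_eq_of_sq_invariant (hodd : Fintype.card F % 2 = 1) (n : F → ℕ)
    (hn : ∀ (d : Fˣ) (s : F), n (d ^ 2 * s) = n s) :
    ∃ K : ℕ, 2 * ∑ s, n s = 2 * n 0 + (Fintype.card F - 1) * K ∧ (K = 0 → ∀ s ≠ 0, n s = 0) := by
  obtain ⟨ν, hν⟩ := FiniteField.exists_nonsquare (F := F)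
    (FiniteField.ringChar_ne_two_of_card_odd hodd)
  have hν0 : ν ≠ 0 := by
    rintro rfl
    exact hν (IsSquare.zero)
  have hK : ∀ s ≠ 0, n s + n (ν * s) = n 1 + n ν := by
    intro s hs
    by_cases hsq : IsSquare s
    · obtain ⟨r, rfl⟩ := hsq
      have hr : r ≠ 0 := fun h => hs (by simp [h])
      have h1 := hn (Units.mk0 r hr) 1
      have h2 := hn (Units.mk0 r hr) ν
      simp only [Units.val_mk0] at h1 h2
      rw [← h1, ← h2]
      ring_nf
    · have hprod : IsSquare (ν * s) := by
        rw [← quadraticChar_one_iff_isSquare (mul_ne_zero hν0 hs), map_mul,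
          quadraticChar_neg_one_iff_not_isSquare.mpr hν,
          quadraticChar_neg_one_iff_not_isSquare.mpr hsq]
        norm_num
      obtain ⟨r, hr⟩ := hprod
      have hr0 : r ≠ 0 := fun h => mul_ne_zero hν0 hs (by simp [hr, h])
      have h1 := hn (Units.mk0 r hr0) 1
      have h2 := hn (Units.mk0 (r / ν) (div_ne_zero hr0 hν0)) ν
      simp only [Units.val_mk0] at h1 h2
      rw [← h1, ← h2, add_comm, hr]
      have hs' : s = (r / ν) ^ 2 * ν := by
        field_simp
        linear_combination hr
      rw [← hs']
      ring_nf
  have hsplit : ∀ f : F → ℕ, ∑ s, f s = f 0 + ∑ s ∈ Finset.univ.erase 0, f s := fun f =>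
    (Finset.add_sum_erase _ _ (Finset.mem_univ 0)).symm
  have hshift : ∑ s, n s = ∑ s, n (ν * s) :=
    (Fintype.sum_equiv (Equiv.mulLeft₀ ν hν0) _ _ fun _ => rfl).symm
  refine ⟨n 1 + n ν, ?_, ?_⟩
  · have : 2 * ∑ s, n s = ∑ s, (n s + n (ν * s)) := by
      rw [Finset.sum_add_distrib, ← hshift, two_mul]
    rw [this, hsplit, Finset.sum_congr rfl fun s hs => hK s (Finset.ne_of_mem_erase hs)]
    simp [Finset.card_erase_of_mem, two_mul]
  · intro h s hs
    have := hK s hs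
    omega

variable {V : Type} [AddCommGroup V] [Module ℂ V]
  (ρ : SL(2, F) →* Module.End ℂ V)

lemma trace_map_eq_of_trace_eq (hodd : Fintype.card F % 2 = 1) {x y : SL(2, F)}
    (hxy : x.1.trace = y.1.trace) (hD : x.1.trace ^ 2 ≠ 4) :
    LinearMap.trace ℂ V (ρ x) = LinearMap.trace ℂ V (ρ y) := by
  obtain ⟨g, rfl⟩ := SL2.isConj_of_trace_eq
    (FiniteField.two_ne_zero_of_card_odd hodd) hodd x y hxy hD
  rw [map_mul, LinearMap.trace_mul_comm, ← map_mul, ← mul_assoc, inv_mul_cancel, one_mul]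

lemma map_diag_mul_unipotentProj_zero (d : Fˣ) :
    ρ (SL2.diag d) * unipotentProj ρ 0 = unipotentProj ρ 0 * ρ (SL2.diag d) := by
  have := map_diag_mul_unipotentProj ρ d 0
  rwa [mul_zero] at this

variable [FiniteDimensional ℂ V]

/-- The space of vectors fixed by the upper unipotent subgroup is a line. -/
lemma trace_unipotentProj_zero (hodd : Fintype.card F % 2 = 1) (hq : 3 < Fintype.card F)
    (hdim : 2 * Module.finrank ℂ V = Fintype.card F + 1)
    (hschur : ∀ f : Module.End ℂ V, (∀ g, f * ρ g = ρ g * f) → ∃ c : ℂ, f = c • 1) :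
    LinearMap.trace ℂ V (unipotentProj ρ 0) = 1 := by
  set n : F → ℕ := fun s => Module.finrank ℂ (LinearMap.range (unipotentProj ρ s))
  have htr : ∀ s, LinearMap.trace ℂ V (unipotentProj ρ s) = n s := fun s =>
    (isIdempotentElem_unipotentProj ρ s).trace_eq_finrank_range
  obtain ⟨K, hK, hK0⟩ := FiniteField.exists_sum_eq_of_sq_invariant hodd n fun d s => by
    have := trace_unipotentProj_sq_mul ρ d s
    rw [htr, htr] at this
    exact_mod_cast this
  have hsum : ∑ s, n s = Module.finrank ℂ V := by
    have := congrArg (LinearMap.trace ℂ V) (sum_unipotentProj ρ)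
    rw [map_sum, LinearMap.trace_one] at this
    simp_rw [htr] at this
    exact_mod_cast this
  rw [htr]
  rw [hsum, hdim] at hK
  rcases Nat.lt_or_ge K 2 with h | h
  · interval_cases K
    · exfalso
      have hE0 : ∀ s ≠ 0, unipotentProj ρ s = 0 := fun s hs =>
        (LinearMap.IsIdempotentElem.trace_eq_zero_iff (isIdempotentElem_unipotentProj ρ s)).mp
          (by rw [htr, hK0 rfl s hs, Nat.cast_zero])
      have hE : unipotentProj ρ 0 = 1 := by
        rw [← sum_unipotentProj ρ]
        exact (Finset.sum_eq_single 0 (fun s _ hs => hE0 s hs) (by simp)).symm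
      have htriv : ∀ x, ρ x = 1 := SL2.map_eq_one_of_upper ρ fun b => by
        have := map_upper_mul_unipotentProj_zero ρ b
        rwa [hE, mul_one] at this
      have hfin : Module.finrank ℂ (Module.End ℂ V) ≤ 1 :=
        finrank_le_one (1 : Module.End ℂ V) fun f => by
          obtain ⟨c, hc⟩ := hschur f fun g => by rw [htriv, mul_one, one_mul]
          exact ⟨c, hc.symm⟩
      rw [Module.finrank_linearMap] at hfin
      nlinarith
    · have : n 0 = 1 := by omega
      rw [this, Nat.cast_one]
  · exfalso
    have : (Fintype.card F - 1) * 2 ≤ (Fintype.card F - 1) * K := Nat.mul_le_mul_left _ h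
    omega

/-- The value on the torus of the linear character by which it acts on the fixed line of the
upper unipotent subgroup. -/
lemma map_diag_mul_unipotentProj_zero_eq_smul (hodd : Fintype.card F % 2 = 1)
    (h1 : LinearMap.trace ℂ V (unipotentProj ρ 0) = 1) (d : Fˣ) (hd : d ^ 2 ≠ 1) :
    ρ (SL2.diag d) * unipotentProj ρ 0 =
      LinearMap.trace ℂ V (ρ (SL2.diag d)) • unipotentProj ρ 0 := by
  have hid := isIdempotentElem_unipotentProj ρ 0
  have hq : (Fintype.card F : ℂ) ≠ 0 := by simp
  have htr : LinearMap.trace ℂ V (ρ (SL2.diag d) * unipotentProj ρ 0) =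
      LinearMap.trace ℂ V (ρ (SL2.diag d)) := by
    have hconj : ∀ b, LinearMap.trace ℂ V (ρ (SL2.diag d * SL2.upper b)) =
        LinearMap.trace ℂ V (ρ (SL2.diag d)) := fun b => by
      have ht : (SL2.diag d * SL2.upper b).1.trace = (SL2.diag d).1.trace := by
        rw [trace_fin_two, trace_fin_two, Matrix.SpecialLinearGroup.coe_mul, SL2.coe_diag,
          SL2.coe_upper]
        simp [mul_apply, Fin.sum_univ_two]
      refine trace_map_eq_of_trace_eq ρ hodd ht ?_
      rw [ht, trace_fin_two, SL2.coe_diag]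
      intro h
      apply hd
      have hd0 : (d : F) * ((d⁻¹ : Fˣ) : F) = 1 := d.mul_inv
      have h' : ((d : F) - ((d⁻¹ : Fˣ) : F)) ^ 2 = 0 := by
        simp only [of_apply, cons_val', cons_val_zero, cons_val_one, cons_val_fin_one] at h
        linear_combination h - 4 * hd0
      have h'' := sub_eq_zero.mp (pow_eq_zero_iff (two_ne_zero) |>.mp h')
      have := Units.ext h''
      rw [sq]
      nth_rewrite 2 [this]
      exact mul_inv_cancel d
    rw [unipotentProj, mul_smul_comm, Finset.mul_sum, map_smul, map_sum]
    simp [← map_mul, hconj, hq]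
  rw [← htr, ← hid.mul_mul_eq_trace_smul h1, ← map_diag_mul_unipotentProj_zero, mul_assoc, hid.eq]

lemma SL2.exists_unit_sq_eq_neg_one (h4 : Fintype.card F % 4 = 1) : ∃ i : Fˣ, i ^ 2 = -1 := by
  obtain ⟨r, hr⟩ := FiniteField.isSquare_neg_one_iff.mpr (show Fintype.card F % 4 ≠ 3 by omega)
  have hr0 : r ≠ 0 := by
    rintro rfl
    simp at hr
  exact ⟨Units.mk0 r hr0, Units.ext (by simp [sq, ← hr])⟩

lemma trace_map_diag_sq (hodd : Fintype.card F % 2 = 1)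
    (h1 : LinearMap.trace ℂ V (unipotentProj ρ 0) = 1) (d : Fˣ) (hd : d ^ 2 ≠ 1) :
    LinearMap.trace ℂ V (ρ (SL2.diag d)) ^ 2 = 1 := by
  have hE0 : unipotentProj ρ 0 ≠ 0 := by
    intro h
    simp [h] at h1
  have hd' : (d⁻¹) ^ 2 ≠ 1 := by
    rwa [inv_pow, ne_eq, inv_eq_one]
  have hinv : LinearMap.trace ℂ V (ρ (SL2.diag d⁻¹)) = LinearMap.trace ℂ V (ρ (SL2.diag d)) := by
    have hconj : SL2.diag d⁻¹ = SL2.weyl * SL2.diag d * SL2.weyl⁻¹ := by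
      rw [eq_mul_inv_iff_mul_eq]
      ext i j
      fin_cases i <;> fin_cases j <;>
        simp [SL2.coe_diag, SL2.coe_weyl, mul_apply, Fin.sum_univ_two]
    rw [hconj, map_mul, LinearMap.trace_mul_comm, ← map_mul]
    simp
  have hprod : ρ (SL2.diag d⁻¹) * (ρ (SL2.diag d) * unipotentProj ρ 0) = unipotentProj ρ 0 := by
    rw [← mul_assoc, ← map_mul, ← map_mul]
    simp
  rw [map_diag_mul_unipotentProj_zero_eq_smul ρ hodd h1 d hd, mul_smul_comm,
    map_diag_mul_unipotentProj_zero_eq_smul ρ hodd h1 _ hd', hinv, smul_smul] at hprod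
  have := smul_left_injective ℂ hE0 (hprod.trans (one_smul ℂ _).symm)
  rw [sq]
  exact this

lemma neg_one_ne_one_units (hodd : Fintype.card F % 2 = 1) : (-1 : Fˣ) ≠ 1 := by
  intro h
  have h' : (-1 : F) = 1 := by simpa using congrArg Units.val h
  exact FiniteField.two_ne_zero_of_card_odd hodd (by linear_combination -h')

lemma trace_map_diag_of_sq_eq_neg_one (h8 : Fintype.card F % 8 = 5)
    (hdim : 2 * Module.finrank ℂ V = Fintype.card F + 1)
    (hcen : ∀ z ∈ Subgroup.center SL(2, F), ρ z = 1)
    (h1 : LinearMap.trace ℂ V (unipotentProj ρ 0) = 1) (i : Fˣ) (hi : i ^ 2 = -1) :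
    LinearMap.trace ℂ V (ρ (SL2.diag i)) = -1 := by
  have hodd : Fintype.card F % 2 = 1 := by omega
  have hi2 : i ^ 2 ≠ 1 := hi ▸ neg_one_ne_one_units hodd
  have hsq := trace_map_diag_sq ρ hodd h1 i hi2
  obtain ⟨b, hb⟩ := trace_of_mul_self_eq_one (f := ρ (SL2.diag i))
    (by rw [← map_mul, ← map_mul, ← sq, hi, SL2.diag_neg_one, hcen _ SL2.neg_one_mem_center])
    (SL2.det_map_eq_one ρ ⟨i, i.ne_zero, fun h => hi2 (Units.ext (by simpa using h))⟩ _)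
  rcases sq_eq_one_iff.mp hsq with h | h
  · exfalso
    rw [h] at hb
    have hb' : (Module.finrank ℂ V : ℂ) = 1 + 4 * b := by linear_combination -hb
    have hb'' : Module.finrank ℂ V = 1 + 4 * b := by exact_mod_cast hb'
    omega
  · exact h

end HalfPrincipalSeries

section CharacterValues

open Matrix MatrixGroups

variable {F : Type} [Field F]

/-- Conjugation by `diag(1, i)` in `GL(2, F)`. -/
def SL2.scale (i : Fˣ) (y : SL(2, F)) : SL(2, F) :=
  ⟨!![y 0 0, ((i⁻¹ : Fˣ) : F) * y 0 1; (i : F) * y 1 0, y 1 1], by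
    have := y.det_coe
    rw [det_fin_two] at this
    rw [det_fin_two_of]
    have hi : (i : F) * ((i⁻¹ : Fˣ) : F) = 1 := i.mul_inv
    linear_combination this - y 0 1 * y 1 0 * hi⟩

lemma SL2.coe_scale (i : Fˣ) (y : SL(2, F)) : (SL2.scale i y : Matrix (Fin 2) (Fin 2) F) =
    !![y 0 0, ((i⁻¹ : Fˣ) : F) * y 0 1; (i : F) * y 1 0, y 1 1] := rfl

lemma SL2.trace_scale (i : Fˣ) (y : SL(2, F)) : (SL2.scale i y).1.trace = y.1.trace := by
  rw [SL2.coe_scale, trace_fin_two, trace_fin_two]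
  simp

lemma SL2.scale_inv_scale (i : Fˣ) (y : SL(2, F)) : SL2.scale i⁻¹ (SL2.scale i y) = y := by
  ext a b
  fin_cases a <;> fin_cases b <;> simp [SL2.coe_scale]

variable [Fintype F] {V : Type} [AddCommGroup V] [Module ℂ V]
  (ρ : SL(2, F) →* Module.End ℂ V)

lemma proj_mul_map_mul_proj {y : SL(2, F)} (c : Fˣ) (hc : y 1 0 = c) :
    unipotentProj ρ 0 * ρ y * unipotentProj ρ 0 =
      unipotentProj ρ 0 * ρ SL2.weyl * (ρ (SL2.diag c) * unipotentProj ρ 0) := by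
  conv_lhs => rw [SL2.eq_upper_mul_weyl_mul_diag_mul_upper y c hc]
  simp only [map_mul, mul_assoc]
  rw [map_upper_mul_unipotentProj_zero]
  simp only [← mul_assoc]
  rw [unipotentProj_zero_mul_map_upper]

variable [FiniteDimensional ℂ V]

lemma trace_map_of_isSquare (hodd : Fintype.card F % 2 = 1)
    (h1 : LinearMap.trace ℂ V (unipotentProj ρ 0) = 1) {x : SL(2, F)} {n : ℕ} (hn : Odd n)
    (hx : ρ (x ^ n) = 1) (hD : x.1.trace ^ 2 ≠ 4) (hsq : IsSquare (x.1.trace ^ 2 - 4)) :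
    LinearMap.trace ℂ V (ρ x) = 1 := by
  have h2 : (2 : F) ≠ 0 := FiniteField.two_ne_zero_of_card_odd hodd
  obtain ⟨r, hr⟩ := hsq
  have hr0 : r ≠ 0 := by
    rintro rfl
    exact hD (by linear_combination hr)
  set τ := x.1.trace with hτ
  have hinv : (τ + r) / 2 * ((τ - r) / 2) = 1 := by
    field_simp
    linear_combination hr
  let d : Fˣ := ⟨(τ + r) / 2, (τ - r) / 2, hinv, by rw [mul_comm, hinv]⟩
  have hd1 : (d : F) = (τ + r) / 2 := rfl
  have hd2 : ((d⁻¹ : Fˣ) : F) = (τ - r) / 2 := rfl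
  have hd : d ^ 2 ≠ 1 := by
    intro h
    have h' : d = d⁻¹ := eq_inv_of_mul_eq_one_left (by rw [← sq, h])
    have h'' : (d : F) = ((d⁻¹ : Fˣ) : F) := congrArg Units.val h'
    rw [hd1, hd2] at h''
    field_simp at h''
    have : 2 * r = 0 := by linear_combination h''
    exact (mul_ne_zero h2 hr0) this
  have htr : x.1.trace = (SL2.diag d).1.trace := by
    rw [trace_fin_two (SL2.diag d).1, SL2.coe_diag]
    simp only [of_apply, cons_val', cons_val_zero, cons_val_one, cons_val_fin_one]
    rw [hd1, hd2, ← hτ]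
    field_simp
    ring
  rw [trace_map_eq_of_trace_eq ρ hodd htr hD]
  set α := LinearMap.trace ℂ V (ρ (SL2.diag d)) with hα
  have hsmul := map_diag_mul_unipotentProj_zero_eq_smul ρ hodd h1 d hd
  rw [← hα] at hsmul
  have hpow : ρ (SL2.diag d) ^ n = 1 := by
    obtain ⟨g, hg⟩ := SL2.isConj_of_trace_eq h2 hodd x _ htr hD
    rw [← map_pow, ← hg, conj_pow, map_mul, map_mul, hx, mul_one, ← map_mul, mul_inv_cancel,
      map_one]
  have hpowsmul : ∀ k : ℕ, ρ (SL2.diag d) ^ k * unipotentProj ρ 0 = α ^ k • unipotentProj ρ 0 := by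
    intro k
    induction k with
    | zero => simp
    | succ k ih => rw [pow_succ, mul_assoc, hsmul, mul_smul_comm, ih, smul_smul, pow_succ, mul_comm]
  have hE0 : unipotentProj ρ 0 ≠ 0 := by
    intro h
    simp [h] at h1
  have hαn : α ^ n = 1 := by
    have := hpowsmul n
    rw [hpow, one_mul] at this
    exact smul_left_injective ℂ hE0 (this.symm.trans (one_smul ℂ _).symm)
  rcases sq_eq_one_iff.mp (trace_map_diag_sq ρ hodd h1 d hd) with h | h
  · exact h
  · rw [← hα] at h
    rw [h, hn.neg_one_pow] at hαn
    norm_num at hαn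

lemma trace_map_of_not_isSquare (hodd : Fintype.card F % 2 = 1)
    (hschur : ∀ f : Module.End ℂ V, (∀ g, f * ρ g = ρ g * f) → ∃ c : ℂ, f = c • 1)
    (h1 : LinearMap.trace ℂ V (unipotentProj ρ 0) = 1) (i : Fˣ) (hi2 : i ^ 2 ≠ 1)
    (hi : LinearMap.trace ℂ V (ρ (SL2.diag i)) = -1) {x : SL(2, F)}
    (hD : x.1.trace ^ 2 ≠ 4) (hsq : ¬ IsSquare (x.1.trace ^ 2 - 4)) :
    LinearMap.trace ℂ V (ρ x) = 0 := by
  set S : Finset SL(2, F) := Finset.univ.filter fun y => y.1.trace = x.1.trace with hS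
  have hmem : ∀ y, y ∈ S ↔ y.1.trace = x.1.trace := fun y => by simp [hS]
  set E := unipotentProj ρ 0 with hE
  have hneg : ∀ y ∈ S, E * ρ (SL2.scale i y) * E = -(E * ρ y * E) := fun y hy => by
    have hy10 : y 1 0 ≠ 0 := by
      intro h0
      apply hsq
      rw [← (hmem y).mp hy, trace_fin_two]
      have hdet := y.det_coe
      rw [det_fin_two, h0] at hdet
      exact ⟨y 0 0 - y 1 1, by linear_combination 4 * hdet⟩
    rw [proj_mul_map_mul_proj ρ (Units.mk0 _ hy10) rfl,
      proj_mul_map_mul_proj ρ (y := SL2.scale i y) (Units.mk0 _ hy10 * i)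
        (by rw [SL2.coe_scale]; simp [mul_comm]),
      map_mul, map_mul, mul_assoc (ρ (SL2.diag _)),
      map_diag_mul_unipotentProj_zero_eq_smul ρ hodd h1 i hi2, hi]
    simp
  obtain ⟨c, hc⟩ := hschur (∑ y ∈ S, ρ y) fun g => by
    rw [Finset.sum_mul, Finset.mul_sum]
    refine Finset.sum_nbij' (fun y => g⁻¹ * y * g) (fun y => g * y * g⁻¹) ?_ ?_ ?_ ?_ ?_
    · intro y hy
      rw [hmem] at hy ⊢
      rw [← hy]
      simpa using SL2.trace_conj g⁻¹ y
    · intro y hy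
      rw [hmem] at hy ⊢
      rw [← hy, SL2.trace_conj]
    · intro y _
      group
    · intro y _
      group
    · intro y _
      rw [← map_mul, ← map_mul]
      congr 1
      group
  have hsum : ∑ y ∈ S, E * ρ y * E = c • E := by
    rw [← Finset.sum_mul, ← Finset.mul_sum, hc, mul_smul_comm, mul_one, smul_mul_assoc,
      (isIdempotentElem_unipotentProj ρ 0).eq]
  have hsum' : ∑ y ∈ S, E * ρ y * E = -∑ y ∈ S, E * ρ y * E := by
    rw [← Finset.sum_neg_distrib, ← Finset.sum_congr rfl hneg]
    refine Finset.sum_nbij' (SL2.scale i⁻¹) (SL2.scale i) ?_ ?_ ?_ ?_ ?_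
    · intro y hy
      rw [hmem, SL2.trace_scale]
      exact (hmem y).mp hy
    · intro y hy
      rw [hmem, SL2.trace_scale]
      exact (hmem y).mp hy
    · intro y _
      simpa using SL2.scale_inv_scale i⁻¹ y
    · intro y _
      exact SL2.scale_inv_scale i y
    · intro y _
      rw [show SL2.scale i (SL2.scale i⁻¹ y) = y by simpa using SL2.scale_inv_scale i⁻¹ y]
  have hc0 : c = 0 := by
    rw [hsum] at hsum'
    have := congrArg (LinearMap.trace ℂ V) hsum'
    rwa [map_neg, map_smul, h1, smul_eq_mul, mul_one, self_eq_neg] at this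
  have htr := congrArg (LinearMap.trace ℂ V) hc
  rw [hc0, zero_smul, map_zero, map_sum, Finset.sum_congr rfl fun y hy =>
    (trace_map_eq_of_trace_eq ρ hodd ((hmem y).mp hy).symm hD).symm, Finset.sum_const,
    nsmul_eq_mul, mul_eq_zero] at htr
  refine htr.resolve_left ?_
  rw [Nat.cast_eq_zero, Finset.card_eq_zero]
  exact Finset.ne_empty_of_mem ((hmem x).mpr rfl)

end CharacterValues

section HalfDegree

open Matrix MatrixGroups

variable {F : Type} [Field F] [Fintype F] {V : Type} [AddCommGroup V] [Module ℂ V]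
  [FiniteDimensional ℂ V] (ρ : SL(2, F) →* Module.End ℂ V)

lemma trace_map_of_sq_mem_center (h8 : Fintype.card F % 8 = 5)
    (hdim : 2 * Module.finrank ℂ V = Fintype.card F + 1)
    (hschur : ∀ f : Module.End ℂ V, (∀ g, f * ρ g = ρ g * f) → ∃ c : ℂ, f = c • 1)
    (hcen : ∀ z ∈ Subgroup.center SL(2, F), ρ z = 1) (x : SL(2, F))
    (hx : x ∉ Subgroup.center SL(2, F)) (hx2 : x ^ 2 ∈ Subgroup.center SL(2, F)) :
    LinearMap.trace ℂ V (ρ x) = -1 := by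
  have hodd : Fintype.card F % 2 = 1 := by omega
  have h2 := FiniteField.two_ne_zero_of_card_odd hodd
  obtain ⟨i, hi⟩ := SL2.exists_unit_sq_eq_neg_one (F := F) (by omega)
  have h1 := trace_unipotentProj_zero ρ hodd (by omega) hdim hschur
  have hi0 : (SL2.diag i).1.trace = 0 := by
    have hinv : i⁻¹ = -i := inv_eq_of_mul_eq_one_right (by rw [mul_neg, ← sq, hi, neg_neg])
    rw [trace_fin_two, SL2.coe_diag, hinv]
    simp
  have hx0 := SL2.trace_eq_zero_of_sq_mem_center x hx hx2
  rw [trace_map_eq_of_trace_eq ρ hodd (hx0.trans hi0.symm)]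
  · exact trace_map_diag_of_sq_eq_neg_one ρ h8 hdim hcen h1 i hi
  · rw [hx0]
    intro h
    exact pow_ne_zero 2 h2 (by linear_combination -h)

lemma trace_map_of_pow_mem_center (h8 : Fintype.card F % 8 = 5)
    (hdim : 2 * Module.finrank ℂ V = Fintype.card F + 1)
    (hschur : ∀ f : Module.End ℂ V, (∀ g, f * ρ g = ρ g * f) → ∃ c : ℂ, f = c • 1)
    (hcen : ∀ z ∈ Subgroup.center SL(2, F), ρ z = 1) {n : ℕ} (hn : Odd n) (hnF : (n : F) ≠ 0)
    (x : SL(2, F)) (hx : x ∉ Subgroup.center SL(2, F))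
    (hxn : x ^ n ∈ Subgroup.center SL(2, F)) :
    LinearMap.trace ℂ V (ρ x) = 0 ∨ LinearMap.trace ℂ V (ρ x) = 1 := by
  have hodd : Fintype.card F % 2 = 1 := by omega
  have h2 := FiniteField.two_ne_zero_of_card_odd hodd
  obtain ⟨i, hi⟩ := SL2.exists_unit_sq_eq_neg_one (F := F) (by omega)
  have h1 := trace_unipotentProj_zero ρ hodd (by omega) hdim hschur
  have hD := SL2.trace_sq_ne_four h2 x hx n hnF hxn
  by_cases hsq : IsSquare (x.1.trace ^ 2 - 4)
  · exact Or.inr (trace_map_of_isSquare ρ hodd h1 hn (hcen _ hxn) hD hsq)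
  · exact Or.inl (trace_map_of_not_isSquare ρ hodd hschur h1 i
      (hi ▸ neg_one_ne_one_units hodd)
      (trace_map_diag_of_sq_eq_neg_one ρ h8 hdim hcen h1 i hi) hD hsq)

end HalfDegree

section RestrictedMultiplicity

variable {G : Type} [Group G]

lemma FDRep.exists_eq_smul_one_of_commute (V : FDRep ℂ G) [CategoryTheory.Simple V]
    (f : Module.End ℂ V) (hf : ∀ g, f * V.ρ g = V.ρ g * f) : ∃ c : ℂ, f = c • 1 := by
  let φ : V ⟶ V := ⟨CategoryTheory.InducedCategory.homMk (ModuleCat.ofHom f), fun g => by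
    ext x
    exact LinearMap.congr_fun (hf g) x⟩
  obtain ⟨c, hc⟩ := CategoryTheory.endomorphism_simple_eq_smul_id ℂ φ
  refine ⟨c, ?_⟩
  have : φ.hom.hom.hom = f := rfl
  rw [← this, ← hc]
  rfl

lemma Subgroup.coe_pow_eq_one_of_natCard_eq (H : Subgroup G) {n : ℕ} (hH : Nat.card H = n)
    (h : H) : (h : G) ^ n = 1 := by
  have : h ^ n = 1 := hH ▸ pow_card_eq_one'
  simpa using congrArg Subtype.val this

variable [Finite G]

lemma FDRep.exists_sum_character_eq (V : FDRep ℂ G) (H : Subgroup G) [Fintype H] :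
    ∃ n : ℕ, ∑ h : H, V.character h = Nat.card H * n := by
  have hH : (Nat.card H : ℂ) ≠ 0 := Nat.cast_ne_zero.mpr Nat.card_pos.ne'
  let : Invertible (Nat.card H : ℂ) := invertibleOfNonzero hH
  let σ : Representation ℂ H V := V.ρ.comp H.subtype
  refine ⟨Module.finrank ℂ σ.invariants, ?_⟩
  rw [← σ.card_inv_mul_sum_char_eq_finrank, mul_inv_cancel_left₀ hH]
  rfl

lemma restMult_eq_of_forall_ne_one (H : Subgroup G) (θ : H →* ℂˣ) (hθ : θ ≠ 1) (χ : G → ℂ) (c : ℂ)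
    (hχ : ∀ h : H, h ≠ 1 → χ h = c) : restMult H θ χ = (Nat.card H : ℂ)⁻¹ * (χ 1 - c) := by
  let : Fintype H := Fintype.ofFinite H
  have hsum : ∑ h : H, (((θ h : ℂˣ) : ℂ))⁻¹ = 0 := by
    have hne : (Units.coeHom ℂ).comp θ⁻¹ ≠ 1 := by
      intro h
      apply hθ
      ext g
      have := DFunLike.congr_fun h g
      simpa using this
    simpa using sum_hom_units_eq_zero ((Units.coeHom ℂ).comp θ⁻¹) hne
  rw [restMult]
  congr 1
  have hterm : ∀ h : H, χ h * ((θ h : ℂ))⁻¹ =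
      c * ((θ h : ℂ))⁻¹ + if h = 1 then χ 1 - c else 0 := fun h => by
    by_cases h1 : h = 1
    · simp [h1]
    · simp [h1, hχ h h1]
  rw [Finset.sum_congr rfl fun h _ => hterm h, Finset.sum_add_distrib, ← Finset.mul_sum, hsum]
  simp

lemma pow_ne_one_of_injective {p : ℕ} (hp : p.Prime) (H : Subgroup G) (hH : Nat.card H = p)
    (θ : H →* ℂˣ) (hθ : Function.Injective θ) {k : ℕ} (hk0 : k ≠ 0) (hk : k < p) : θ ^ k ≠ 1 := by
  intro h
  have : Nontrivial H := Finite.one_lt_card_iff_nontrivial.mp (hH ▸ hp.one_lt)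
  obtain ⟨g, hg⟩ := exists_ne (1 : H)
  have hgk : g ^ k = 1 := hθ (by
    have := DFunLike.congr_fun h g
    simpa using this)
  have hord := orderOf_eq_prime (p := p) (hp := ⟨hp⟩) (hH ▸ pow_card_eq_one') hg
  exact Nat.not_dvd_of_pos_of_lt (Nat.pos_of_ne_zero hk0) hk (hord ▸ orderOf_dvd_of_pow_eq_one hgk)

end RestrictedMultiplicity

section ProjectiveCharacter

open Matrix MatrixGroups

variable {F : Type} [Field F]

/-- The representation of `SL(2, F)` inflated from a representation of `PSL(2, F)`. -/
noncomputable abbrev inflate (V : FDRep ℂ (PSL2 F)) : SL(2, F) →* Module.End ℂ V :=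
  V.ρ.comp (QuotientGroup.mk' (Subgroup.center SL(2, F)))

lemma inflate_eq_one (V : FDRep ℂ (PSL2 F)) (z : SL(2, F)) (hz : z ∈ Subgroup.center SL(2, F)) :
    inflate V z = 1 := by
  have : QuotientGroup.mk' (Subgroup.center SL(2, F)) z = 1 := (QuotientGroup.eq_one_iff z).mpr hz
  rw [inflate, MonoidHom.comp_apply, this, map_one]

lemma exists_eq_smul_one_of_commute_inflate (V : FDRep ℂ (PSL2 F)) [CategoryTheory.Simple V]
    (f : Module.End ℂ V) (hf : ∀ g, f * inflate V g = inflate V g * f) : ∃ c : ℂ, f = c • 1 :=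
  V.exists_eq_smul_one_of_commute f fun g => by
    obtain ⟨x, rfl⟩ := QuotientGroup.mk'_surjective _ g
    exact hf x

variable [Fintype F]

lemma character_of_sq_eq_one (h8 : Fintype.card F % 8 = 5) (V : FDRep ℂ (PSL2 F))
    [CategoryTheory.Simple V] (hdim : 2 * Module.finrank ℂ V = Fintype.card F + 1) (g : PSL2 F)
    (hg1 : g ≠ 1) (hg : g ^ 2 = 1) : V.character g = -1 := by
  obtain ⟨x, rfl⟩ := QuotientGroup.mk'_surjective _ g
  refine trace_map_of_sq_mem_center (inflate V) h8 hdim (exists_eq_smul_one_of_commute_inflate V)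
    (inflate_eq_one V) x ?_ ?_
  · exact fun h => hg1 ((QuotientGroup.eq_one_iff x).mpr h)
  · rw [← map_pow] at hg
    exact (QuotientGroup.eq_one_iff _).mp hg

lemma character_of_pow_eq_one (h8 : Fintype.card F % 8 = 5) (V : FDRep ℂ (PSL2 F))
    [CategoryTheory.Simple V] (hdim : 2 * Module.finrank ℂ V = Fintype.card F + 1) {n : ℕ}
    (hn : Odd n) (hnF : (n : F) ≠ 0) (g : PSL2 F) (hg1 : g ≠ 1) (hg : g ^ n = 1) :
    V.character g = 0 ∨ V.character g = 1 := by
  obtain ⟨x, rfl⟩ := QuotientGroup.mk'_surjective _ g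
  refine trace_map_of_pow_mem_center (inflate V) h8 hdim (exists_eq_smul_one_of_commute_inflate V)
    (inflate_eq_one V) hn hnF x ?_ ?_
  · exact fun h => hg1 ((QuotientGroup.eq_one_iff x).mpr h)
  · rw [← map_pow] at hg
    exact (QuotientGroup.eq_one_iff _).mp hg

lemma character_eq_ite (h8 : Fintype.card F % 8 = 5) (V : FDRep ℂ (PSL2 F))
    [CategoryTheory.Simple V] (hdim : 2 * Module.finrank ℂ V = Fintype.card F + 1) {p : ℕ}
    (hp : p.Prime) (hp2 : p ≠ 2) (hpF : (p : F) ≠ 0)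
    (hpq : Fintype.card F % p = 1 ∨ Fintype.card F % p + 1 = p)
    (H : Subgroup (PSL2 F)) (hH : Nat.card H = p) (h : H) (h1 : h ≠ 1) :
    V.character h = if Fintype.card F % p = 1 then 1 else 0 := by
  let : Fintype H := Fintype.ofFinite H
  have hcard : Fintype.card H = p := by rw [← hH, Nat.card_eq_fintype_card]
  have hval : ∀ g : H, g ≠ 1 → V.character g = 0 ∨ V.character g = 1 := fun g hg =>
    character_of_pow_eq_one h8 V hdim (hp.odd_of_ne_two hp2) hpF g (by simpa using hg)
      (H.coe_pow_eq_one_of_natCard_eq hH g)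
  obtain ⟨n, hn⟩ := V.exists_sum_character_eq H
  set S : Finset H := (Finset.univ.erase 1).filter fun g => V.character g = 1 with hS
  have hSle : S.card ≤ p - 1 := by
    refine (Finset.card_filter_le _ _).trans ?_
    rw [Finset.card_erase_of_mem (Finset.mem_univ _), Finset.card_univ, hcard]
  have hsum : ∑ g : H, V.character g = Module.finrank ℂ V + S.card := by
    rw [← Finset.add_sum_erase _ _ (Finset.mem_univ (1 : H)), hS, Finset.card_filter, Nat.cast_sum]
    congr 1
    · simp
    · refine Finset.sum_congr rfl fun g hg => ?_
      rcases hval g (Finset.ne_of_mem_erase hg) with h | h <;> simp [h]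
  have hmem : h ∈ S ↔ V.character h = 1 := by simp [hS, h1]
  have hdvd : Fintype.card F + 1 + 2 * S.card = p * (2 * n) := by
    rw [hsum, hH] at hn
    have hn' : Module.finrank ℂ V + S.card = p * n := by exact_mod_cast hn
    linear_combination 2 * hn' - hdim
  have hdiv := Nat.div_add_mod (Fintype.card F) p
  have hcop : Nat.Coprime p 2 := (Nat.coprime_primes hp Nat.prime_two).mpr hp2
  have hp3 : 3 ≤ p := by
    have := hp.two_le
    omega
  split_ifs with hq
  · rw [← hmem]
    have hd : p ∣ 2 * (1 + S.card) := by
      rw [hq] at hdiv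
      refine (Nat.dvd_add_right (Dvd.intro (Fintype.card F / p) rfl)).mp
        (Dvd.intro (2 * n) (b := p * (Fintype.card F / p) + 2 * (1 + S.card)) ?_)
      omega
    have hle := Nat.le_of_dvd (by omega) (hcop.dvd_of_dvd_mul_left hd)
    have hSeq : S = Finset.univ.erase 1 := by
      refine Finset.eq_of_subset_of_card_le (Finset.filter_subset _ _) ?_
      rw [Finset.card_erase_of_mem (Finset.mem_univ _), Finset.card_univ, hcard]
      omega
    simp [hSeq, h1]
  · refine (hval h h1).resolve_right fun hh => ?_
    have hd : p ∣ 2 * S.card := by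
      have hq' := hpq.resolve_left hq
      refine (Nat.dvd_add_right (Dvd.intro (Fintype.card F / p + 1) rfl)).mp
        (Dvd.intro (2 * n) (b := p * (Fintype.card F / p + 1) + 2 * S.card) ?_)
      rw [mul_add]
      omega
    have hpos : 0 < S.card := Finset.card_pos.mpr ⟨h, hmem.mpr hh⟩
    have hle := Nat.le_of_dvd hpos (hcop.dvd_of_dvd_mul_left hd)
    omega

lemma restMult_character_pow (h8 : Fintype.card F % 8 = 5) (V : FDRep ℂ (PSL2 F))
    [CategoryTheory.Simple V] (hdim : 2 * Module.finrank ℂ V = Fintype.card F + 1) {p : ℕ}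
    (hp : p.Prime) (hp2 : p ≠ 2) (hpF : (p : F) ≠ 0)
    (hpq : Fintype.card F % p = 1 ∨ Fintype.card F % p + 1 = p)
    (H : Subgroup (PSL2 F)) (hH : Nat.card H = p) (θ : H →* ℂˣ) (hθ : Function.Injective θ)
    {k : ℕ} (hk0 : k ≠ 0) (hk : k < p) :
    restMult H (θ ^ k) V.character =
      (p : ℂ)⁻¹ * (V.character 1 - if Fintype.card F % p = 1 then 1 else 0) := by
  rw [restMult_eq_of_forall_ne_one H (θ ^ k) (pow_ne_one_of_injective hp H hH θ hθ hk0 hk)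
    V.character _ (character_eq_ite h8 V hdim hp hp2 hpF hpq H hH), hH]

lemma natCast_ne_zero_of_coprime_card {p : ℕ} (h : Nat.Coprime (Fintype.card F) p) :
    (p : F) ≠ 0 := by
  intro h0
  obtain ⟨r, hr⟩ := CharP.exists F
  have hrp : r ∣ p := (CharP.cast_eq_zero_iff F r p).mp h0
  have hr1 : r ∣ Fintype.card F :=
    (CharP.cast_eq_zero_iff F r _).mp (FiniteField.cast_card_eq_zero F)
  have : r = 1 := Nat.eq_one_of_dvd_coprimes h hr1 hrp
  subst this
  exact CharP.ringChar_ne_one (R := F) (CharP.eq F (ringChar.charP F) hr)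

end ProjectiveCharacter

theorem ramification_module_q5mod8
    (q : ℕ) (hq : IsPrimePow q) (hgcd : Nat.Coprime q 42)
    (hq7 : q % 7 = 1 ∨ q % 7 = 6)
    (F : Type) [Field F] [Fintype F] (hF : Fintype.card F = q)
    (H2 H3 H7 : Subgroup (PSL2 F))
    (hH2 : Nat.card H2 = 2) (hH3 : Nat.card H3 = 3) (hH7 : Nat.card H7 = 7)
    (θ2 : H2 →* ℂˣ) (θ3 : H3 →* ℂˣ) (θ7 : H7 →* ℂˣ)
    (hθ2 : Function.Injective θ2) (hθ3 : Function.Injective θ3)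
    (hθ7 : Function.Injective θ7)
    (hq8 : q % 8 = 5)
    (χ : PSL2 F → ℂ) (hχ : IsIrrCharacter (PSL2 F) χ) (hdeg : χ 1 = ((q : ℂ) + 1) / 2)
    :
    ramMult H2 H3 H7 θ2 θ3 θ7 χ = ((baseMult q : ℂ) + 1) / 2 := by
  subst hF
  set q := Fintype.card F with hqdef
  obtain ⟨V, hV, rfl⟩ := hχ
  have hdim : 2 * Module.finrank ℂ V = q + 1 := by
    rw [V.char_one] at hdeg
    have : (2 : ℂ) * Module.finrank ℂ V = q + 1 := by
      rw [hdeg]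
      ring
    exact_mod_cast this
  have hc3 : Nat.Coprime q 3 := hgcd.coprime_dvd_right (by norm_num)
  have hc7 : Nat.Coprime q 7 := hgcd.coprime_dvd_right (by norm_num)
  have hq3 : q % 3 = 1 ∨ q % 3 = 2 := by
    have : ¬ 3 ∣ q := fun h => by
      have := Nat.eq_one_of_dvd_coprimes hc3 h dvd_rfl
      omega
    omega
  have h3 : ∀ k : ℕ, k ≠ 0 → k < 3 → restMult H3 (θ3 ^ k) V.character =
      3⁻¹ * (V.character 1 - if q % 3 = 1 then 1 else 0) := fun k hk0 hk =>
    restMult_character_pow hq8 V hdim Nat.prime_three (by norm_num)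
      (natCast_ne_zero_of_coprime_card hc3) (by omega) H3 hH3 θ3 hθ3 hk0 hk
  have h7 : ∀ k : ℕ, k ≠ 0 → k < 7 → restMult H7 (θ7 ^ k) V.character =
      7⁻¹ * (V.character 1 - if q % 7 = 1 then 1 else 0) := fun k hk0 hk =>
    restMult_character_pow hq8 V hdim (by norm_num) (by norm_num)
      (natCast_ne_zero_of_coprime_card hc7) (by omega) H7 hH7 θ7 hθ7 hk0 hk
  have h2 : restMult H2 θ2 V.character = 2⁻¹ * (V.character 1 - (-1)) := by
    have hθ : θ2 ≠ 1 := by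
      have := pow_ne_one_of_injective Nat.prime_two H2 hH2 θ2 hθ2 one_ne_zero one_lt_two
      rwa [show θ2 ^ 1 = θ2 from MonoidHom.ext fun g => pow_one _] at this
    rw [restMult_eq_of_forall_ne_one H2 θ2 hθ V.character (-1), hH2, Nat.cast_ofNat]
    intro h h1
    exact character_of_sq_eq_one hq8 V hdim h (by simpa using h1)
      (H2.coe_pow_eq_one_of_natCard_eq hH2 h)
  have h31 := h3 1 one_ne_zero (by norm_num)
  rw [show θ3 ^ 1 = θ3 from MonoidHom.ext fun g => pow_one _] at h31
  have hbase : (84 * baseMult q : ℤ) = 85 * q - 21 - 28 * (if q % 3 = 1 then 1 else -1)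
      - 36 * (if q % 7 = 1 then 1 else -1) := by
    rw [baseMult]
    split_ifs <;> omega
  have hbase' : (84 * baseMult q : ℂ) = 85 * q - 21 - 28 * (if q % 3 = 1 then 1 else -1)
      - 36 * (if q % 7 = 1 then 1 else -1) := by
    exact_mod_cast congrArg (Int.cast : ℤ → ℂ) hbase
  have hsum7 : ∑ k ∈ Finset.Icc (1 : ℕ) 6, (k : ℂ) * restMult H7 (θ7 ^ k) V.character =
      3 * (V.character 1 - if q % 7 = 1 then 1 else 0) := by
    have hterm : ∀ k ∈ Finset.Icc (1 : ℕ) 6, (k : ℂ) * restMult H7 (θ7 ^ k) V.character =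
        k * (7⁻¹ * (V.character 1 - if q % 7 = 1 then 1 else 0)) := fun k hk => by
      rw [Finset.mem_Icc] at hk
      rw [h7 k (by omega) (by omega)]
    rw [Finset.sum_congr rfl hterm, ← Finset.sum_mul]
    norm_num [Finset.sum_Icc_succ_top]
    ring
  rw [ramMult, h2, h31, h3 2 two_ne_zero (by norm_num), hsum7, hdeg]
  split_ifs at hbase' ⊢ <;> linear_combination (-1 / 168) * hbase'
end
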